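/- arXiv:1906.04639 — 3 statements merged into one kernel-verified Lean document; each statement's English description precedes it below -/
import Mathlib

section
/- Let d ≥ 2. The vector field b_d is locally integrable on ℝ^d, satisfies div b_d = 0 pointwise in the classical sense on ℝ^d ∖ {0}, and is divergence-free in the distributional sense: for every ξ ∈ C_c^∞(ℝ^d), ∫_{ℝ^d} b_d · ∇ξ dx = 0. -/
open MeasureTheory Set Metric Filter
open scoped RealInnerProductSpace ENNReal NNReal Topology

noncomputable section

/-- `ℝ^d` with the Euclidean structure. -/
abbrev E (d : ℕ) := EuclideanSpace ℝ (Fin d)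

/-- The last coordinate `x_d` of `x ∈ ℝ^d`. -/
def xd (d : ℕ) (x : E d) : ℝ := if h : 0 < d then x ⟨d - 1, Nat.sub_lt h one_pos⟩ else 0

/-- The Euclidean norm `|x̄|` of the first `d-1` coordinates of `x ∈ ℝ^d`. -/
def barNorm (d : ℕ) (x : E d) : ℝ :=
  Real.sqrt (∑ i : Fin d, if (i : ℕ) < d - 1 then (x i)^2 else 0)

/-- `σ_m`: the total surface measure of the unit sphere of `ℝ^m`,
which equals `m` times the volume of the unit ball. -/
def sphereArea (m : ℕ) : ℝ := (m : ℝ) * (volume (Metric.ball (0 : E m) 1)).toReal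

/-- The skew-symmetric matrix `M(x̄)` with upper-left `(d-1)×(d-1)` block `0`,
last column `(-x̄, 0)ᵀ` and last row `(x̄ᵀ, 0)`. -/
def Mmat (d : ℕ) (x : E d) : Fin d → Fin d → ℝ := fun i j =>
  if (i : ℕ) < d - 1 ∧ (j : ℕ) = d - 1 then -(x i)
  else if (i : ℕ) = d - 1 ∧ (j : ℕ) < d - 1 then x j
  else 0

/-- Zhikov's matrix field `A_d(x) = θ(|x̄|/|x_d|) σ_{d-1}⁻¹ |x̄|^{1-d} M(x̄)`
(where on the hyperplane `x_d = 0` the factor `θ(|x̄|/|x_d|)` is interpreted as its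
limit value `1`). -/
def Amat (d : ℕ) (θ : ℝ → ℝ) (x : E d) : Fin d → Fin d → ℝ := fun i j =>
  (if xd d x = 0 then 1 else θ (barNorm d x / |xd d x|)) *
    (sphereArea (d-1))⁻¹ * (barNorm d x) ^ ((1:ℝ) - d) * Mmat d x i j

/-- Row-wise divergence of a matrix field: `(div A)_i = ∑ j ∂_j A_{ij}`. -/
def divRow (d : ℕ) (A : E d → Fin d → Fin d → ℝ) (x : E d) : E d :=
  (EuclideanSpace.equiv (Fin d) ℝ).symm
    (fun i => ∑ j : Fin d, fderiv ℝ (fun y => A y i j) x (EuclideanSpace.single j 1))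

/-- Zhikov's vector field `b_d := div A_d` (row-wise divergence). -/
def bZhikov (d : ℕ) (θ : ℝ → ℝ) : E d → E d := divRow d (Amat d θ)

/-- Zhikov's function `u_d(x) = sgn(x_d) θ(|x_d|/|x̄|)`, interpreted as `sgn(x_d)`
when `x̄ = 0`. -/
def uZhikov (d : ℕ) (θ : ℝ → ℝ) (x : E d) : ℝ :=
  if barNorm d x = 0 then Real.sign (xd d x)
  else Real.sign (xd d x) * θ (|xd d x| / barNorm d x)

/-- `θ ∈ C_c^∞((0,∞))` with `1_{(1/2,∞)} ≤ θ ≤ 1_{(1/4,∞)}` and `‖θ'‖_∞ ≤ 6`. -/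
def IsCutoff (θ : ℝ → ℝ) : Prop :=
  ContDiff ℝ (⊤ : ℕ∞) θ ∧ (∀ s, 0 ≤ θ s ∧ θ s ≤ 1) ∧ (∀ s ≤ (4:ℝ)⁻¹, θ s = 0) ∧
    (∀ s, (2:ℝ)⁻¹ ≤ s → θ s = 1) ∧ (∀ s, |deriv θ s| ≤ 6)


lemma z_barSum_contDiff (d : ℕ) :
    ContDiff ℝ (⊤ : ℕ∞) (fun x : E d => ∑ i : Fin d, if (i : ℕ) < d - 1 then (x i)^2 else 0) := by
  apply ContDiff.sum
  intro i _
  split_ifs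
  · fun_prop
  · fun_prop

lemma z_barNorm_nonneg (d : ℕ) (x : E d) : 0 ≤ barNorm d x := Real.sqrt_nonneg _

lemma z_barNorm_continuous (d : ℕ) : Continuous (barNorm d) :=
  (z_barSum_contDiff d).continuous.sqrt

lemma z_xd_contDiff (d : ℕ) : ContDiff ℝ (⊤ : ℕ∞) (xd d) := by
  unfold xd
  split_ifs <;> fun_prop

lemma z_barNorm_contDiffAt (d : ℕ) (x : E d) (hx : barNorm d x ≠ 0) :
    ContDiffAt ℝ (⊤ : ℕ∞) (barNorm d) x := by
  apply ContDiffAt.sqrt (z_barSum_contDiff d).contDiffAt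
  intro h
  apply hx
  simp [barNorm, h]

lemma z_Mmat_contDiff (d : ℕ) (i j : Fin d) :
    ContDiff ℝ (⊤ : ℕ∞) (fun x : E d => Mmat d x i j) := by
  unfold Mmat
  split_ifs <;> fun_prop

lemma z_eq_zero (d : ℕ) (x : E d) (h1 : barNorm d x = 0) (h2 : xd d x = 0) : x = 0 := by
  ext i
  have hd : 0 < d := i.pos
  by_cases hi : (i : ℕ) < d - 1
  · unfold barNorm at h1
    rw [Real.sqrt_eq_zero (Finset.sum_nonneg (fun i _ => by split_ifs <;> positivity)),
      Finset.sum_eq_zero_iff_of_nonneg (fun i _ => by split_ifs <;> positivity)] at h1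
    have := h1 i (Finset.mem_univ i)
    simpa [hi] using this
  · unfold xd at h2
    rw [dif_pos hd] at h2
    have : i = ⟨d - 1, Nat.sub_lt hd one_pos⟩ := by
      ext
      simp
      omega
    rw [this, h2]; simp

lemma z_Amat_contDiffAt (d : ℕ) (θ : ℝ → ℝ) (hθ : IsCutoff θ) (i j : Fin d) (x : E d)
    (hx : x ≠ 0) : ContDiffAt ℝ (⊤ : ℕ∞) (fun y => Amat d θ y i j) x := by
  obtain ⟨hs, hb, h0, h1, -⟩ := hθ
  have cb := z_barNorm_continuous d
  have cx := (z_xd_contDiff d).continuous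
  by_cases hbar : barNorm d x = 0
  · have hxd : xd d x ≠ 0 := fun h => hx (z_eq_zero d x hbar h)
    have : (fun y => Amat d θ y i j) =ᶠ[𝓝 x] fun _ => 0 := by
      have e1 : ∀ᶠ y in 𝓝 x, 4 * barNorm d y < |xd d y| := by
        apply ContinuousAt.eventually_lt
        · exact (cb.const_mul 4).continuousAt
        · exact cx.abs.continuousAt
        · simpa [hbar] using hxd
      filter_upwards [e1] with y hy
      have hp : 0 < |xd d y| := by linarith [z_barNorm_nonneg d y]
      have hn : xd d y ≠ 0 := abs_pos.1 hp
      unfold Amat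
      rw [if_neg hn, h0]
      · simp
      · rw [div_le_iff₀ hp]; linarith
    exact contDiffAt_const.congr_of_eventuallyEq this
  · have hbn := z_barNorm_contDiffAt d x hbar
    unfold Amat
    refine ContDiffAt.mul (ContDiffAt.mul (ContDiffAt.mul ?_ contDiffAt_const) ?_)
      (z_Mmat_contDiff d i j).contDiffAt
    · by_cases hxd : xd d x = 0
      · have : (fun y => if xd d y = 0 then 1 else θ (barNorm d y / |xd d y|))
            =ᶠ[𝓝 x] fun _ => 1 := by
          have e1 : ∀ᶠ y in 𝓝 x, |xd d y| < barNorm d y := by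
            apply ContinuousAt.eventually_lt
            · exact cx.abs.continuousAt
            · exact cb.continuousAt
            · rw [hxd, abs_zero]
              exact lt_of_le_of_ne (z_barNorm_nonneg d x) (Ne.symm hbar)
          filter_upwards [e1] with y hy
          split_ifs with h
          · rfl
          · apply h1
            have hp : 0 < |xd d y| := abs_pos.2 h
            rw [le_div_iff₀ hp]; linarith
        exact contDiffAt_const.congr_of_eventuallyEq this
      · have : (fun y => if xd d y = 0 then 1 else θ (barNorm d y / |xd d y|))
            =ᶠ[𝓝 x] fun y => θ (barNorm d y / |xd d y|) := by
          filter_upwards [cx.continuousAt.eventually_ne hxd] with y hy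
          rw [if_neg hy]
        refine ContDiffAt.congr_of_eventuallyEq ?_ this
        refine hs.contDiffAt.comp x (ContDiffAt.div hbn ?_ (abs_ne_zero.2 hxd))
        exact (contDiffAt_abs hxd).comp x (z_xd_contDiff d).contDiffAt
    · exact hbn.rpow_const_of_ne hbar

lemma z_Amat_homog (d : ℕ) (θ : ℝ → ℝ) (i j : Fin d) (t : ℝ) (ht : 0 < t) (x : E d) :
    Amat d θ (t • x) i j = t ^ ((2:ℝ) - d) * Amat d θ x i j := by
  have hb : barNorm d (t • x) = t * barNorm d x := by
    unfold barNorm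
    rw [← Real.sqrt_sq ht.le, ← Real.sqrt_mul (sq_nonneg _), Finset.mul_sum, Real.sqrt_sq ht.le]
    congr 1
    apply Finset.sum_congr rfl
    intro i _
    split_ifs <;> simp [mul_pow]
  have hx : xd d (t • x) = t * xd d x := by
    unfold xd; split_ifs <;> simp
  have hM : Mmat d (t • x) i j = t * Mmat d x i j := by
    unfold Mmat; split_ifs <;> simp
  unfold Amat
  rw [hb, hx, hM, Real.mul_rpow ht.le (z_barNorm_nonneg d x), abs_mul, abs_of_pos ht,
    mul_div_mul_left _ _ ht.ne', show (2:ℝ) - d = (1 - d) + 1 by ring, Real.rpow_add_one ht.ne']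
  simp only [mul_eq_zero, ht.ne', false_or]
  ring

lemma z_Amat_skew (d : ℕ) (θ : ℝ → ℝ) (i j : Fin d) (x : E d) :
    Amat d θ x i j = - Amat d θ x j i := by
  have : Mmat d x i j = - Mmat d x j i := by
    unfold Mmat; split_ifs <;> first | omega | simp
  unfold Amat
  rw [this]; ring

/-- homogeneous functions continuous off the origin are bounded by a power of the norm -/
lemma z_homog_bound (d : ℕ) (f : E d → ℝ) (k : ℝ) (hc : ContinuousOn f {0}ᶜ)
    (hh : ∀ t : ℝ, 0 < t → ∀ x, x ≠ 0 → f (t • x) = t ^ k * f x) :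
    ∃ C, 0 ≤ C ∧ ∀ x, x ≠ 0 → ‖f x‖ ≤ C * ‖x‖ ^ k := by
  obtain ⟨C, hC⟩ := (isCompact_sphere (0 : E d) 1).exists_bound_of_continuousOn
    (hc.mono (fun x hx => by
      simp only [mem_sphere_iff_norm, sub_zero] at hx
      simp only [mem_compl_iff, mem_singleton_iff]
      rintro rfl
      simp at hx))
  refine ⟨max C 0, le_max_right _ _, fun x hx => ?_⟩
  have hn : 0 < ‖x‖ := norm_pos_iff.2 hx
  have h1 := hC (‖x‖⁻¹ • x) (by simp [norm_smul, hn.ne'])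
  have h2 := hh ‖x‖ hn (‖x‖⁻¹ • x) (by simp [hx])
  rw [smul_smul, mul_inv_cancel₀ hn.ne', one_smul] at h2
  rw [h2, norm_mul, Real.norm_of_nonneg (Real.rpow_nonneg hn.le _), mul_comm]
  gcongr
  exact h1.trans (le_max_left _ _)

lemma z_aesm (d : ℕ) (hd : 2 ≤ d) (f : E d → ℝ) (hc : ContinuousOn f {0}ᶜ) :
    AEStronglyMeasurable f volume := by
  have : Nonempty (Fin d) := ⟨⟨0, by omega⟩⟩
  have h := hc.aestronglyMeasurable (μ := (volume : Measure (E d)))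
    (measurableSet_singleton (0 : E d)).compl
  rwa [Measure.restrict_eq_self_of_ae_mem] at h
  exact compl_mem_ae_iff.2 (measure_singleton 0)

lemma z_locInt (d : ℕ) (hd : 2 ≤ d) (f : E d → ℝ) (C k : ℝ) (hk : 1 - d ≤ k)
    (hc : ContinuousOn f {0}ᶜ)
    (hb : ∀ x, x ≠ 0 → ‖f x‖ ≤ C * ‖x‖ ^ k) : LocallyIntegrable f volume := by
  have : Nonempty (Fin d) := ⟨⟨0, by omega⟩⟩
  refine locallyIntegrable_of_norm_le_rpow (C := C) (α := -k) ?_ ?_ ?_ (z_aesm d hd f hc)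
  · simp; omega
  · simp; linarith
  · have : ∀ᵐ x : E d, x ≠ 0 := compl_mem_ae_iff.2 (measure_singleton 0)
    filter_upwards [this] with x hx
    simpa using hb x hx

lemma z_ibp (d : ℕ) (hd : 2 ≤ d) (f : E d → ℝ) (v : E d) (C C' : ℝ)
    (hf : ∀ x, x ≠ 0 → ContDiffAt ℝ (⊤ : ℕ∞) f x)
    (hfb : ∀ x, x ≠ 0 → ‖f x‖ ≤ C * ‖x‖ ^ ((2:ℝ) - d))
    (hfb' : ∀ x, x ≠ 0 → ‖fderiv ℝ f x v‖ ≤ C' * ‖x‖ ^ ((1:ℝ) - d))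
    (η : E d → ℝ) (hη : ContDiff ℝ (⊤ : ℕ∞) η) (hηc : HasCompactSupport η) :
    ∫ x, f x * fderiv ℝ η x v = - ∫ x, fderiv ℝ f x v * η x := by
  have hne : Nonempty (Fin d) := ⟨⟨0, by omega⟩⟩
  have hae : ∀ᵐ x : E d, x ≠ 0 := compl_mem_ae_iff.2 (measure_singleton 0)
  have fc : ContinuousOn f {0}ᶜ := fun x hx => (hf x hx).continuousAt.continuousWithinAt
  have fc' : ContinuousOn (fun x => fderiv ℝ f x v) {0}ᶜ := fun x hx =>
    (((hf x hx).fderiv_right (m := (⊤ : ℕ∞)) (by simp)).continuousAt.clm_apply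
      continuousAt_const).continuousWithinAt
  have fl : LocallyIntegrable f volume := z_locInt d hd f C _ (by linarith) fc hfb
  have fl' : LocallyIntegrable (fun x => fderiv ℝ f x v) volume :=
    z_locInt d hd _ C' _ le_rfl fc' hfb'
  have fln : LocallyIntegrable (fun x => f x * ‖x‖⁻¹) volume := by
    refine z_locInt d hd _ C ((1:ℝ) - d) le_rfl ?_ ?_
    · refine fc.mul (continuousOn_id.norm.inv₀ ?_)
      intro x hx; exact norm_ne_zero_iff.2 hx
    · intro x hx
      have hn : 0 < ‖x‖ := norm_pos_iff.2 hx
      rw [norm_mul, norm_inv, norm_norm, mul_inv_le_iff₀ hn, mul_assoc,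
        ← Real.rpow_add_one hn.ne']
      rw [show (1:ℝ) - d + 1 = 2 - d by ring]
      exact hfb x hx
  -- the cutoff
  let B : ContDiffBump (0 : E d) := ⟨1, 2, one_pos, one_lt_two⟩
  let φ : E d → ℝ := fun x => 1 - B x
  have hφ : ContDiff ℝ (⊤ : ℕ∞) φ := contDiff_const.sub B.contDiff
  have hφ01 : ∀ x, ‖φ x‖ ≤ 1 := fun x => by
    have h1 := B.nonneg' x
    have h2 := B.le_one (x := x)
    rw [Real.norm_eq_abs, abs_le]; constructor <;> simp only [φ] <;> linarith
  have hφ0 : ∀ x, ‖x‖ ≤ 1 → φ x = 0 := fun x hx => by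
    have := B.one_of_mem_closedBall (x := x) (by simpa [B] using hx)
    simp [φ, this]
  have hφ1 : ∀ x, 2 ≤ ‖x‖ → φ x = 1 := fun x hx => by
    have := B.zero_of_le_dist (x := x) (by simpa [B] using hx)
    simp [φ, this]
  have hφd1 : ∀ x, 2 < ‖x‖ → fderiv ℝ φ x = 0 := fun x hx => by
    have : φ =ᶠ[𝓝 x] fun _ => 1 := by
      filter_upwards [continuous_norm.continuousAt.eventually (lt_mem_nhds hx)] with y hy
      exact hφ1 y hy.le
    rw [this.fderiv_eq]; simp
  obtain ⟨K, hK⟩ : ∃ K, ∀ x, ‖fderiv ℝ φ x‖ ≤ K := by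
    have hcs : HasCompactSupport (fderiv ℝ φ) := by
      apply HasCompactSupport.intro (isCompact_closedBall (0 : E d) 2)
      intro x hx
      apply hφd1
      simpa using hx
    exact hcs.exists_bound_of_continuous (hφ.continuous_fderiv (by simp))
  have hK0 : 0 ≤ K := (norm_nonneg _).trans (hK 0)
  let χ : ℕ → E d → ℝ := fun n x => φ (((n : ℝ) + 1) • x)
  have npos : ∀ n : ℕ, (0 : ℝ) < (n : ℝ) + 1 := fun n => by positivity
  have hχ : ∀ n, ContDiff ℝ (⊤ : ℕ∞) (χ n) := fun n => hφ.comp (contDiff_const_smul _)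
  have hχd : ∀ n x, fderiv ℝ (χ n) x = ((n : ℝ) + 1) • fderiv ℝ φ (((n : ℝ) + 1) • x) :=
    fun n x => fderiv_comp_smul _
  have hχdb : ∀ n x, x ≠ 0 → ‖fderiv ℝ (χ n) x v‖ ≤ 2 * K * ‖v‖ * ‖x‖⁻¹ := fun n x hx => by
    have hn : 0 < ‖x‖ := norm_pos_iff.2 hx
    rw [hχd]
    by_cases h : 2 < ‖((n : ℝ) + 1) • x‖
    · rw [hφd1 _ h]; simp; positivity
    · rw [norm_smul, Real.norm_of_nonneg (npos n).le, not_lt] at h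
      have h1 : (n : ℝ) + 1 ≤ 2 * ‖x‖⁻¹ := by
        rw [← div_eq_mul_inv, le_div_iff₀ hn]; exact h
      calc _ ≤ ‖((n : ℝ) + 1) • fderiv ℝ φ (((n : ℝ) + 1) • x)‖ * ‖v‖ :=
            ContinuousLinearMap.le_opNorm _ _
        _ = ((n : ℝ) + 1) * ‖fderiv ℝ φ (((n : ℝ) + 1) • x)‖ * ‖v‖ := by
            rw [norm_smul, Real.norm_of_nonneg (npos n).le]
        _ ≤ (2 * ‖x‖⁻¹) * K * ‖v‖ := by
            gcongr; exact hK _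
        _ = _ := by ring
  have hev : ∀ x : E d, x ≠ 0 → ∀ᶠ n : ℕ in atTop, 2 < ‖((n : ℝ) + 1) • x‖ := fun x hx => by
    have hn : 0 < ‖x‖ := norm_pos_iff.2 hx
    have : Tendsto (fun n : ℕ => ((n : ℝ) + 1) * ‖x‖) atTop atTop :=
      (tendsto_atTop_add_const_right _ _ tendsto_natCast_atTop_atTop).atTop_mul_const hn
    filter_upwards [this.eventually_gt_atTop 2] with n h
    rwa [norm_smul, Real.norm_of_nonneg (npos n).le]
  have hηd : Continuous (fun x => fderiv ℝ η x v) :=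
    (hη.continuous_fderiv (by simp)).clm_apply continuous_const
  have hηdc : HasCompactSupport (fun x => fderiv ℝ η x v) := hηc.fderiv_apply (𝕜 := ℝ) v
  let g : ℕ → E d → ℝ := fun n x => χ n x * η x
  have hg : ∀ n, ContDiff ℝ (⊤ : ℕ∞) (g n) := fun n => (hχ n).mul hη
  have hgc : ∀ n, HasCompactSupport (g n) := fun n => hηc.mul_left
  have hgd : ∀ n x, fderiv ℝ (g n) x v = χ n x * fderiv ℝ η x v + η x * fderiv ℝ (χ n) x v := by
    intro n x
    have := fderiv_fun_mul ((hχ n).differentiable (by simp) x) (hη.differentiable (by simp) x)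
    simp only [g]
    rw [this]; simp
  have hgs : ∀ n, ∀ x ∈ tsupport (g n), x ≠ 0 := by
    rintro n x hx rfl
    revert hx
    rw [imp_false, notMem_tsupport_iff_eventuallyEq]
    have : ∀ᶠ y : E d in 𝓝 0, ((n : ℝ) + 1) * ‖y‖ < 1 := by
      apply ContinuousAt.eventually_lt
      · fun_prop
      · fun_prop
      · simp
    filter_upwards [this] with y hy
    simp only [g, χ]
    rw [hφ0]
    · simp
    · rw [norm_smul, Real.norm_of_nonneg (npos n).le]; exact hy.le
  have key : ∀ n, ∫ x, f x * fderiv ℝ (g n) x v = - ∫ x, fderiv ℝ f x v * g n x := by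
    intro n
    have hgdc : Continuous (fun x => fderiv ℝ (g n) x v) :=
      ((hg n).continuous_fderiv (by simp)).clm_apply continuous_const
    apply integral_mul_fderiv_eq_neg_fderiv_mul_of_integrable
    · exact fl'.integrable_smul_right_of_hasCompactSupport (hg n).continuous (hgc n)
    · exact fl.integrable_smul_right_of_hasCompactSupport hgdc ((hgc n).fderiv_apply (𝕜 := ℝ) v)
    · exact fl.integrable_smul_right_of_hasCompactSupport (hg n).continuous (hgc n)
    · intro x hx
      exact (hf x (hgs n x hx)).differentiableAt (by simp)
    · intro x _
      exact (hg n).differentiable (by simp) x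
  have i1 : Integrable (fun x => f x * fderiv ℝ η x v) :=
    fl.integrable_smul_right_of_hasCompactSupport hηd hηdc
  have i2 : Integrable (fun x => fderiv ℝ f x v * η x) :=
    fl'.integrable_smul_right_of_hasCompactSupport hη.continuous hηc
  have i3 : Integrable (fun x => (f x * ‖x‖⁻¹) * η x) :=
    fln.integrable_smul_right_of_hasCompactSupport hη.continuous hηc
  have l1 : Tendsto (fun n => ∫ x, f x * fderiv ℝ (g n) x v) atTop
      (𝓝 (∫ x, f x * fderiv ℝ η x v)) := by
    apply tendsto_integral_of_dominated_convergence
      (fun x => ‖f x * fderiv ℝ η x v‖ + 2 * K * ‖v‖ * ‖(f x * ‖x‖⁻¹) * η x‖)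
    · intro n
      have hgdc : Continuous (fun x => fderiv ℝ (g n) x v) :=
        ((hg n).continuous_fderiv (by simp)).clm_apply continuous_const
      exact fl.aestronglyMeasurable.mul hgdc.aestronglyMeasurable
    · exact i1.norm.add (i3.norm.const_mul _)
    · intro n
      filter_upwards [hae] with x hx
      rw [hgd, mul_add]
      refine (norm_add_le _ _).trans (add_le_add ?_ ?_)
      · rw [norm_mul, norm_mul, norm_mul]
        have := hφ01 (((n : ℝ) + 1) • x)
        gcongr
        exact mul_le_of_le_one_left (norm_nonneg _) this
      · rw [norm_mul, norm_mul, norm_mul, norm_mul, norm_inv, norm_norm]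
        calc _ ≤ ‖f x‖ * (‖η x‖ * (2 * K * ‖v‖ * ‖x‖⁻¹)) := by
              gcongr; exact hχdb n x hx
          _ = _ := by ring
    · filter_upwards [hae] with x hx
      apply tendsto_const_nhds.congr'
      filter_upwards [hev x hx] with n hn
      rw [hgd, hχd, hφd1 _ hn]
      simp only [χ]
      rw [hφ1 _ hn.le]; simp
  have l2 : Tendsto (fun n => - ∫ x, fderiv ℝ f x v * g n x) atTop
      (𝓝 (- ∫ x, fderiv ℝ f x v * η x)) := by
    apply Tendsto.neg
    apply tendsto_integral_of_dominated_convergence (fun x => ‖fderiv ℝ f x v * η x‖)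
    · intro n
      exact fl'.aestronglyMeasurable.mul (hg n).continuous.aestronglyMeasurable
    · exact i2.norm
    · intro n
      filter_upwards [] with x
      have h1 := hφ01 (((n : ℝ) + 1) • x)
      have h2 : ‖g n x‖ ≤ ‖η x‖ := by
        simp only [g, χ]
        rw [norm_mul]
        exact mul_le_of_le_one_left (norm_nonneg _) h1
      rw [norm_mul (fderiv ℝ f x v) (g n x), norm_mul (fderiv ℝ f x v) (η x)]
      exact mul_le_mul_of_nonneg_left h2 (norm_nonneg _)
    · filter_upwards [hae] with x hx
      apply tendsto_const_nhds.congr'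
      filter_upwards [hev x hx] with n hn
      simp only [g, χ]
      rw [hφ1 _ hn.le]; simp
  simp_rw [key] at l1
  exact tendsto_nhds_unique l1 l2

lemma z_b_apply (d : ℕ) (θ : ℝ → ℝ) (x : E d) (i : Fin d) : bZhikov d θ x i =
    ∑ j : Fin d, fderiv ℝ (fun y => Amat d θ y i j) x (EuclideanSpace.single j 1) := rfl

lemma z_dA_contDiffAt (d : ℕ) (θ : ℝ → ℝ) (hθ : IsCutoff θ) (i j : Fin d) (v : E d) (x : E d)
    (hx : x ≠ 0) :
    ContDiffAt ℝ (⊤ : ℕ∞) (fun x => fderiv ℝ (fun y => Amat d θ y i j) x v) x :=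
  ((z_Amat_contDiffAt d θ hθ i j x hx).fderiv_right (m := (⊤ : ℕ∞)) (by simp)).clm_apply
    contDiffAt_const

lemma z_A_bound (d : ℕ) (θ : ℝ → ℝ) (hθ : IsCutoff θ) (i j : Fin d) :
    ∃ C, 0 ≤ C ∧ ∀ x : E d, x ≠ 0 → ‖Amat d θ x i j‖ ≤ C * ‖x‖ ^ ((2:ℝ) - d) :=
  z_homog_bound d _ _ (fun x hx =>
    (z_Amat_contDiffAt d θ hθ i j x hx).continuousAt.continuousWithinAt)
    (fun t ht x _ => z_Amat_homog d θ i j t ht x)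

lemma z_dA_bound (d : ℕ) (θ : ℝ → ℝ) (hθ : IsCutoff θ) (i j : Fin d) (v : E d) :
    ∃ C, 0 ≤ C ∧ ∀ x : E d, x ≠ 0 →
      ‖fderiv ℝ (fun y => Amat d θ y i j) x v‖ ≤ C * ‖x‖ ^ ((1:ℝ) - d) := by
  refine z_homog_bound d (fun x => fderiv ℝ (fun y => Amat d θ y i j) x v) _ (fun x hx =>
    (z_dA_contDiffAt d θ hθ i j v x hx).continuousAt.continuousWithinAt) ?_
  intro t ht x hx
  have h1 : fderiv ℝ (fun y => Amat d θ (t • y) i j) x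
      = t • fderiv ℝ (fun y => Amat d θ y i j) (t • x) :=
    fderiv_comp_smul (f := fun y => Amat d θ y i j) t
  have h2 : (fun y => Amat d θ (t • y) i j) = fun y => t ^ ((2:ℝ) - d) * Amat d θ y i j :=
    funext fun y => z_Amat_homog d θ i j t ht y
  rw [h2, fderiv_const_mul ((z_Amat_contDiffAt d θ hθ i j x hx).differentiableAt (by simp))] at h1
  have h3 := congrArg (fun L => L v) h1
  simp only [_root_.smul_apply, smul_eq_mul] at h3
  rw [show (2:ℝ) - d = (1 - d) + 1 by ring, Real.rpow_add_one ht.ne'] at h3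
  apply mul_left_cancel₀ ht.ne'
  rw [← h3]; ring

lemma z_dA_locInt (d : ℕ) (hd : 2 ≤ d) (θ : ℝ → ℝ) (hθ : IsCutoff θ) (i j : Fin d) (v : E d) :
    LocallyIntegrable (fun x => fderiv ℝ (fun y => Amat d θ y i j) x v) volume := by
  obtain ⟨C, -, hC⟩ := z_dA_bound d θ hθ i j v
  exact z_locInt d hd _ C _ le_rfl (fun x hx =>
    (z_dA_contDiffAt d θ hθ i j v x hx).continuousAt.continuousWithinAt) hC

lemma z_b_locInt (d : ℕ) (hd : 2 ≤ d) (θ : ℝ → ℝ) (hθ : IsCutoff θ) :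
    LocallyIntegrable (bZhikov d θ) (volume : Measure (E d)) := by
  have h : bZhikov d θ = fun x => ∑ i : Fin d, ∑ j : Fin d,
      fderiv ℝ (fun y => Amat d θ y i j) x (EuclideanSpace.single j 1) •
        (EuclideanSpace.single i (1:ℝ) : E d) := by
    funext x
    ext k
    rw [z_b_apply]
    simp [Finset.sum_apply, Pi.single_apply]
  rw [h]
  refine locallyIntegrable_finsetSum _ fun i _ => locallyIntegrable_finsetSum _ fun j _ => ?_
  intro x
  obtain ⟨s, hs, hi⟩ := z_dA_locInt d hd θ hθ i j (EuclideanSpace.single j 1) x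
  exact ⟨s, hs, hi.smul_const _⟩

lemma z_skew_sum {d : ℕ} (F : Fin d → Fin d → ℝ) (h : ∀ i j, F i j = - F j i) :
    ∑ i, ∑ j, F i j = 0 := by
  have h1 : ∑ i, ∑ j, F i j = - ∑ i, ∑ j, F i j := by
    conv_rhs => rw [Finset.sum_comm]
    rw [← Finset.sum_neg_distrib]
    refine Finset.sum_congr rfl fun i _ => ?_
    rw [← Finset.sum_neg_distrib]
    exact Finset.sum_congr rfl fun j _ => h i j
  linarith

lemma z_sum_comp {d : ℕ} {θ : ℝ → ℝ} (i j : Fin d) :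
    (fun y => Amat d θ y i j) = fun y => - Amat d θ y j i :=
  funext fun y => z_Amat_skew d θ i j y

lemma z_fderiv_dir {d : ℕ} (f : E d → ℝ) (x v w : E d) (hf : ContDiffAt ℝ (⊤ : ℕ∞) f x) :
    fderiv ℝ (fun y => fderiv ℝ f y v) x w = fderiv ℝ (fderiv ℝ f) x w v := by
  have h := (hf.fderiv_right (m := (⊤ : ℕ∞)) (by simp)).differentiableAt (by simp)
  rw [fderiv_clm_apply h (differentiableAt_const v)]
  simp

lemma z_symm {d : ℕ} (f : E d → ℝ) (x v w : E d) (hf : ContDiffAt ℝ (⊤ : ℕ∞) f x) :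
    fderiv ℝ (fun y => fderiv ℝ f y v) x w = fderiv ℝ (fun y => fderiv ℝ f y w) x v := by
  rw [z_fderiv_dir f x v w hf, z_fderiv_dir f x w v hf]
  exact (hf.isSymmSndFDerivAt (by simpa using (WithTop.coe_le_coe.2 (le_top : (2 : ℕ∞) ≤ ⊤)))) w v

lemma z_classical (d : ℕ) (θ : ℝ → ℝ) (hθ : IsCutoff θ) (x : E d) (hx : x ≠ 0) :
    ∑ i : Fin d, fderiv ℝ (fun y => bZhikov d θ y i) x (EuclideanSpace.single i 1) = 0 := by
  simp_rw [z_b_apply]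
  have h : ∀ i : Fin d, fderiv ℝ (fun y => ∑ j : Fin d,
      fderiv ℝ (fun y => Amat d θ y i j) y (EuclideanSpace.single j 1)) x
        (EuclideanSpace.single i 1) = ∑ j : Fin d, fderiv ℝ (fun y =>
      fderiv ℝ (fun y => Amat d θ y i j) y (EuclideanSpace.single j 1)) x
        (EuclideanSpace.single i 1) := by
    intro i
    rw [fderiv_fun_sum (fun j _ => (z_dA_contDiffAt d θ hθ i j _ x hx).differentiableAt (by simp))]
    simp
  simp_rw [h]
  apply z_skew_sum
  intro i j
  rw [z_symm _ _ _ _ (z_Amat_contDiffAt d θ hθ i j x hx)]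
  rw [z_sum_comp i j]
  simp only [fderiv_fun_neg, _root_.neg_apply]

lemma z_distr (d : ℕ) (hd : 2 ≤ d) (θ : ℝ → ℝ) (hθ : IsCutoff θ) (ξ : E d → ℝ)
    (hξ : ContDiff ℝ (⊤ : ℕ∞) ξ) (hc : HasCompactSupport ξ) :
    ∫ x : E d, ⟪bZhikov d θ x, gradient ξ x⟫ = 0 := by
  have e : ∀ x : E d, ⟪bZhikov d θ x, gradient ξ x⟫ = ∑ i : Fin d, ∑ j : Fin d,
      fderiv ℝ (fun y => Amat d θ y i j) x (EuclideanSpace.single j 1) *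
        fderiv ℝ ξ x (EuclideanSpace.single i 1) := by
    intro x
    rw [PiLp.inner_apply]
    refine Finset.sum_congr rfl fun i _ => ?_
    have : gradient ξ x i = fderiv ℝ ξ x (EuclideanSpace.single i 1) := by
      rw [← InnerProductSpace.toDual_symm_apply (𝕜 := ℝ)]
      rw [EuclideanSpace.inner_single_right]
      simp [gradient]
    rw [this, z_b_apply, ← Finset.sum_mul]
    simp [mul_comm]
  simp_rw [e]
  have hd1 : ∀ i : Fin d, ContDiff ℝ (⊤ : ℕ∞)
      (fun x => fderiv ℝ ξ x (EuclideanSpace.single i 1)) := fun i =>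
    (hξ.fderiv_right (m := (⊤ : ℕ∞)) (by simp)).clm_apply contDiff_const
  have hc1 : ∀ i : Fin d, HasCompactSupport
      (fun x => fderiv ℝ ξ x (EuclideanSpace.single i 1)) := fun i => hc.fderiv_apply (𝕜 := ℝ) _
  have hint : ∀ i j : Fin d, Integrable (fun x : E d =>
      fderiv ℝ (fun y => Amat d θ y i j) x (EuclideanSpace.single j 1) *
        fderiv ℝ ξ x (EuclideanSpace.single i 1)) := fun i j =>
    (z_dA_locInt d hd θ hθ i j _).integrable_smul_right_of_hasCompactSupport
      (hd1 i).continuous (hc1 i)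
  rw [integral_finsetSum _ (fun i _ => integrable_finsetSum _ fun j _ => hint i j)]
  simp_rw [fun i => integral_finsetSum Finset.univ (fun j _ => hint i j)]
  have ibp : ∀ i j : Fin d, ∫ x : E d,
      fderiv ℝ (fun y => Amat d θ y i j) x (EuclideanSpace.single j 1) *
        fderiv ℝ ξ x (EuclideanSpace.single i 1) = - ∫ x : E d, Amat d θ x i j *
        fderiv ℝ (fun x => fderiv ℝ ξ x (EuclideanSpace.single i 1)) x
          (EuclideanSpace.single j 1) := by
    intro i j
    obtain ⟨C, -, hC⟩ := z_A_bound d θ hθ i j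
    obtain ⟨C', -, hC'⟩ := z_dA_bound d θ hθ i j (EuclideanSpace.single j 1)
    rw [z_ibp d hd (fun y => Amat d θ y i j) (EuclideanSpace.single j 1) C C'
      (fun x hx => z_Amat_contDiffAt d θ hθ i j x hx) hC hC' _ (hd1 i) (hc1 i), neg_neg]
  apply z_skew_sum
  intro i j
  rw [ibp, ibp, neg_neg, ← integral_neg]
  refine integral_congr_ae (Eventually.of_forall fun x => ?_)
  simp only
  rw [z_Amat_skew, z_symm ξ x _ _ hξ.contDiffAt]
  ring

/-- For `d ≥ 2`, the vector field `b_d` is locally integrable on `ℝ^d`,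
satisfies `div b_d = 0` pointwise in the classical sense on `ℝ^d ∖ {0}`, and is
divergence-free in the distributional sense: `∫ b_d · ∇ξ = 0` for every `ξ ∈ C_c^∞(ℝ^d)`. -/
theorem statement_1 (d : ℕ) (hd : 2 ≤ d) (θ : ℝ → ℝ) (hθ : IsCutoff θ) :
    LocallyIntegrable (bZhikov d θ) (volume : Measure (E d)) ∧
    (∀ x : E d, x ≠ 0 →
      ∑ i : Fin d, fderiv ℝ (fun y => bZhikov d θ y i) x (EuclideanSpace.single i 1) = 0) ∧
    (∀ ξ : E d → ℝ, ContDiff ℝ (⊤ : ℕ∞) ξ → HasCompactSupport ξ →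
      ∫ x : E d, ⟪bZhikov d θ x, gradient ξ x⟫ = 0) := by
  exact ⟨z_b_locInt d hd θ hθ, z_classical d θ hθ, z_distr d hd θ hθ⟩
end
end

section
/- Let d ≥ 2. The map x̄ ↦ b_d(x̄, 1) from ℝ^{d−1} to ℝ^d is C^∞ with compact support contained in {x̄ ∈ ℝ^{d−1} : 1/4 ≤ |x̄| ≤ 1/2} ⊂ (−1,1)^{d−1}, and ∫_{ℝ^{d−1}} b_d(x̄, 1) · e_d dx̄ = 1, where e_d is the d-th standard basis vector of ℝ^d. -/
open MeasureTheory Set Metric Filter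
open scoped RealInnerProductSpace ENNReal NNReal Topology

noncomputable section

/-- The point `(ȳ, t) ∈ ℝ^d` built from `ȳ ∈ ℝ^{d-1}` and a last coordinate `t`. -/
def withLast (d : ℕ) (y : E (d-1)) (t : ℝ) : E d :=
  (EuclideanSpace.equiv (Fin d) ℝ).symm
    (fun i => if h : (i : ℕ) < d - 1 then y ⟨i, h⟩ else t)

/-- The scalar factor of the slice. -/
def cRad (n : ℕ) (θ : ℝ → ℝ) (r : ℝ) : ℝ :=
  (sphereArea n)⁻¹ * deriv θ r * (r ^ (n-1 : ℕ))⁻¹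

lemma barNorm_succ (n : ℕ) (x : E (n+1)) :
    barNorm (n+1) x = Real.sqrt (∑ i : Fin n, (x i.castSucc)^2) := by
  simp [barNorm, Fin.sum_univ_castSucc]

lemma xd_succ (n : ℕ) (x : E (n+1)) : xd (n+1) x = x (Fin.last n) := by
  simp [xd, Fin.last]

lemma withLast_castSucc (n : ℕ) (y : E n) (t : ℝ) (i : Fin n) :
    (withLast (n+1) y t : E (n+1)) i.castSucc = y i := by
  simp [withLast]

lemma withLast_last (n : ℕ) (y : E n) (t : ℝ) :
    (withLast (n+1) y t : E (n+1)) (Fin.last n) = t := by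
  simp [withLast]

lemma barNorm_withLast (n : ℕ) (y : E n) (t : ℝ) :
    barNorm (n+1) (withLast (n+1) y t) = ‖y‖ := by
  rw [barNorm_succ, EuclideanSpace.norm_eq]
  simp only [withLast_castSucc, Real.norm_eq_abs, sq_abs]

lemma continuous_barNorm (n : ℕ) : Continuous (barNorm (n+1)) := by
  have : barNorm (n+1) = fun x => Real.sqrt (∑ i : Fin n, (x i.castSucc)^2) := by
    funext x; exact barNorm_succ n x
  rw [this]; fun_prop

lemma deriv_zero_lo {θ : ℝ → ℝ} (h : ∀ s ≤ (4:ℝ)⁻¹, θ s = 0) {s : ℝ} (hs : s < (4:ℝ)⁻¹) :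
    deriv θ s = 0 := by
  have : θ =ᶠ[𝓝 s] fun _ => 0 := by
    filter_upwards [Iio_mem_nhds hs] with a ha using h a (le_of_lt ha)
  rw [this.deriv_eq]; simp

lemma deriv_zero_hi {θ : ℝ → ℝ} (h : ∀ s, (2:ℝ)⁻¹ ≤ s → θ s = 1) {s : ℝ} (hs : (2:ℝ)⁻¹ < s) :
    deriv θ s = 0 := by
  have : θ =ᶠ[𝓝 s] fun _ => 1 := by
    filter_upwards [Ioi_mem_nhds hs] with a ha using h a (le_of_lt ha)
  rw [this.deriv_eq]; simp

lemma Mmat_last_castSucc (n : ℕ) (x : E (n+1)) (j : Fin n) :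
    Mmat (n+1) x (Fin.last n) j.castSucc = x j.castSucc := by simp [Mmat]
lemma Mmat_castSucc_last (n : ℕ) (x : E (n+1)) (j : Fin n) :
    Mmat (n+1) x j.castSucc (Fin.last n) = - x j.castSucc := by simp [Mmat]
lemma Mmat_last_last (n : ℕ) (x : E (n+1)) :
    Mmat (n+1) x (Fin.last n) (Fin.last n) = 0 := by simp [Mmat]
lemma Mmat_castSucc_castSucc (n : ℕ) (x : E (n+1)) (i j : Fin n) :
    Mmat (n+1) x i.castSucc j.castSucc = 0 := by
  have := i.2; have := j.2
  have h1 : (i : ℕ) ≠ n := by omega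
  have h2 : (j : ℕ) ≠ n := by omega
  simp [Mmat, h1, h2]

/-- scalar factor of `Amat`. -/
def phi (n : ℕ) (θ : ℝ → ℝ) (x : E (n+1)) : ℝ :=
  (if xd (n+1) x = 0 then 1 else θ (barNorm (n+1) x / |xd (n+1) x|)) *
    (sphereArea n)⁻¹ * (barNorm (n+1) x) ^ ((1:ℝ) - (n+1 : ℕ))

lemma hasFDerivAt_barNorm (n : ℕ) (x : E (n+1)) (hx : 0 < barNorm (n+1) x) :
    HasFDerivAt (barNorm (n+1))
      ((barNorm (n+1) x)⁻¹ • ∑ i : Fin n, (x i.castSucc) •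
        (EuclideanSpace.proj i.castSucc : E (n+1) →L[ℝ] ℝ)) x := by
  have e : barNorm (n+1) = fun x => Real.sqrt (∑ i : Fin n, (x i.castSucc)^2) := by
    funext x; exact barNorm_succ n x
  have h1 : HasFDerivAt (fun x : E (n+1) => ∑ i : Fin n, (x i.castSucc)^2)
      (∑ i : Fin n, (2 * x i.castSucc) •
        (EuclideanSpace.proj i.castSucc : E (n+1) →L[ℝ] ℝ)) x := by
    apply HasFDerivAt.fun_sum
    intro i _
    have := ((EuclideanSpace.proj i.castSucc : E (n+1) →L[ℝ] ℝ).hasFDerivAt (x := x)).pow 2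
    simpa using this
  have hb := barNorm_succ n x
  have hne : (∑ i : Fin n, (x i.castSucc)^2) ≠ 0 := by
    intro h; rw [hb, h] at hx; simp at hx
  have h2 := h1.sqrt hne
  rw [← hb] at h2
  rw [e]
  refine h2.congr_fderiv ?_
  rw [Finset.smul_sum, Finset.smul_sum]
  refine Finset.sum_congr rfl fun i _ => ?_
  rw [smul_smul, smul_smul]; congr 1; field_simp; rw [← hb, mul_comm]

/-- Derivative of the scalar factor. -/
lemma hasFDerivAt_phi (n : ℕ) (θ : ℝ → ℝ) (hθ : Differentiable ℝ θ) (x : E (n+1))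
    (hx : 0 < barNorm (n+1) x) (h1 : x (Fin.last n) = 1) :
    ∃ L : E (n+1) →L[ℝ] ℝ, HasFDerivAt (phi n θ) L x ∧
      (∀ j : Fin n, L (EuclideanSpace.single j.castSucc 1) =
        (deriv θ (barNorm (n+1) x) * (sphereArea n)⁻¹ * ((barNorm (n+1) x)^n)⁻¹ -
          n * θ (barNorm (n+1) x) * (sphereArea n)⁻¹ * ((barNorm (n+1) x)^(n+1))⁻¹)
          * (x j.castSucc / barNorm (n+1) x)) ∧
      L (EuclideanSpace.single (Fin.last n) 1) =
        - (deriv θ (barNorm (n+1) x) * (sphereArea n)⁻¹ * ((barNorm (n+1) x)^n)⁻¹ *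
          barNorm (n+1) x) := by
  have hl : HasFDerivAt (fun x : E (n+1) => x (Fin.last n))
      (EuclideanSpace.proj (Fin.last n) : E (n+1) →L[ℝ] ℝ) x :=
    (EuclideanSpace.proj (Fin.last n) : E (n+1) →L[ℝ] ℝ).hasFDerivAt
  have hb := hasFDerivAt_barNorm n x hx
  set r := barNorm (n+1) x with hr
  have hli : HasFDerivAt (fun x : E (n+1) => (x (Fin.last n))⁻¹) _ x :=
    (hasDerivAt_inv (x := x (Fin.last n)) (by rw [h1]; norm_num)).comp_hasFDerivAt x hl
  have hq := hb.mul hli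
  have hθ' : HasDerivAt θ (deriv θ r) (r * (x (Fin.last n))⁻¹) := by
    rw [h1]; simpa using (hθ r).hasDerivAt
  have hT := hθ'.comp_hasFDerivAt x hq
  have hp : HasDerivAt (fun s : ℝ => (s^n)⁻¹) (-(n * r^(n-1)) / (r^n)^2) r :=
    (hasDerivAt_pow n r).inv (by positivity)
  have hP := hp.comp_hasFDerivAt x hb
  have hF := (hT.mul_const ((sphereArea n)⁻¹)).mul hP
  have key : -(n * r^(n-1)) / (r^n)^2 = - n * (r^(n+1))⁻¹ := by
    rcases n with _ | m
    · simp
    · simp only [Nat.add_sub_cancel]; field_simp; ring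
  refine ⟨_, hF.congr_of_eventuallyEq ?_, ?_, ?_⟩
  · have : ∀ᶠ z in 𝓝 x, (0:ℝ) < z (Fin.last n) := by
      have hc : ContinuousAt (fun z : E (n+1) => z (Fin.last n)) x := hl.continuousAt
      apply hc.eventually (Ioi_mem_nhds _); beta_reduce; rw [h1]; norm_num
    filter_upwards [this] with z hz
    have hbz : 0 ≤ barNorm (n+1) z := Real.sqrt_nonneg _
    have : (1:ℝ) - ((n+1 : ℕ):ℝ) = -(n:ℝ) := by push_cast; ring
    simp only [phi, xd_succ, if_neg hz.ne', abs_of_pos hz, this, Real.rpow_neg hbz,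
      Real.rpow_natCast, Pi.mul_apply, Function.comp, div_eq_mul_inv]
  · intro j
    simp [h1, ← hr, key, PiLp.single_apply, Fin.castSucc_ne_last, (Fin.castSucc_ne_last _).symm, -mul_eq_mul_left_iff, -mul_eq_mul_right_iff]
    ring
  · simp [h1, ← hr, key, PiLp.single_apply, Fin.castSucc_ne_last]
    ring

lemma sphereArea_pos (n : ℕ) (hn : 1 ≤ n) : 0 < sphereArea n := by
  unfold sphereArea
  have h : 0 < (volume (Metric.ball (0 : E n) 1)).toReal :=
    ENNReal.toReal_pos (measure_ball_pos _ _ one_pos).ne' measure_ball_lt_top.ne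
  have : (0:ℝ) < n := by exact_mod_cast hn
  positivity

lemma bZhikov_apply (n : ℕ) (θ : ℝ → ℝ) (x : E (n+1)) (i : Fin (n+1)) :
    bZhikov (n+1) θ x i = ∑ j : Fin (n+1),
      fderiv ℝ (fun y => phi n θ y * Mmat (n+1) y i j) x (EuclideanSpace.single j 1) := rfl

/-- Closed form of the slice. -/
lemma bZhikov_slice (n : ℕ) (hn : 1 ≤ n) (θ : ℝ → ℝ) (hθ : IsCutoff θ) (y : E n) :
    bZhikov (n+1) θ (withLast (n+1) y 1) = cRad n θ ‖y‖ • withLast (n+1) y 1 := by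
  obtain ⟨hs, -, hlo, hhi, -⟩ := hθ
  set x : E (n+1) := withLast (n+1) y 1 with hxdef
  have hbx : barNorm (n+1) x = ‖y‖ := barNorm_withLast n y 1
  have hx1 : x (Fin.last n) = 1 := withLast_last n y 1
  by_cases hy : ‖y‖ < (4:ℝ)⁻¹
  · have hev : ∀ᶠ z in 𝓝 x, phi n θ z = 0 := by
      have hc : ContinuousAt (fun z : E (n+1) => z (Fin.last n)) x := by fun_prop
      have hc1 : ∀ᶠ z in 𝓝 x, (0:ℝ) < z (Fin.last n) := by
        apply hc.eventually (Ioi_mem_nhds _); beta_reduce; rw [hx1]; norm_num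
      have hc2 : ∀ᶠ z in 𝓝 x, barNorm (n+1) z - (4:ℝ)⁻¹ * z (Fin.last n) < 0 := by
        have : ContinuousAt (fun z : E (n+1) => barNorm (n+1) z - (4:ℝ)⁻¹ * z (Fin.last n)) x := by
          have := continuous_barNorm n
          fun_prop
        apply this.eventually (Iio_mem_nhds _); beta_reduce; rw [hx1, hbx]; linarith
      filter_upwards [hc1, hc2] with z h1 h2
      have : θ (barNorm (n+1) z / z (Fin.last n)) = 0 := by
        apply hlo; rw [div_le_iff₀ h1]; linarith
      simp [phi, xd_succ, h1.ne', abs_of_pos h1, this]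
    have hc0 : cRad n θ ‖y‖ = 0 := by simp [cRad, deriv_zero_lo hlo hy]
    rw [hc0, zero_smul]
    ext i
    rw [bZhikov_apply]
    apply Finset.sum_eq_zero
    intro j _
    have : (fun z => phi n θ z * Mmat (n+1) z i j) =ᶠ[𝓝 x] fun _ => 0 := by
      filter_upwards [hev] with z hz; simp [hz]
    rw [this.fderiv_eq]; simp
  · have hr : 0 < ‖y‖ := lt_of_lt_of_le (by norm_num) (not_lt.mp hy)
    obtain ⟨L, hL, hLj, hLl⟩ := hasFDerivAt_phi n θ (hs.differentiable (by simp)) x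
      (by rw [hbx]; exact hr) hx1
    rw [hbx] at hLj hLl
    have hproj : ∀ j : Fin (n+1), HasFDerivAt (fun z : E (n+1) => z j)
      (EuclideanSpace.proj j : E (n+1) →L[ℝ] ℝ) x := fun j =>
      (EuclideanSpace.proj j : E (n+1) →L[ℝ] ℝ).hasFDerivAt
    have hpow : ‖y‖ ^ n = ‖y‖ ^ (n-1) * ‖y‖ := by
      rw [← pow_succ]; congr 1; omega
    have hφ : phi n θ x = θ ‖y‖ * (sphereArea n)⁻¹ * (‖y‖^n)⁻¹ := by
      have : (1:ℝ) - ((n+1 : ℕ):ℝ) = -(n:ℝ) := by push_cast; ring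
      simp [phi, xd_succ, hx1, hbx, Real.rpow_neg, Real.rpow_natCast]
    ext i
    rw [bZhikov_apply]
    refine Fin.lastCases ?_ (fun i => ?_) i
    · rw [Fin.sum_univ_castSucc]
      simp only [Mmat_last_castSucc, Mmat_last_last, mul_zero]
      have : ∀ j : Fin n, fderiv ℝ (fun z : E (n+1) => phi n θ z * z j.castSucc) x
          (EuclideanSpace.single j.castSucc 1) =
          phi n θ x + L (EuclideanSpace.single j.castSucc 1) * x j.castSucc := by
        intro j
        rw [(hL.fun_mul (hproj j.castSucc)).fderiv]
        simp; ring
      simp only [this, hLj, Finset.sum_add_distrib]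
      have hsq : ∑ j : Fin n, (x j.castSucc)^2 = ‖y‖^2 := by
        rw [EuclideanSpace.norm_sq_eq]; simp [hxdef, withLast_castSucc]
      have : ∀ a : ℝ, ∑ j : Fin n, a * (x j.castSucc / ‖y‖) * x j.castSucc = a * ‖y‖ := by
        intro a
        have : ∀ j : Fin n, a * (x j.castSucc / ‖y‖) * x j.castSucc
            = (a / ‖y‖) * (x j.castSucc)^2 := fun j => by ring
        simp only [this, ← Finset.mul_sum, hsq]; field_simp
      rw [this, hφ]
      have hσ := sphereArea_pos n hn
      simp [hx1, cRad, pow_succ, hpow]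
      field_simp
      ring
    · rw [Fin.sum_univ_castSucc]
      simp only [Mmat_castSucc_castSucc, Mmat_castSucc_last, mul_zero]
      rw [(hL.fun_mul (hproj i.castSucc).fun_neg).fderiv]
      have hσ := sphereArea_pos n hn
      simp [hLl, cRad, hpow, PiLp.single_apply, Fin.castSucc_ne_last]
      field_simp

lemma contDiff_withLast (n : ℕ) : ContDiff ℝ (⊤ : ℕ∞) (fun y : E n => withLast (n+1) y 1) := by
  rw [contDiff_euclidean]
  intro i
  refine Fin.lastCases ?_ (fun i => ?_) i
  · simp only [withLast_last]; exact contDiff_const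
  · simp only [withLast_castSucc]; fun_prop

lemma contDiff_cRad (n : ℕ) (θ : ℝ → ℝ) (hθ : IsCutoff θ) :
    ContDiff ℝ (⊤ : ℕ∞) (fun y : E n => cRad n θ ‖y‖) := by
  obtain ⟨hs, -, hlo, hhi, -⟩ := hθ
  have hd : ContDiff ℝ (⊤ : ℕ∞) (deriv θ) := by
    have := (contDiff_infty_iff_deriv.mp hs).2
    exact this
  rw [contDiff_iff_contDiffAt]
  intro y
  by_cases hy : y = 0
  · have : (fun y : E n => cRad n θ ‖y‖) =ᶠ[𝓝 y] fun _ => 0 := by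
      have : ∀ᶠ z : E n in 𝓝 y, ‖z‖ < (4:ℝ)⁻¹ := by
        apply continuous_norm.continuousAt.eventually (Iio_mem_nhds _)
        rw [hy]; norm_num
      filter_upwards [this] with z hz
      simp [cRad, deriv_zero_lo hlo hz]
    exact contDiffAt_const.congr_of_eventuallyEq this
  · have hn : ContDiffAt ℝ (⊤ : ℕ∞) (fun y : E n => ‖y‖) y := contDiffAt_norm ℝ hy
    unfold cRad
    refine (contDiffAt_const.mul (hd.contDiffAt.comp y hn)).mul ((hn.pow _).inv ?_)
    exact pow_ne_zero _ (norm_ne_zero_iff.mpr hy)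

lemma integral_cRad (n : ℕ) (hn : 1 ≤ n) (θ : ℝ → ℝ) (hθ : IsCutoff θ) :
    ∫ y : E n, cRad n θ ‖y‖ = 1 := by
  obtain ⟨hs, -, hlo, hhi, -⟩ := hθ
  have : Nonempty (Fin n) := ⟨⟨0, hn⟩⟩
  have hσ := sphereArea_pos n hn
  rw [integral_fun_norm_addHaar (volume : Measure (E n)) (cRad n θ)]
  have h1 : ∫ r in Ioi (0:ℝ), r ^ (Module.finrank ℝ (E n) - 1) • cRad n θ r
      = (sphereArea n)⁻¹ := by
    have e : ∀ r ∈ Ioi (0:ℝ), r ^ (Module.finrank ℝ (E n) - 1) • cRad n θ r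
        = (sphereArea n)⁻¹ * deriv θ r := by
      intro r hr
      have : (0:ℝ) < r := hr
      simp [cRad]; field_simp
    rw [setIntegral_congr_fun measurableSet_Ioi e, integral_const_mul]
    have hd : Continuous (deriv θ) := hs.continuous_deriv (by simp)
    have hcs : HasCompactSupport (deriv θ) := by
      apply HasCompactSupport.intro (isCompact_Icc (a := (4:ℝ)⁻¹) (b := (2:ℝ)⁻¹))
      intro s hs
      by_contra hne
      apply hs
      constructor
      · by_contra h; exact hne (deriv_zero_lo hlo (not_le.mp h))
      · by_contra h; exact hne (deriv_zero_hi hhi (not_le.mp h))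
    have := integral_Ioi_of_hasDerivAt_of_tendsto' (a := (0:ℝ)) (f := θ) (f' := deriv θ) (m := 1)
      (fun s _ => ((hs.differentiable (by simp)) s).hasDerivAt)
      (hd.integrable_of_hasCompactSupport hcs).integrableOn
      (tendsto_const_nhds.congr' (by
        filter_upwards [eventually_ge_atTop (2:ℝ)⁻¹] with s hs using (hhi s hs).symm))
    rw [this, hlo 0 (by norm_num)]; simp
  rw [h1]
  have h2 : sphereArea n = n * (volume : Measure (E n)).real (ball 0 1) := rfl
  simp only [finrank_euclideanSpace, Fintype.card_fin, nsmul_eq_mul, smul_eq_mul]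
  rw [← mul_assoc, ← h2]; field_simp

lemma slice_support (n : ℕ) (hn : 1 ≤ n) (θ : ℝ → ℝ) (hθ : IsCutoff θ) :
    Function.support (fun y : E n => bZhikov (n+1) θ (withLast (n+1) y 1)) ⊆
      {y : E n | (4:ℝ)⁻¹ ≤ ‖y‖ ∧ ‖y‖ ≤ (2:ℝ)⁻¹} := by
  intro y hy
  simp only [Function.mem_support, bZhikov_slice n hn θ hθ] at hy
  obtain ⟨hs, -, hlo, hhi, -⟩ := hθ
  constructor
  · by_contra h; apply hy; simp [cRad, deriv_zero_lo hlo (not_le.mp h)]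
  · by_contra h; apply hy; simp [cRad, deriv_zero_hi hhi (not_le.mp h)]

/-- Lemma: the slice of `b_d` at height `x_d = 1`.
For `d ≥ 2`, the map `x̄ ↦ b_d(x̄, 1)` is `C^∞` with compact support contained in the
annulus `{1/4 ≤ |x̄| ≤ 1/2} ⊂ (−1,1)^{d−1}`, and `∫_{ℝ^{d−1}} b_d(x̄,1) · e_d dx̄ = 1`. -/
theorem statement_2 (d : ℕ) (hd : 2 ≤ d) (θ : ℝ → ℝ) (hθ : IsCutoff θ) :
    ContDiff ℝ (⊤ : ℕ∞) (fun y : E (d-1) => bZhikov d θ (withLast d y 1)) ∧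
    HasCompactSupport (fun y : E (d-1) => bZhikov d θ (withLast d y 1)) ∧
    Function.support (fun y : E (d-1) => bZhikov d θ (withLast d y 1)) ⊆
      {y : E (d-1) | (4:ℝ)⁻¹ ≤ ‖y‖ ∧ ‖y‖ ≤ (2:ℝ)⁻¹} ∧
    {y : E (d-1) | (4:ℝ)⁻¹ ≤ ‖y‖ ∧ ‖y‖ ≤ (2:ℝ)⁻¹} ⊆
      {y : E (d-1) | ∀ i, y i ∈ Set.Ioo (-1:ℝ) 1} ∧
    ∫ y : E (d-1), bZhikov d θ (withLast d y 1) ⟨d - 1, by omega⟩ = 1 := by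
  obtain ⟨n, rfl⟩ : ∃ n, d = n + 1 := ⟨d - 1, by omega⟩
  have hn : 1 ≤ n := by omega
  have hsup := slice_support n hn θ hθ
  have heq : (fun y : E n => bZhikov (n+1) θ (withLast (n+1) y 1)) =
      fun y : E n => cRad n θ ‖y‖ • withLast (n+1) y 1 :=
    funext fun y => bZhikov_slice n hn θ hθ y
  refine ⟨?_, ?_, hsup, ?_, ?_⟩
  · change ContDiff ℝ (⊤ : ℕ∞) (fun y : E n => bZhikov (n+1) θ (withLast (n+1) y 1))
    rw [heq]
    exact (contDiff_cRad n θ hθ).smul (contDiff_withLast n)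
  · change HasCompactSupport (fun y : E n => bZhikov (n+1) θ (withLast (n+1) y 1))
    apply HasCompactSupport.intro (isCompact_closedBall (0 : E n) (2:ℝ)⁻¹)
    intro y hy
    by_contra hne
    exact hy (by simpa using (hsup hne).2)
  · rintro y ⟨-, hy⟩ i
    have h := (PiLp.norm_apply_le y i).trans hy
    rw [Real.norm_eq_abs] at h
    rw [Set.mem_Ioo, ← abs_lt]
    exact lt_of_le_of_lt h (by norm_num)
  · change ∫ y : E n, bZhikov (n+1) θ (withLast (n+1) y 1) (Fin.last n) = 1
    refine Eq.trans ?_ (integral_cRad n hn θ hθ)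
    congr 1
    funext y
    rw [bZhikov_slice n hn θ hθ]
    simp [withLast_last]
end
end

section
/- Let Ω = (−1,1)^d with d ≥ 2 and let 1 < p⁻ < p⁺ < ∞. Then there exist a measurable variable exponent p : Ω → [p⁻, p⁺] and a vector field b° ∈ L^1(Ω;ℝ^d), supported in a compact subset of Ω and satisfying ∫_Ω |b°(x)|^{p(x)/(p(x)−1)} dx < ∞, such that: (i) ∫_Ω b° · ∇v dx = 0 for every v ∈ C^∞(Ω), hence the functional G(v) := ∫_Ω (1/p(x))|∇v(x)|^{p(x)} dx + ∫_Ω b° · ∇v dx satisfies G(v) ≥ 0 for every v ∈ C_c^∞(Ω) and G(0) = 0; (ii) there exists w ∈ W_0^{1,1}(Ω) with ∫_Ω |∇w(x)|^{p(x)} dx < ∞ and G(w) < 0. Thus G exhibits a Lavrentiev gap: the infimum of G over W_0^{1,p(·)}(Ω) is strictly smaller than its infimum over H_0^{1,p(·)}(Ω), which equals 0. -/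
open MeasureTheory Set Metric Filter
open scoped RealInnerProductSpace ENNReal NNReal Topology

noncomputable section

/-- The open cube `Ω = (-1,1)^m`. -/
def cube (m : ℕ) : Set (E m) := {x | ∀ i, x i ∈ Set.Ioo (-1:ℝ) 1}

/-- `w ∈ W_0^{1,1}(Ω)` for `Ω = (−1,1)^d`, with weak gradient `g`: `w` and `g` are
integrable on `Ω` and the extension of `w` by zero has weak gradient (the extension of)
`g` on `ℝ^d`, i.e. `∫_Ω w ∂_i ξ dx = −∫_Ω g_i ξ dx` for all `ξ ∈ C_c^∞(ℝ^d)`. -/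
def MemW011 (d : ℕ) (w : E d → ℝ) (g : E d → E d) : Prop :=
  IntegrableOn w (cube d) volume ∧ IntegrableOn g (cube d) volume ∧
  ∀ ξ : E d → ℝ, ContDiff ℝ (⊤ : ℕ∞) ξ → HasCompactSupport ξ → ∀ i : Fin d,
    ∫ x in cube d, w x * fderiv ℝ ξ x (EuclideanSpace.single i 1) =
      - ∫ x in cube d, g x i * ξ x

namespace Lav

/-- The plane. -/
abbrev Z := ℝ × ℝ

/-- The open unit square. -/
def Q : Set Z := Ioo (0:ℝ) 1 ×ˢ Ioo (0:ℝ) 1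

lemma isOpen_Q : IsOpen Q := isOpen_Ioo.prod isOpen_Ioo

lemma convex_Q : Convex ℝ Q := (convex_Ioo _ _).prod (convex_Ioo _ _)

lemma closure_Q : closure Q = Icc (0:ℝ) 1 ×ˢ Icc (0:ℝ) 1 := by
  rw [Q, closure_prod_eq, closure_Ioo (by norm_num)]

lemma isCompact_closure_Q : IsCompact (closure Q) := by
  rw [closure_Q]; exact isCompact_Icc.prod isCompact_Icc

lemma ae_Q : ∀ᵐ z : Z, z ∈ Q ∨ z ∉ closure Q := by
  have h := convex_Q.addHaar_frontier (μ := (volume : Measure Z))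
  filter_upwards [measure_eq_zero_iff_ae_notMem.1 h] with z hz
  rw [frontier, isOpen_Q.interior_eq] at hz
  by_contra! hcon
  exact hz ⟨hcon.2, hcon.1⟩

/-- Similarity. -/
def Sm (M : ℝ) (a : Z) (z : Z) : Z := M • z - a

lemma continuous_Sm (M : ℝ) (a : Z) : Continuous (Sm M a) := by unfold Sm; fun_prop

lemma map_Sm {M : ℝ} (hM : 0 < M) (a : Z) :
    Measure.map (Sm M a) volume = ENNReal.ofReal (M⁻¹ ^ 2) • (volume : Measure Z) := by
  have h1 : Sm M a = (fun z => z - a) ∘ (fun z : Z => M • z) := rfl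
  rw [h1, ← Measure.map_map (by fun_prop) (by fun_prop), Measure.map_addHaar_smul _ hM.ne',
    Measure.map_smul, map_sub_right_eq_self]
  congr 2
  simp [abs_of_pos hM]

lemma qmp_Sm {M : ℝ} (hM : 0 < M) (a : Z) :
    Measure.QuasiMeasurePreserving (Sm M a) volume volume := by
  refine ⟨(continuous_Sm M a).measurable, ?_⟩
  rw [map_Sm hM]
  exact Measure.smul_absolutelyContinuous

lemma fderiv_Sm (M : ℝ) (a : Z) (f : Z → ℝ) (z : Z) :
    fderiv ℝ (fun z => f (Sm M a z)) z = M • fderiv ℝ f (Sm M a z) := by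
  have := fderiv_comp_smul (𝕜 := ℝ) (f := fun z => f (z - a)) (x := z) M
  simp only [Sm]
  rw [this, fderiv_comp_sub]

/-- transfer operator. -/
def P {ι : Type} [Fintype ι] (M : ℝ) (a : ι → Z) (c : ℝ) (f : Z → ℝ) : Z → ℝ :=
  fun z => c * ∑ i, f (Sm M (a i) z)

section
variable {ι : Type} [Fintype ι] {M : ℝ} {a : ι → Z} {c : ℝ}

lemma P_zero_off (hsub : ∀ i z, Sm M (a i) z ∈ Q → z ∈ Q) {f : Z → ℝ}
    (hf : ∀ z ∉ Q, f z = 0) : ∀ z ∉ Q, P M a c f z = 0 := by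
  intro z hz
  unfold P
  rw [Finset.sum_eq_zero, mul_zero]
  intro i _
  exact hf _ (fun h => hz (hsub i z h))

lemma P_single (hdisj : ∀ i j z, Sm M (a i) z ∈ Q → Sm M (a j) z ∈ Q → i = j) {f : Z → ℝ}
    (hf : ∀ z ∉ Q, f z = 0) {i : ι} {z : Z} (hz : Sm M (a i) z ∈ Q) :
    P M a c f z = c * f (Sm M (a i) z) := by
  unfold P
  rw [Finset.sum_eq_single i]
  · intro j _ hj
    exact hf _ (fun h => hj (hdisj j i z h hz))
  · simp

lemma P_none {f : Z → ℝ}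
    (hf : ∀ z ∉ Q, f z = 0) {z : Z} (hz : ∀ i, Sm M (a i) z ∉ Q) :
    P M a c f z = 0 := by
  unfold P
  rw [Finset.sum_eq_zero, mul_zero]
  intro i _
  exact hf _ (hz i)

lemma P_bound (hc : 0 ≤ c) (hdisj : ∀ i j z, Sm M (a i) z ∈ Q → Sm M (a j) z ∈ Q → i = j)
    {f : Z → ℝ} (hf : ∀ z ∉ Q, f z = 0) {B : ℝ} (hB : ∀ z, |f z| ≤ B) (z : Z) :
    |P M a c f z| ≤ c * B := by
  have hB0 : 0 ≤ B := (abs_nonneg _).trans (hB 0)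
  by_cases h : ∃ i, Sm M (a i) z ∈ Q
  · obtain ⟨i, hi⟩ := h
    rw [P_single hdisj hf hi, abs_mul, abs_of_nonneg hc]
    exact mul_le_mul_of_nonneg_left (hB _) hc
  · push Not at h
    rw [P_none hf h, abs_zero]; positivity

lemma lip_Sm (M : ℝ) (a : Z) : ∃ C, LipschitzWith C (Sm M a) := by
  have h1 : LipschitzWith ‖M‖₊ (fun z : Z => M • z) := lipschitzWith_smul M
  exact ⟨_, h1.sub (LipschitzWith.const a)⟩

lemma lip_sum {κ X : Type*} [PseudoEMetricSpace X] (s : Finset κ) (f : κ → X → ℝ)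
    (h : ∀ i ∈ s, ∃ C, LipschitzWith C (f i)) :
    ∃ C, LipschitzWith C (fun z => ∑ i ∈ s, f i z) := by
  classical
  induction s using Finset.induction_on with
  | empty => exact ⟨0, by simp⟩
  | insert i s hi ih =>
    obtain ⟨C, hC⟩ := ih (fun j hj => h j (Finset.mem_insert_of_mem hj))
    obtain ⟨D, hD⟩ := h i (Finset.mem_insert_self _ _)
    refine ⟨D + C, ?_⟩
    simp only [Finset.sum_insert hi]
    exact hD.add hC

lemma lip_const_mul {X : Type*} [PseudoEMetricSpace X] (c : ℝ) {f : X → ℝ}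
    (h : ∃ C, LipschitzWith C f) : ∃ C, LipschitzWith C (fun z => c * f z) := by
  obtain ⟨C, hC⟩ := h
  exact ⟨_, (lipschitzWith_smul c).comp hC⟩

lemma P_lip (M : ℝ) (a : ι → Z) (c : ℝ) {f : Z → ℝ} (hf : ∃ C, LipschitzWith C f) :
    ∃ C, LipschitzWith C (P M a c f) := by
  apply lip_const_mul
  apply lip_sum
  intro i _
  obtain ⟨C, hC⟩ := hf
  obtain ⟨D, hD⟩ := lip_Sm M (a i)
  exact ⟨_, hC.comp hD⟩

lemma P_fderiv (hdisj : ∀ i j z, Sm M (a i) z ∈ Q → Sm M (a j) z ∈ Q → i = j) {f : Z → ℝ}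
    (hf : ∀ z ∉ Q, f z = 0) {i : ι} {z : Z} (hz : Sm M (a i) z ∈ Q) :
    fderiv ℝ (P M a c f) z = (c * M) • fderiv ℝ f (Sm M (a i) z) := by
  have h1 : P M a c f =ᶠ[𝓝 z] fun z => c • f (Sm M (a i) z) := by
    have : (Sm M (a i)) ⁻¹' Q ∈ 𝓝 z :=
      (isOpen_Q.preimage (continuous_Sm _ _)).mem_nhds hz
    filter_upwards [this] with y hy
    exact P_single hdisj hf hy
  rw [h1.fderiv_eq, mul_smul, ← fderiv_Sm M (a i) f z]
  exact congrFun (fderiv_const_smul_field (𝕜 := ℝ) (f := fun z => f (Sm M (a i) z)) c) z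

lemma P_fderiv_zero {f : Z → ℝ}
    (hf : ∀ z ∉ Q, f z = 0) {z : Z} (hz : ∀ i, Sm M (a i) z ∉ closure Q) :
    fderiv ℝ (P M a c f) z = 0 := by
  have h1 : P M a c f =ᶠ[𝓝 z] fun z => 0 := by
    have : ∀ i, ∀ᶠ y in 𝓝 z, Sm M (a i) y ∉ closure Q := fun i =>
      (isClosed_closure.isOpen_compl.preimage (continuous_Sm M (a i))).mem_nhds (hz i)
    filter_upwards [Filter.eventually_all.2 this] with y hy
    exact P_none hf (fun i h => hy i (subset_closure h))
  rw [h1.fderiv_eq]; simp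

lemma fderiv_zero_off {f : Z → ℝ}
    (hf : ∀ z ∉ Q, f z = 0) {z : Z} (hz : z ∉ closure Q) :
    fderiv ℝ f z = 0 := by
  have h1 : f =ᶠ[𝓝 z] fun z => 0 := by
    filter_upwards [isClosed_closure.isOpen_compl.mem_nhds hz] with y hy
    exact hf _ (fun h => hy (subset_closure h))
  rw [h1.fderiv_eq]; simp

lemma ae_cases (hM : 0 < M) (a : ι → Z) :
    ∀ᵐ z : Z, (∃ i, Sm M (a i) z ∈ Q) ∨ (∀ i, Sm M (a i) z ∉ closure Q) := by
  have h : ∀ᵐ z : Z, ∀ i, Sm M (a i) z ∈ Q ∨ Sm M (a i) z ∉ closure Q :=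
    ae_all_iff.2 fun i => (qmp_Sm hM (a i)).ae ae_Q
  filter_upwards [h] with z hz
  by_cases h' : ∃ i, Sm M (a i) z ∈ Q
  · exact Or.inl h'
  · push Not at h'
    exact Or.inr fun i => (hz i).resolve_left (h' i)

lemma P_lintegral (hM : 0 < M) (hc : 0 ≤ c)
    (hdisj : ∀ i j z, Sm M (a i) z ∈ Q → Sm M (a j) z ∈ Q → i = j) {f : Z → ℝ}
    (hf : ∀ z ∉ Q, f z = 0) {q : ℝ} (hq : 0 < q) :
    ∫⁻ z, ‖fderiv ℝ (P M a c f) z‖ₑ ^ q ≤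
      ENNReal.ofReal (Fintype.card ι * M⁻¹ ^ 2 * (c * M) ^ q) * ∫⁻ z, ‖fderiv ℝ f z‖ₑ ^ q := by
  have hcM : 0 ≤ c * M := by positivity
  have hmeas : Measurable fun z => ‖fderiv ℝ f z‖ₑ ^ q :=
    (measurable_fderiv ℝ f).enorm.pow_const q
  calc ∫⁻ z, ‖fderiv ℝ (P M a c f) z‖ₑ ^ q
      ≤ ∫⁻ z, ∑ i, ENNReal.ofReal ((c * M) ^ q) * ‖fderiv ℝ f (Sm M (a i) z)‖ₑ ^ q := by
        apply lintegral_mono_ae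
        filter_upwards [ae_cases hM a] with z hz
        rcases hz with ⟨i, hi⟩ | hz
        · rw [P_fderiv hdisj hf hi]
          refine le_trans (le_of_eq ?_) (Finset.single_le_sum (fun _ _ => zero_le) (Finset.mem_univ i))
          rw [enorm_smul, ENNReal.mul_rpow_of_nonneg _ _ hq.le, Real.enorm_eq_ofReal hcM,
            ENNReal.ofReal_rpow_of_nonneg hcM hq.le]
        · rw [P_fderiv_zero hf hz]
          have h0 : ‖(0 : Z →L[ℝ] ℝ)‖ₑ = 0 := by
            rw [← ofReal_norm, norm_zero, ENNReal.ofReal_zero]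
          rw [h0, ENNReal.zero_rpow_of_pos hq]
          exact zero_le
    _ = ∑ i : ι, ENNReal.ofReal ((c * M) ^ q) * (ENNReal.ofReal (M⁻¹ ^ 2) *
          ∫⁻ z, ‖fderiv ℝ f z‖ₑ ^ q) := by
        rw [lintegral_finsetSum]
        · congr 1
          ext i
          rw [lintegral_const_mul]
          · congr 1
            rw [← lintegral_map (f := fun z => ‖fderiv ℝ f z‖ₑ ^ q) hmeas
              (continuous_Sm M (a i)).measurable, map_Sm hM, lintegral_smul_measure, smul_eq_mul]
          · exact hmeas.comp (continuous_Sm M (a i)).measurable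
        · intro i _
          exact (hmeas.comp (continuous_Sm M (a i)).measurable).const_mul _
    _ = _ := by
        rw [Finset.sum_const, Finset.card_univ, nsmul_eq_mul, ENNReal.ofReal_mul (by positivity),
          ENNReal.ofReal_mul (by positivity), ENNReal.ofReal_natCast]
        ring

end

end Lav

namespace Lav
section
variable {ι : Type} [Fintype ι] {M : ℝ} {a : ι → Z} {c : ℝ}

/-- Data of the iteration. -/
structure Dat (M : ℝ) (a : ι → Z) (c : ℝ) (Φ : Z → ℝ) : Prop where
  hM : 0 < M
  hc : 0 < c
  hc1 : c < 1
  hsub : ∀ i z, Sm M (a i) z ∈ Q → z ∈ Q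
  hdisj : ∀ i j z, Sm M (a i) z ∈ Q → Sm M (a j) z ∈ Q → i = j
  hΦ0 : ∀ z ∉ Q, Φ z = 0
  hΦL : ∃ C, LipschitzWith C Φ
  hθ : (Fintype.card ι : ℝ) * M⁻¹ ^ 2 * (c * M) < 1

/-- Level `k` corrections. -/
def Ps (M : ℝ) (a : ι → Z) (c : ℝ) (Φ : Z → ℝ) (k : ℕ) : Z → ℝ := (P M a c)^[k] Φ

variable {Φ : Z → ℝ}

lemma Ps_succ (k : ℕ) : Ps M a c Φ (k+1) = P M a c (Ps M a c Φ k) := by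
  simp only [Ps, Function.iterate_succ_apply']

lemma Ps_zero_off (D : Dat M a c Φ) (k : ℕ) : ∀ z ∉ Q, Ps M a c Φ k z = 0 := by
  induction k with
  | zero => exact D.hΦ0
  | succ k ih => rw [Ps_succ]; exact P_zero_off D.hsub ih

lemma Ps_lip (D : Dat M a c Φ) (k : ℕ) : ∃ C, LipschitzWith C (Ps M a c Φ k) := by
  induction k with
  | zero => exact D.hΦL
  | succ k ih => rw [Ps_succ]; exact P_lip _ _ _ ih

lemma Phi_bound (D : Dat M a c Φ) : ∃ B, ∀ z, |Φ z| ≤ B := by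
  obtain ⟨C, hC⟩ := D.hΦL
  have h : HasCompactSupport Φ := HasCompactSupport.intro isCompact_closure_Q
    (fun z hz => D.hΦ0 z (fun h => hz (subset_closure h)))
  obtain ⟨B, hB⟩ := h.exists_bound_of_continuous hC.continuous
  exact ⟨B, fun z => by simpa using hB z⟩

lemma Ps_bound (D : Dat M a c Φ) {B : ℝ} (hB : ∀ z, |Φ z| ≤ B) (k : ℕ) :
    ∀ z, |Ps M a c Φ k z| ≤ c ^ k * B := by
  induction k with
  | zero => simpa [Ps] using hB
  | succ k ih =>
    intro z
    rw [Ps_succ, pow_succ', mul_assoc]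
    exact P_bound D.hc.le D.hdisj (Ps_zero_off D k) ih z

lemma Phi_lintegral (D : Dat M a c Φ) {q : ℝ} (hq : 0 < q) :
    ∫⁻ z, ‖fderiv ℝ Φ z‖ₑ ^ q < ∞ := by
  obtain ⟨C, hC⟩ := D.hΦL
  calc ∫⁻ z, ‖fderiv ℝ Φ z‖ₑ ^ q ≤ ∫⁻ z, (closure Q).indicator (fun _ => (C : ℝ≥0∞) ^ q) z := by
        apply lintegral_mono
        intro z
        by_cases hz : z ∈ closure Q
        · simp only [indicator_of_mem hz]
          gcongr
          have := norm_fderiv_le_of_lipschitz ℝ hC (x₀ := z)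
          rw [← ofReal_norm]
          exact ENNReal.ofReal_le_of_le_toReal (by simpa using this)
        · simp only [indicator_of_notMem hz]
          rw [fderiv_zero_off D.hΦ0 hz]
          have h0 : ‖(0 : Z →L[ℝ] ℝ)‖ₑ = 0 := by
            rw [← ofReal_norm, norm_zero, ENNReal.ofReal_zero]
          rw [h0, ENNReal.zero_rpow_of_pos hq]
    _ < ∞ := by
        rw [lintegral_indicator isClosed_closure.measurableSet, lintegral_const]
        refine ENNReal.mul_lt_top (ENNReal.rpow_lt_top_of_nonneg hq.le ENNReal.coe_ne_top) ?_
        simpa using isCompact_closure_Q.measure_lt_top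

lemma Ps_lintegral (D : Dat M a c Φ) {q : ℝ} (hq : 0 < q) (k : ℕ) :
    ∫⁻ z, ‖fderiv ℝ (Ps M a c Φ k) z‖ₑ ^ q ≤
      ENNReal.ofReal (Fintype.card ι * M⁻¹ ^ 2 * (c * M) ^ q) ^ k *
        ∫⁻ z, ‖fderiv ℝ Φ z‖ₑ ^ q := by
  induction k with
  | zero => simp [Ps]
  | succ k ih =>
    rw [Ps_succ]
    refine (P_lintegral D.hM D.hc.le D.hdisj (Ps_zero_off D k) hq).trans ?_
    rw [pow_succ' (ENNReal.ofReal _) k, mul_assoc (ENNReal.ofReal _)]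
    gcongr

/-- Norm of the `k`-th gradient. -/
def Nk (M : ℝ) (a : ι → Z) (c : ℝ) (Φ : Z → ℝ) (k : ℕ) (z : Z) : ℝ :=
  ‖fderiv ℝ (Ps M a c Φ k) z‖

/-- Sum of norms of gradients. -/
def HH (M : ℝ) (a : ι → Z) (c : ℝ) (Φ : Z → ℝ) (z : Z) : ℝ := ∑' k, Nk M a c Φ k z

/-- The limit gradient. -/
def GG (M : ℝ) (a : ι → Z) (c : ℝ) (Φ : Z → ℝ) (z : Z) : Z →L[ℝ] ℝ :=
  ∑' k, fderiv ℝ (Ps M a c Φ k) z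

/-- The limit correction. -/
def psi (M : ℝ) (a : ι → Z) (c : ℝ) (Φ : Z → ℝ) (z : Z) : ℝ := ∑' k, Ps M a c Φ k z

/-- Partial sums. -/
def psin (M : ℝ) (a : ι → Z) (c : ℝ) (Φ : Z → ℝ) (n : ℕ) (z : Z) : ℝ :=
  ∑ k ∈ Finset.range n, Ps M a c Φ k z

lemma measurable_Nk (k : ℕ) : Measurable (Nk M a c Φ k) := (measurable_fderiv ℝ _).norm

lemma ae_summable (D : Dat M a c Φ) : ∀ᵐ z, Summable fun k => Nk M a c Φ k z := by
  have h1 : ∫⁻ z, ∑' k, ‖Nk M a c Φ k z‖ₑ < ∞ := by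
    rw [lintegral_tsum (fun k => (measurable_Nk k).enorm.aemeasurable)]
    have h2 : ∀ k, ∫⁻ z, ‖Nk M a c Φ k z‖ₑ ≤
        ENNReal.ofReal (Fintype.card ι * M⁻¹ ^ 2 * (c * M)) ^ k * ∫⁻ z, ‖fderiv ℝ Φ z‖ₑ ^ (1:ℝ) := by
      intro k
      have := Ps_lintegral D zero_lt_one k
      simp only [ENNReal.rpow_one, Real.rpow_one] at this ⊢
      simpa only [Nk, enorm_norm] using this
    refine (ENNReal.tsum_le_tsum h2).trans_lt ?_
    rw [ENNReal.tsum_mul_right, ENNReal.tsum_geometric]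
    refine ENNReal.mul_lt_top ?_ (Phi_lintegral D zero_lt_one)
    rw [ENNReal.inv_lt_top, tsub_pos_iff_lt]
    rw [← ENNReal.ofReal_one]
    exact (ENNReal.ofReal_lt_ofReal_iff one_pos).2 D.hθ
  have h3 := ae_lt_top (Measurable.tsum fun k => (measurable_Nk k).enorm) h1.ne
  filter_upwards [h3] with z hz
  have : Summable fun k => ‖Nk M a c Φ k z‖₊ := by
    rw [← ENNReal.tsum_coe_ne_top_iff_summable]
    simpa only [enorm_eq_nnnorm] using hz.ne
  exact Summable.of_nnnorm this

lemma memLp_HH (D : Dat M a c Φ) {q : ℝ} (hq : 1 ≤ q)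
    (hθq : (Fintype.card ι : ℝ) * M⁻¹ ^ 2 * (c * M) ^ q < 1) :
    MemLp (HH M a c Φ) (ENNReal.ofReal q) volume := by
  have hq0 : 0 < q := by linarith
  set θ := ENNReal.ofReal (Fintype.card ι * M⁻¹ ^ 2 * (c * M) ^ q) with hθdef
  have hθ1 : θ < 1 := by
    rw [← ENNReal.ofReal_one]
    exact (ENNReal.ofReal_lt_ofReal_iff one_pos).2 hθq
  set K := ∫⁻ z, ‖fderiv ℝ Φ z‖ₑ ^ q with hK
  have hKt : K < ∞ := Phi_lintegral D hq0
  have hmeas : ∀ n, Measurable (fun z => ∑ k ∈ Finset.range n, Nk M a c Φ k z) := fun n =>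
    Finset.measurable_fun_sum _ (fun k _ => measurable_Nk k)
  have hlim : ∀ᵐ z, Tendsto (fun n => ∑ k ∈ Finset.range n, Nk M a c Φ k z) atTop
      (𝓝 (HH M a c Φ z)) := by
    filter_upwards [ae_summable D] with z hz
    exact hz.hasSum.tendsto_sum_nat
  have hq1 : (1:ℝ≥0∞) ≤ ENNReal.ofReal q := by
    rw [← ENNReal.ofReal_one]; exact ENNReal.ofReal_le_ofReal hq
  have hb1 : ∀ k, eLpNorm (Nk M a c Φ k) (ENNReal.ofReal q) volume ≤
      (θ ^ (1/q)) ^ k * K ^ (1/q) := by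
    intro k
    rw [eLpNorm_eq_lintegral_rpow_enorm_toReal (by simpa using hq0) ENNReal.ofReal_ne_top,
      ENNReal.toReal_ofReal hq0.le]
    have h := Ps_lintegral D hq0 k
    rw [← hθdef, ← hK] at h
    have h' := ENNReal.rpow_le_rpow h (show 0 ≤ 1/q by positivity)
    rw [ENNReal.mul_rpow_of_nonneg _ _ (by positivity), ← ENNReal.rpow_natCast,
      ← ENNReal.rpow_mul, mul_comm (k:ℝ), ENNReal.rpow_mul, ENNReal.rpow_natCast] at h'
    simpa only [Nk, enorm_norm] using h'
  set R := ∑' k, (θ ^ (1/q)) ^ k * K ^ (1/q) with hR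
  have hRt : R < ∞ := by
    rw [hR, ENNReal.tsum_mul_right, ENNReal.tsum_geometric]
    refine ENNReal.mul_lt_top ?_ (ENNReal.rpow_lt_top_of_nonneg (by positivity) hKt.ne)
    rw [ENNReal.inv_lt_top, tsub_pos_iff_lt]
    exact ENNReal.rpow_lt_one hθ1 (by positivity)
  have hb : ∀ n, eLpNorm (fun z => ∑ k ∈ Finset.range n, Nk M a c Φ k z) (ENNReal.ofReal q) volume
      ≤ R := by
    intro n
    have h := eLpNorm_sum_le (μ := volume) (p := ENNReal.ofReal q) (f := Nk M a c Φ)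
      (s := Finset.range n) (fun k _ => (measurable_Nk k).aestronglyMeasurable) hq1
    have e : (∑ k ∈ Finset.range n, Nk M a c Φ k) = fun z => ∑ k ∈ Finset.range n, Nk M a c Φ k z := by
      ext z; simp
    rw [e] at h
    exact h.trans ((Finset.sum_le_sum fun k _ => hb1 k).trans (ENNReal.sum_le_tsum _))
  refine ⟨aestronglyMeasurable_of_tendsto_ae _ (fun n => (hmeas n).aestronglyMeasurable) hlim, ?_⟩
  have h := Lp.eLpNorm_lim_le_liminf_eLpNorm (p := ENNReal.ofReal q)
    (fun n => (hmeas n).aestronglyMeasurable) _ hlim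
  refine (h.trans ?_).trans_lt hRt
  refine Filter.liminf_le_of_le (by isBoundedDefault) ?_
  intro b hb'
  obtain ⟨n, hn⟩ := hb'.exists
  exact hn.trans (hb n)

lemma integrable_HH (D : Dat M a c Φ) : Integrable (HH M a c Φ) := by
  have := memLp_HH D le_rfl (by simpa using D.hθ)
  rwa [ENNReal.ofReal_one, memLp_one_iff_integrable] at this

lemma measurable_GG : Measurable (GG M a c Φ) := by
  unfold GG
  exact Measurable.tsum fun k => measurable_fderiv ℝ _

lemma psin_lip (D : Dat M a c Φ) (n : ℕ) : ∃ C, LipschitzWith C (psin M a c Φ n) :=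
  lip_sum _ _ fun k _ => Ps_lip D k

lemma psin_zero_off (D : Dat M a c Φ) (n : ℕ) : ∀ z ∉ Q, psin M a c Φ n z = 0 :=
  fun z hz => Finset.sum_eq_zero fun k _ => Ps_zero_off D k z hz

lemma psi_zero_off (D : Dat M a c Φ) : ∀ z ∉ Q, psi M a c Φ z = 0 := by
  intro z hz
  simp only [psi, Ps_zero_off D _ z hz, tsum_zero]

lemma psi_props (D : Dat M a c Φ) : ∃ B, (∀ n z, |psin M a c Φ n z| ≤ B) ∧
    (∀ z, Tendsto (fun n => psin M a c Φ n z) atTop (𝓝 (psi M a c Φ z))) := by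
  obtain ⟨B, hB⟩ := Phi_bound D
  have hB0 : 0 ≤ B := (abs_nonneg _).trans (hB 0)
  have hs : Summable fun k => c ^ k * B :=
    (summable_geometric_of_lt_one D.hc.le D.hc1).mul_right B
  refine ⟨∑' k, c ^ k * B, ?_, ?_⟩
  · intro n z
    calc |psin M a c Φ n z| ≤ ∑ k ∈ Finset.range n, |Ps M a c Φ k z| := Finset.abs_sum_le_sum_abs _ _
      _ ≤ ∑ k ∈ Finset.range n, c ^ k * B := Finset.sum_le_sum fun k _ => Ps_bound D hB k z
      _ ≤ _ := hs.sum_le_tsum _ (fun k _ => by have := D.hc; positivity)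
  · intro z
    have : Summable fun k => Ps M a c Φ k z :=
      Summable.of_norm_bounded hs (fun k => Ps_bound D hB k z)
    exact this.hasSum.tendsto_sum_nat

lemma psi_bound (D : Dat M a c Φ) : ∃ B, ∀ z, |psi M a c Φ z| ≤ B := by
  obtain ⟨B, hB, hl⟩ := psi_props D
  refine ⟨B, fun z => le_of_tendsto (hl z).abs (Eventually.of_forall fun n => hB n z)⟩

lemma measurable_psi (D : Dat M a c Φ) : Measurable (psi M a c Φ) := by
  obtain ⟨B, hB, hl⟩ := psi_props D
  refine measurable_of_tendsto_metrizable (f := psin M a c Φ) (fun n => ?_) (tendsto_pi_nhds.2 hl)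
  obtain ⟨C, hC⟩ := psin_lip D n
  exact hC.continuous.measurable

/-- gradient facts, a.e. -/
lemma ae_grad (D : Dat M a c Φ) : ∀ᵐ z, ∀ n,
    DifferentiableAt ℝ (psin M a c Φ n) z ∧ ‖fderiv ℝ (psin M a c Φ n) z‖ ≤ HH M a c Φ z := by
  have hd : ∀ᵐ z : Z, ∀ k, DifferentiableAt ℝ (Ps M a c Φ k) z := by
    refine ae_all_iff.2 fun k => ?_
    obtain ⟨C, hC⟩ := Ps_lip D k
    exact hC.ae_differentiableAt
  filter_upwards [hd, ae_summable D] with z hz hs n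
  refine ⟨DifferentiableAt.fun_sum fun k _ => hz k, ?_⟩
  have : fderiv ℝ (psin M a c Φ n) z = ∑ k ∈ Finset.range n, fderiv ℝ (Ps M a c Φ k) z :=
    fderiv_fun_sum fun k _ => hz k
  rw [this]
  exact (norm_sum_le _ _).trans (hs.sum_le_tsum _ (fun k _ => norm_nonneg _))

lemma ae_grad_lim (D : Dat M a c Φ) : ∀ᵐ z,
    Tendsto (fun n => fderiv ℝ (psin M a c Φ n) z) atTop (𝓝 (GG M a c Φ z)) := by
  have hd : ∀ᵐ z : Z, ∀ k, DifferentiableAt ℝ (Ps M a c Φ k) z := by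
    refine ae_all_iff.2 fun k => ?_
    obtain ⟨C, hC⟩ := Ps_lip D k
    exact hC.ae_differentiableAt
  filter_upwards [hd, ae_summable D] with z hz hs
  have : (fun n => fderiv ℝ (psin M a c Φ n) z) =
      fun n => ∑ k ∈ Finset.range n, fderiv ℝ (Ps M a c Φ k) z := by
    ext1 n
    exact fderiv_fun_sum fun k _ => hz k
  rw [this]
  exact (Summable.of_norm hs).hasSum.tendsto_sum_nat

lemma ae_GG_le (D : Dat M a c Φ) : ∀ᵐ z, ‖GG M a c Φ z‖ ≤ HH M a c Φ z := by
  filter_upwards [ae_summable D] with z hs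
  exact norm_tsum_le_tsum_norm hs

lemma GG_off (D : Dat M a c Φ) {z : Z} (hz : z ∉ closure Q) : GG M a c Φ z = 0 := by
  simp only [GG, fderiv_zero_off (Ps_zero_off D _) hz, tsum_zero]

lemma GG_collar (D : Dat M a c Φ) {z : Z} (hz : ∀ i, Sm M (a i) z ∉ closure Q) :
    GG M a c Φ z = fderiv ℝ Φ z := by
  rw [GG, tsum_eq_single 0]
  · rfl
  · intro k hk
    obtain ⟨m, rfl⟩ := Nat.exists_eq_succ_of_ne_zero hk
    rw [Nat.succ_eq_add_one, Ps_succ]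
    exact P_fderiv_zero (Ps_zero_off D m) hz

lemma GG_inner (D : Dat M a c Φ) : ∀ᵐ z, ∀ i, Sm M (a i) z ∈ Q →
    GG M a c Φ z = fderiv ℝ Φ z + (c * M) • GG M a c Φ (Sm M (a i) z) := by
  filter_upwards [ae_summable D] with z hs i hi
  have hs' : Summable fun k => fderiv ℝ (Ps M a c Φ k) z := Summable.of_norm hs
  rw [GG, hs'.tsum_eq_zero_add]
  have : ∀ k, fderiv ℝ (Ps M a c Φ (k+1)) z =
      (c * M) • fderiv ℝ (Ps M a c Φ k) (Sm M (a i) z) := by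
    intro k
    rw [Ps_succ]
    exact P_fderiv D.hdisj (Ps_zero_off D k) hi
  simp only [this]
  rw [tsum_const_smul'', GG]
  rfl

end
end Lav

namespace Lav

/-- Collar parameter. -/
def rho (k t : ℝ) : ℝ := max 0 ((2 * |t| - k) / (1 - k))

/-- One-sided tent. -/
def TT (m k s t : ℝ) : ℝ := max 0 (min (1/2 - s) ((1 - m) / (2 * m) * (2 * s - rho k t)))

/-- Tile profile. -/
def tau (m k s t : ℝ) : ℝ := TT m k s t - TT m k (-s) t

lemma rho_nonneg (k t : ℝ) : 0 ≤ rho k t := le_max_left _ _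

lemma TT_neg {m k s t : ℝ} (hm : 0 < m) (hm1 : m < 1) (hs : s ≤ 0) : TT m k s t = 0 := by
  have h := rho_nonneg k t
  have hC : 0 ≤ (1 - m) / (2 * m) := div_nonneg (by linarith) (by linarith)
  refine max_eq_left ((min_le_right _ _).trans ?_)
  exact mul_nonpos_of_nonneg_of_nonpos hC (by linarith)

lemma TT_big {m k s t : ℝ} (hs : 1/2 ≤ s) : TT m k s t = 0 :=
  max_eq_left ((min_le_left _ _).trans (by linarith))

lemma TT_far {m k s t : ℝ} (hm : 0 < m) (hm1 : m < 1) (hk1 : k < 1)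
    (ht : 1/2 ≤ |t|) : TT m k s t = 0 := by
  rcases le_total (1/2) s with hs | hs
  · exact TT_big hs
  · have hC : 0 ≤ (1 - m) / (2 * m) := div_nonneg (by linarith) (by linarith)
    have h : 1 ≤ rho k t := by
      refine le_trans ?_ (le_max_right _ _)
      rw [le_div_iff₀ (by linarith)]; linarith
    refine max_eq_left ((min_le_right _ _).trans ?_)
    exact mul_nonpos_of_nonneg_of_nonpos hC (by linarith)

lemma tau_zero {m k s t : ℝ} (hm : 0 < m) (hm1 : m < 1) (hk1 : k < 1)
    (h : ¬ (|s| < 1/2 ∧ |t| < 1/2)) : tau m k s t = 0 := by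
  unfold tau
  by_cases ht : 1/2 ≤ |t|
  · rw [TT_far hm hm1 hk1 ht, TT_far hm hm1 hk1 ht, sub_zero]
  · have hs : 1/2 ≤ |s| := by
      by_contra hs; exact h ⟨not_le.1 hs, not_le.1 ht⟩
    rcases le_total 0 s with h0 | h0
    · rw [abs_of_nonneg h0] at hs
      rw [TT_big hs, TT_neg hm hm1 (by linarith), sub_zero]
    · rw [abs_of_nonpos h0] at hs
      rw [TT_big hs, TT_neg hm hm1 h0, sub_zero]

lemma TT_inner {m k s t : ℝ} (hm : 0 < m) (hm1 : m < 1) (hk1 : k < 1)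
    (hs0 : 0 ≤ s) (hs : s ≤ m / 2) (ht : |t| ≤ k / 2) : TT m k s t = (1/m - 1) * s := by
  have hr : rho k t = 0 := max_eq_left (div_nonpos_of_nonpos_of_nonneg (by linarith) (by linarith))
  have h1 : (1 - m) / (2 * m) * (2 * s - rho k t) = (1/m - 1) * s := by
    rw [hr]; field_simp; ring
  have h2 : s / m ≤ 1/2 := by rw [div_le_iff₀ hm]; linarith
  have h3 : 1 ≤ 1 / m := by rw [le_div_iff₀ hm]; linarith
  unfold TT
  rw [h1, min_eq_right, max_eq_right]
  · exact mul_nonneg (by linarith) hs0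
  · have : (1/m - 1) * s = s / m - s := by ring
    linarith

lemma tau_inner {m k s t : ℝ} (hm : 0 < m) (hm1 : m < 1) (hk1 : k < 1)
    (hs : |s| ≤ m / 2) (ht : |t| ≤ k / 2) : tau m k s t = (1/m - 1) * s := by
  unfold tau
  rcases le_total 0 s with h0 | h0
  · rw [abs_of_nonneg h0] at hs
    rw [TT_inner hm hm1 hk1 h0 hs ht, TT_neg hm hm1 (by linarith), sub_zero]
  · rw [abs_of_nonpos h0] at hs
    rw [TT_inner (s := -s) hm hm1 hk1 (by linarith) hs ht, TT_neg hm hm1 h0]; ring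

lemma TT_const {m k s t : ℝ} (hm : 0 < m)
    (hs1 : s ≤ 1/2) (hs : m + (1 - m) * rho k t ≤ 2 * s) : TT m k s t = 1/2 - s := by
  unfold TT
  have h1 : 1/2 - s ≤ (1 - m) / (2 * m) * (2 * s - rho k t) := by
    rw [div_mul_eq_mul_div, le_div_iff₀ (by linarith)]
    nlinarith
  rw [min_eq_left h1, max_eq_right (by linarith)]

lemma tau_const_pos {m k s t : ℝ} (hm : 0 < m) (hm1 : m < 1) (h0 : 0 ≤ s)
    (hs1 : |s| ≤ 1/2) (hs : m + (1 - m) * rho k t ≤ 2 * |s|) : tau m k s t = 1/2 - s := by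
  rw [abs_of_nonneg h0] at hs hs1
  rw [tau, TT_const hm hs1 hs, TT_neg hm hm1 (by linarith), sub_zero]

lemma tau_const_neg {m k s t : ℝ} (hm : 0 < m) (hm1 : m < 1) (h0 : s ≤ 0)
    (hs1 : |s| ≤ 1/2) (hs : m + (1 - m) * rho k t ≤ 2 * |s|) : tau m k s t = -1/2 - s := by
  rw [abs_of_nonpos h0] at hs hs1
  rw [tau, TT_const (s := -s) hm hs1 hs, TT_neg hm hm1 h0]; ring

section lip
variable {X : Type*} [PseudoEMetricSpace X]

/-- Being Lipschitz. -/
def IsLip (f : X → ℝ) : Prop := ∃ C, LipschitzWith C f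

lemma IsLip.sub {f g : X → ℝ} (hf : IsLip f) (hg : IsLip g) : IsLip fun z => f z - g z := by
  obtain ⟨C, hC⟩ := hf; obtain ⟨D, hD⟩ := hg
  exact ⟨_, hC.sub hD⟩
lemma IsLip.max {f g : X → ℝ} (hf : IsLip f) (hg : IsLip g) : IsLip fun z => max (f z) (g z) := by
  obtain ⟨C, hC⟩ := hf; obtain ⟨D, hD⟩ := hg
  exact ⟨_, hC.max hD⟩
lemma IsLip.min {f g : X → ℝ} (hf : IsLip f) (hg : IsLip g) : IsLip fun z => min (f z) (g z) := by
  obtain ⟨C, hC⟩ := hf; obtain ⟨D, hD⟩ := hg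
  exact ⟨_, hC.min hD⟩
lemma IsLip.const (c : ℝ) : IsLip fun _ : X => c := ⟨0, LipschitzWith.const c⟩
lemma IsLip.const_mul (c : ℝ) {f : X → ℝ} (hf : IsLip f) : IsLip fun z => c * f z :=
  lip_const_mul c hf
lemma IsLip.abs {f : X → ℝ} (hf : IsLip f) : IsLip fun z => |f z| := by
  obtain ⟨C, hC⟩ := hf
  exact ⟨_, lipschitzWith_one_norm.comp hC⟩
lemma IsLip.neg {f : X → ℝ} (hf : IsLip f) : IsLip fun z => - f z := by
  obtain ⟨C, hC⟩ := hf
  exact ⟨_, hC.neg⟩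

lemma IsLip.rho (k : ℝ) {f : X → ℝ} (hf : IsLip f) : IsLip fun z => rho k (f z) := by
  unfold Lav.rho
  simp only [div_eq_inv_mul]
  exact (IsLip.const 0).max (((hf.abs.const_mul 2).sub (.const k)).const_mul _)

lemma IsLip.TT (m k : ℝ) {f g : X → ℝ} (hf : IsLip f) (hg : IsLip g) :
    IsLip fun z => TT m k (f z) (g z) := by
  unfold Lav.TT
  exact (IsLip.const 0).max (((IsLip.const _).sub hf).min
    (((hf.const_mul 2).sub (hg.rho k)).const_mul _))

lemma IsLip.tau (m k : ℝ) {f g : X → ℝ} (hf : IsLip f) (hg : IsLip g) :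
    IsLip fun z => tau m k (f z) (g z) := by
  unfold Lav.tau
  exact (hf.TT m k hg).sub (hf.neg.TT m k hg)

end lip

section tiles
variable {ι : Type} [Fintype ι]

/-- Sum of tile profiles. -/
def Phi (n m k : ℝ) (X Y : ι → Z → ℝ) (z : Z) : ℝ := n⁻¹ * ∑ i, tau m k (X i z) (Y i z)

lemma Phi_lip (n m k : ℝ) {X Y : ι → Z → ℝ} (hX : ∀ i, IsLip (X i)) (hY : ∀ i, IsLip (Y i)) :
    ∃ C, LipschitzWith C (Phi n m k X Y) := by
  apply lip_const_mul
  apply lip_sum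
  intro i _
  exact (hX i).tau m k (hY i)

variable {n m k : ℝ} {X Y : ι → Z → ℝ}

lemma Phi_zero (hm : 0 < m) (hm1 : m < 1) (hk1 : k < 1) {z : Z}
    (h : ∀ i, ¬ (|X i z| < 1/2 ∧ |Y i z| < 1/2)) : Phi n m k X Y z = 0 := by
  unfold Phi
  rw [Finset.sum_eq_zero, mul_zero]
  intro i _
  exact tau_zero hm hm1 hk1 (h i)

lemma Phi_single (hm : 0 < m) (hm1 : m < 1) (hk1 : k < 1)
    (hdisj : ∀ i j z, (|X i z| < 1/2 ∧ |Y i z| < 1/2) → (|X j z| < 1/2 ∧ |Y j z| < 1/2) → i = j)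
    {z : Z} {i : ι}
    (h : |X i z| < 1/2 ∧ |Y i z| < 1/2) : Phi n m k X Y z = n⁻¹ * tau m k (X i z) (Y i z) := by
  unfold Phi
  rw [Finset.sum_eq_single i]
  · intro j _ hj
    exact tau_zero hm hm1 hk1 (fun h' => hj (hdisj j i z h' h))
  · simp

lemma fderiv_aff (L : Z →L[ℝ] ℝ) (α β : ℝ) (z : Z) :
    fderiv ℝ (fun y => α * L y + β) z = α • L := by
  have : HasFDerivAt (fun y => α * L y + β) (α • L) z :=
    (L.hasFDerivAt.const_mul α).add_const β
  exact this.fderiv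

lemma Phi_fderiv_inner (hn : 0 < n) (hm : 0 < m) (hm1 : m < 1) (hk1 : k < 1)
    (hXc : ∀ i, Continuous (X i)) (hYc : ∀ i, Continuous (Y i))
    (hdisj : ∀ i j z, (|X i z| < 1/2 ∧ |Y i z| < 1/2) → (|X j z| < 1/2 ∧ |Y j z| < 1/2) → i = j)
    {L : Z →L[ℝ] ℝ} {κ : ι → ℝ} (hX : ∀ i z, X i z = n * L z - κ i)
    {z : Z} {i : ι} (h : |X i z| < m/2 ∧ |Y i z| < k/2) :
    fderiv ℝ (Phi n m k X Y) z = (1/m - 1) • L := by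
  have ho : IsOpen {y | |X i y| < m/2 ∧ |Y i y| < k/2} :=
    (isOpen_lt (hXc i).abs continuous_const).inter (isOpen_lt (hYc i).abs continuous_const)
  have he : Phi n m k X Y =ᶠ[𝓝 z] fun y => (1/m-1) * L y + (- n⁻¹ * (1/m-1) * κ i) := by
    filter_upwards [ho.mem_nhds h] with y hy
    obtain ⟨h1, h2⟩ := hy
    rw [Phi_single (i := i) hm hm1 hk1 hdisj ⟨by linarith, by linarith⟩,
      tau_inner hm hm1 hk1 h1.le h2.le, hX]
    field_simp
    ring
  rw [he.fderiv_eq, fderiv_aff]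

lemma Phi_fderiv_const (hn : 0 < n) (hm : 0 < m) (hm1 : m < 1) (hk1 : k < 1)
    (hXc : ∀ i, Continuous (X i)) (hYc : ∀ i, Continuous (Y i))
    (hdisj : ∀ i j z, (|X i z| < 1/2 ∧ |Y i z| < 1/2) → (|X j z| < 1/2 ∧ |Y j z| < 1/2) → i = j)
    {L : Z →L[ℝ] ℝ} {κ : ι → ℝ} (hX : ∀ i z, X i z = n * L z - κ i)
    {z : Z} {i : ι} (h : |X i z| < 1/2 ∧ |Y i z| < 1/2)
    (h' : m + (1 - m) * rho k (Y i z) < 2 * |X i z|) :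
    fderiv ℝ (Phi n m k X Y) z = - L := by
  have hrc : Continuous fun y => rho k (Y i y) := by
    unfold rho
    have := hYc i
    fun_prop
  have hc1 : Continuous fun y => m + (1 - m) * rho k (Y i y) := by fun_prop
  have hc2 : Continuous fun y => 2 * |X i y| := by have := hXc i; fun_prop
  have ho : IsOpen {y | (|X i y| < 1/2 ∧ |Y i y| < 1/2) ∧
      m + (1 - m) * rho k (Y i y) < 2 * |X i y|} :=
    ((isOpen_lt (hXc i).abs continuous_const).inter (isOpen_lt (hYc i).abs continuous_const)).inter
      (isOpen_lt hc1 hc2)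
  have hne : X i z ≠ 0 := by
    intro h0
    rw [h0, abs_zero] at h'
    have := mul_nonneg (sub_nonneg.2 hm1.le) (rho_nonneg k (Y i z))
    linarith
  rcases lt_or_gt_of_ne hne with hneg | hpos
  · have he : Phi n m k X Y =ᶠ[𝓝 z] fun y => (-1) * L y + (n⁻¹ * (κ i - 1/2)) := by
      filter_upwards [ho.mem_nhds ⟨h, h'⟩, (isOpen_lt (hXc i) continuous_const).mem_nhds hneg]
        with y hy hy0
      rw [Phi_single hm hm1 hk1 hdisj hy.1, tau_const_neg hm hm1 (le_of_lt hy0) hy.1.1.le hy.2.le, hX]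
      field_simp
      ring
    rw [he.fderiv_eq, fderiv_aff]; ext <;> exact neg_one_mul _
  · have he : Phi n m k X Y =ᶠ[𝓝 z] fun y => (-1) * L y + (n⁻¹ * (κ i + 1/2)) := by
      filter_upwards [ho.mem_nhds ⟨h, h'⟩, (isOpen_lt continuous_const (hXc i)).mem_nhds hpos]
        with y hy hy0
      rw [Phi_single hm hm1 hk1 hdisj hy.1, tau_const_pos hm hm1 (le_of_lt hy0) hy.1.1.le hy.2.le, hX]
      field_simp
      ring
    rw [he.fderiv_eq, fderiv_aff]; ext <;> exact neg_one_mul _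

end tiles
end Lav

namespace Lav
section

/-- Tile coordinate. -/
def X1 (n1 n2 : ℕ) (i : Fin n1 × Fin n2) (z : Z) : ℝ := n1 * z.1 - ((i.1 : ℕ) + 1/2)
/-- Tile coordinate. -/
def X2 (n1 n2 : ℕ) (i : Fin n1 × Fin n2) (z : Z) : ℝ := n2 * z.2 - ((i.2 : ℕ) + 1/2)
/-- Translations. -/
def aa (n1 n2 M : ℕ) (i : Fin n1 × Fin n2) : Z :=
  (M * ((i.1 : ℕ) + 1/2) / n1 - 1/2, M * ((i.2 : ℕ) + 1/2) / n2 - 1/2)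

/-- First profile. -/
def Pu (n1 n2 M : ℕ) : Z → ℝ := Phi (n1:ℝ) (n1/M) (n2/M) (X1 n1 n2) (X2 n1 n2)
/-- Second profile. -/
def Pw (n1 n2 M : ℕ) : Z → ℝ := Phi (n2:ℝ) (n2/M) (n1/M) (X2 n1 n2) (X1 n1 n2)

variable {n1 n2 M : ℕ}

lemma lip_X1 (i) : IsLip (X1 n1 n2 i) := by
  have : IsLip fun z : Z => z.1 := ⟨1, LipschitzWith.prod_fst⟩
  exact (this.const_mul _).sub (.const _)

lemma lip_X2 (i) : IsLip (X2 n1 n2 i) := by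
  have : IsLip fun z : Z => z.2 := ⟨1, LipschitzWith.prod_snd⟩
  exact (this.const_mul _).sub (.const _)

lemma cont_X1 (i) : Continuous (X1 n1 n2 i) := by unfold X1; fun_prop
lemma cont_X2 (i) : Continuous (X2 n1 n2 i) := by unfold X2; fun_prop

lemma nat_eq_of_abs {i j : ℕ} {x : ℝ} (h1 : |x - (i + 1/2)| < 1/2) (h2 : |x - (j + 1/2)| < 1/2) :
    i = j := by
  rw [abs_lt] at h1 h2
  have a1 : (i:ℝ) < j + 1 := by linarith
  have a2 : (j:ℝ) < i + 1 := by linarith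
  norm_cast at a1 a2
  omega

lemma tile_disj (i j : Fin n1 × Fin n2) (z : Z) (h : |X1 n1 n2 i z| < 1/2 ∧ |X2 n1 n2 i z| < 1/2)
    (h' : |X1 n1 n2 j z| < 1/2 ∧ |X2 n1 n2 j z| < 1/2) : i = j := by
  have e1 := nat_eq_of_abs h.1 h'.1
  have e2 := nat_eq_of_abs h.2 h'.2
  exact Prod.ext (Fin.ext e1) (Fin.ext e2)

lemma coord_mem {n : ℕ} (i : Fin n) {x : ℝ} (h : |n * x - ((i:ℕ) + 1/2)| < 1/2) :
    x ∈ Ioo (0:ℝ) 1 := by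
  have hn : (0:ℝ) < n := by exact_mod_cast i.pos
  have hi : ((i:ℕ):ℝ) + 1 ≤ n := by exact_mod_cast i.2
  rw [abs_lt] at h
  have h0 : (0:ℝ) ≤ (i:ℕ) := by positivity
  constructor
  · by_contra hx; push Not at hx; nlinarith
  · by_contra hx; push Not at hx; nlinarith

lemma tile_sub (i : Fin n1 × Fin n2) (z : Z) (h : |X1 n1 n2 i z| < 1/2 ∧ |X2 n1 n2 i z| < 1/2) :
    z ∈ Q := ⟨coord_mem i.1 h.1, coord_mem i.2 h.2⟩

lemma coord_exists {n : ℕ} (hn : 0 < n) {x : ℝ} (hx : x ∈ Ioo (0:ℝ) 1) (h : ∀ k : ℕ, n * x ≠ k) :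
    ∃ i : Fin n, |n * x - ((i:ℕ) + 1/2)| < 1/2 := by
  have hn' : (0:ℝ) < n := by exact_mod_cast hn
  have h0 : 0 ≤ n * x := mul_nonneg hn'.le hx.1.le
  have h1 := Nat.floor_le h0
  have h2 := Nat.lt_floor_add_one (n * x)
  have h3 : (⌊n * x⌋₊ : ℝ) < n * x := lt_of_le_of_ne h1 (h _).symm
  refine ⟨⟨⌊n * x⌋₊, ?_⟩, ?_⟩
  · rw [Nat.floor_lt h0]; nlinarith [hx.2]
  · rw [abs_lt]; constructor <;> simp only <;> linarith

lemma coord_inner {n M : ℕ} (hM : 0 < M) (i : Fin n) (x : ℝ) :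
    (M * x - (M * ((i:ℕ) + 1/2) / n - 1/2) ∈ Ioo (0:ℝ) 1 ↔
      |n * x - ((i:ℕ) + 1/2)| < (n / M : ℝ) / 2) := by
  have hn : (0:ℝ) < n := by exact_mod_cast i.pos
  have hM' : (0:ℝ) < M := by exact_mod_cast hM
  have e : M * x - (M * ((i:ℕ) + 1/2) / n - 1/2) = (n * x - ((i:ℕ) + 1/2)) / (n / M : ℝ) + 1/2 := by
    field_simp; ring
  have hm : (0:ℝ) < n / M := by positivity
  rw [e, abs_lt, mem_Ioo]
  have e1 : ((0:ℝ) < (n * x - ((i:ℕ) + 1/2)) / (n / M : ℝ) + 1/2) ↔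
      -(1/2) < (n * x - ((i:ℕ) + 1/2)) / (n / M : ℝ) := by constructor <;> intro <;> linarith
  have e2 : ((n * x - ((i:ℕ) + 1/2)) / (n / M : ℝ) + 1/2 < 1) ↔
      (n * x - ((i:ℕ) + 1/2)) / (n / M : ℝ) < 1/2 := by constructor <;> intro <;> linarith
  rw [e1, e2, lt_div_iff₀ hm, div_lt_iff₀ hm]
  constructor <;> rintro ⟨h1, h2⟩ <;> constructor <;> linarith

lemma coord_inner' {n M : ℕ} (hM : 0 < M) (i : Fin n) (x : ℝ)
    (h : |n * x - ((i:ℕ) + 1/2)| ≤ (n / M : ℝ) / 2) :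
    M * x - (M * ((i:ℕ) + 1/2) / n - 1/2) ∈ Icc (0:ℝ) 1 := by
  have hn : (0:ℝ) < n := by exact_mod_cast i.pos
  have hM' : (0:ℝ) < M := by exact_mod_cast hM
  have e : M * x - (M * ((i:ℕ) + 1/2) / n - 1/2) = (n * x - ((i:ℕ) + 1/2)) / (n / M : ℝ) + 1/2 := by
    field_simp; ring
  have hm : (0:ℝ) < n / M := by positivity
  rw [e, mem_Icc]
  rw [abs_le] at h
  have e1 : -(1/2) ≤ (n * x - ((i:ℕ) + 1/2)) / (n / M : ℝ) := by rw [le_div_iff₀ hm]; linarith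
  have e2 : (n * x - ((i:ℕ) + 1/2)) / (n / M : ℝ) ≤ 1/2 := by rw [div_le_iff₀ hm]; linarith
  constructor <;> linarith

lemma Sm_mem (hM : 0 < M) (i : Fin n1 × Fin n2) (z : Z) :
    Sm M (aa n1 n2 M i) z ∈ Q ↔
      |X1 n1 n2 i z| < (n1 / M : ℝ) / 2 ∧ |X2 n1 n2 i z| < (n2 / M : ℝ) / 2 :=
  and_congr (coord_inner hM i.1 z.1) (coord_inner hM i.2 z.2)

lemma Sm_mem' (hM : 0 < M) (i : Fin n1 × Fin n2) (z : Z)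
    (h : |X1 n1 n2 i z| ≤ (n1 / M : ℝ) / 2 ∧ |X2 n1 n2 i z| ≤ (n2 / M : ℝ) / 2) :
    Sm M (aa n1 n2 M i) z ∈ closure Q := by
  rw [closure_Q]
  exact ⟨coord_inner' hM i.1 z.1 h.1, coord_inner' hM i.2 z.2 h.2⟩

lemma ratio {n M : ℕ} (hn : 2 ≤ n) (hM : n < M) : (0:ℝ) < n / M ∧ (n:ℝ) / M < 1 := by
  have h1 : (0:ℝ) < n := by exact_mod_cast (by omega : 0 < n)
  have h2 : (n:ℝ) < M := by exact_mod_cast hM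
  exact ⟨by have := h1.trans h2; positivity, by rw [div_lt_one (h1.trans h2)]; exact h2⟩

lemma Sm_tile (h1 : 2 ≤ n1) (h2 : 2 ≤ n2) (hM1 : n1 < M) (hM2 : n2 < M)
    (i : Fin n1 × Fin n2) (z : Z) (h : Sm M (aa n1 n2 M i) z ∈ Q) :
    |X1 n1 n2 i z| < 1/2 ∧ |X2 n1 n2 i z| < 1/2 := by
  rw [Sm_mem (by omega)] at h
  have a1 := (ratio h1 hM1).2
  have a2 := (ratio h2 hM2).2
  exact ⟨by linarith [h.1], by linarith [h.2]⟩

lemma datU (h1 : 2 ≤ n1) (h2 : 2 ≤ n2) (hM1 : n1 < M) (hM2 : n2 < M) :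
    Dat (M:ℝ) (aa n1 n2 M) (n1:ℝ)⁻¹ (Pu n1 n2 M) where
  hM := by exact_mod_cast (by omega : 0 < M)
  hc := by have : (0:ℝ) < n1 := by exact_mod_cast (by omega : 0 < n1)
           positivity
  hc1 := inv_lt_one_of_one_lt₀ (by exact_mod_cast (by omega : 1 < n1))
  hsub := fun i z h => tile_sub i z (Sm_tile h1 h2 hM1 hM2 i z h)
  hdisj := fun i j z h h' => tile_disj i j z (Sm_tile h1 h2 hM1 hM2 i z h)
    (Sm_tile h1 h2 hM1 hM2 j z h')
  hΦ0 := fun z hz => Phi_zero (ratio h1 hM1).1 (ratio h1 hM1).2 (ratio h2 hM2).2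
    (fun i h => hz (tile_sub i z h))
  hΦL := Phi_lip _ _ _ lip_X1 lip_X2
  hθ := by
    have a1 : (0:ℝ) < n1 := by exact_mod_cast (by omega : 0 < n1)
    have a2 := (ratio h2 hM2).2
    have a3 : (0:ℝ) < M := by exact_mod_cast (by omega : 0 < M)
    have : ((Fintype.card (Fin n1 × Fin n2) : ℕ) : ℝ) * (M:ℝ)⁻¹ ^ 2 * ((n1:ℝ)⁻¹ * M) = n2 / M := by
      simp only [Fintype.card_prod, Fintype.card_fin, Nat.cast_mul]
      field_simp
    rw [this]; exact a2

lemma datW (h1 : 2 ≤ n1) (h2 : 2 ≤ n2) (hM1 : n1 < M) (hM2 : n2 < M) :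
    Dat (M:ℝ) (aa n1 n2 M) (n2:ℝ)⁻¹ (Pw n1 n2 M) where
  hM := by exact_mod_cast (by omega : 0 < M)
  hc := by have : (0:ℝ) < n2 := by exact_mod_cast (by omega : 0 < n2)
           positivity
  hc1 := inv_lt_one_of_one_lt₀ (by exact_mod_cast (by omega : 1 < n2))
  hsub := fun i z h => tile_sub i z (Sm_tile h1 h2 hM1 hM2 i z h)
  hdisj := fun i j z h h' => tile_disj i j z (Sm_tile h1 h2 hM1 hM2 i z h)
    (Sm_tile h1 h2 hM1 hM2 j z h')
  hΦ0 := fun z hz => Phi_zero (ratio h2 hM2).1 (ratio h2 hM2).2 (ratio h1 hM1).2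
    (fun i h => hz (tile_sub i z h.symm))
  hΦL := Phi_lip _ _ _ lip_X2 lip_X1
  hθ := by
    have a1 : (0:ℝ) < n2 := by exact_mod_cast (by omega : 0 < n2)
    have a2 := (ratio h1 hM1).2
    have a3 : (0:ℝ) < M := by exact_mod_cast (by omega : 0 < M)
    have : ((Fintype.card (Fin n1 × Fin n2) : ℕ) : ℝ) * (M:ℝ)⁻¹ ^ 2 * ((n2:ℝ)⁻¹ * M) = n1 / M := by
      simp only [Fintype.card_prod, Fintype.card_fin, Nat.cast_mul]
      field_simp
    rw [this]; exact a2

lemma ae_nat {n : ℕ} (hn : 0 < n) : ∀ᵐ x : ℝ, ∀ k : ℕ, n * x ≠ k := by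
  refine ae_all_iff.2 fun k => ?_
  have hn' : (n:ℝ) ≠ 0 := by exact_mod_cast hn.ne'
  filter_upwards [Measure.ae_ne volume ((k:ℝ) / n)] with x hx h
  exact hx (by field_simp; linarith)

lemma ae_tile (h1 : 0 < n1) (h2 : 0 < n2) : ∀ᵐ z : Z, z ∈ Q →
    ∃ i : Fin n1 × Fin n2, |X1 n1 n2 i z| < 1/2 ∧ |X2 n1 n2 i z| < 1/2 := by
  have a1 : ∀ᵐ z : Z, ∀ k : ℕ, n1 * z.1 ≠ k := Measure.quasiMeasurePreserving_fst.ae (ae_nat h1)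
  have a2 : ∀ᵐ z : Z, ∀ k : ℕ, n2 * z.2 ≠ k := Measure.quasiMeasurePreserving_snd.ae (ae_nat h2)
  filter_upwards [a1, a2] with z b1 b2 hz
  obtain ⟨i, hi⟩ := coord_exists h1 hz.1 b1
  obtain ⟨j, hj⟩ := coord_exists h2 hz.2 b2
  exact ⟨(i, j), hi, hj⟩

lemma ae_diag (h2 : 0 < n2) {m1 m2 : ℝ} (hm2 : m2 < 1) (i : Fin n1 × Fin n2) : ∀ᵐ z : Z,
    (2 * |X1 n1 n2 i z| - m1) / (1 - m1) ≠ (2 * |X2 n1 n2 i z| - m2) / (1 - m2) := by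
  have hcl : IsClosed {z : Z |
      (2 * |X1 n1 n2 i z| - m1) / (1 - m1) = (2 * |X2 n1 n2 i z| - m2) / (1 - m2)} := by
    have := cont_X1 i
    have := cont_X2 i
    exact isClosed_eq (by fun_prop) (by fun_prop)
  have h0 : volume {z : Z |
      (2 * |X1 n1 n2 i z| - m1) / (1 - m1) = (2 * |X2 n1 n2 i z| - m2) / (1 - m2)} = 0 := by
    rw [Measure.volume_eq_prod, Measure.measure_prod_null hcl.measurableSet]
    refine Eventually.of_forall fun x => ?_
    simp only [Pi.zero_apply]
    set r := (2 * |n1 * x - ((i.1 : ℕ) + 1/2)| - m1) / (1 - m1) with hr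
    set e := ((i.2 : ℕ) + 1/2 : ℝ) with he
    have hn' : (n2:ℝ) ≠ 0 := by exact_mod_cast h2.ne'
    refine measure_mono_null (t := {(e + (r * (1 - m2) + m2) / 2) / n2,
      (e - (r * (1 - m2) + m2) / 2) / n2}) ?_ ((Set.toFinite _).measure_zero _)
    intro y hy
    have hy' : r = (2 * |n2 * y - e| - m2) / (1 - m2) := hy
    rw [eq_div_iff (by linarith)] at hy'
    have hy2 : |n2 * y - e| = (r * (1 - m2) + m2) / 2 := by linarith
    rcases abs_choice (n2 * y - e) with h | h
    · left; rw [h] at hy2; rw [← hy2]; field_simp; ring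
    · right; rw [h] at hy2; rw [← hy2]; simp only [mem_singleton_iff]; field_simp; ring
  exact measure_eq_zero_iff_ae_notMem.1 h0

/-- First coordinate. -/
abbrev L1 : Z →L[ℝ] ℝ := ContinuousLinearMap.fst ℝ ℝ ℝ
/-- Second coordinate. -/
abbrev L2 : Z →L[ℝ] ℝ := ContinuousLinearMap.snd ℝ ℝ ℝ

/-- Limit gradient. -/
def GU (n1 n2 M : ℕ) : Z → Z →L[ℝ] ℝ := GG (M:ℝ) (aa n1 n2 M) (n1:ℝ)⁻¹ (Pu n1 n2 M)
/-- Limit gradient. -/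
def GW (n1 n2 M : ℕ) : Z → Z →L[ℝ] ℝ := GG (M:ℝ) (aa n1 n2 M) (n2:ℝ)⁻¹ (Pw n1 n2 M)

lemma collar_aux {m1 m2 s t : ℝ} (hm2 : m2 < 1) (hm1 : m1 < 1)
    (hno : ¬ (|s| ≤ m1 / 2 ∧ |t| ≤ m2 / 2))
    (hlt : (2 * |t| - m2) / (1 - m2) < (2 * |s| - m1) / (1 - m1)) :
    m1 + (1 - m1) * rho m2 t < 2 * |s| := by
  have hpos : 0 < (2 * |s| - m1) / (1 - m1) := by
    by_contra hle
    push Not at hle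
    apply hno
    rw [div_le_iff₀ (by linarith)] at hle
    have h2 := hlt.trans_le (by rw [div_le_iff₀ (by linarith)]; exact hle :
      (2 * |s| - m1) / (1 - m1) ≤ 0)
    rw [div_lt_iff₀ (by linarith)] at h2
    constructor <;> linarith
  have hr : rho m2 t < (2 * |s| - m1) / (1 - m1) := max_lt hpos hlt
  rw [lt_div_iff₀ (by linarith)] at hr
  linarith

lemma collar (h1 : 2 ≤ n1) (h2 : 2 ≤ n2) (hM1 : n1 < M) (hM2 : n2 < M) : ∀ᵐ z : Z, z ∈ Q →
    (∀ i, Sm M (aa n1 n2 M i) z ∉ closure Q) →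
    fderiv ℝ (Pu n1 n2 M) z = - L1 ∨ fderiv ℝ (Pw n1 n2 M) z = -L2 := by
  obtain ⟨r1, r1'⟩ := ratio h1 hM1
  obtain ⟨r2, r2'⟩ := ratio h2 hM2
  have hd : ∀ᵐ z : Z, ∀ i : Fin n1 × Fin n2, _ :=
    ae_all_iff.2 fun i => ae_diag (n1 := n1) (n2 := n2) (m1 := n1/M) (by omega) r2' i
  filter_upwards [ae_tile (n1 := n1) (n2 := n2) (by omega) (by omega), hd] with z ht hz hQ hno
  obtain ⟨i, hi⟩ := ht hQ
  have hno' : ¬ _ := fun h => hno i (Sm_mem' (by omega) i z h)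
  rcases lt_or_gt_of_ne (hz i) with hlt | hgt
  · right
    refine Phi_fderiv_const (κ := fun i => ((i.2:ℕ):ℝ) + 1/2)
      (by exact_mod_cast (by omega : 0 < n2)) r2 r2' r1' cont_X2 cont_X1
      (fun i j z h h' => tile_disj i j z h.symm h'.symm) (fun i z => rfl) hi.symm ?_
    exact collar_aux r1' r2' (fun h => hno' h.symm) hlt
  · left
    refine Phi_fderiv_const (κ := fun i => ((i.1:ℕ):ℝ) + 1/2)
      (by exact_mod_cast (by omega : 0 < n1)) r1 r1' r2' cont_X1 cont_X2
      tile_disj (fun i z => rfl) hi ?_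
    exact collar_aux r2' r1' hno' hgt

/-- the two limit maps have a.e. disjointly supported gradients in the square. -/
lemma disjoint_grad (h1 : 2 ≤ n1) (h2 : 2 ≤ n2) (hM1 : n1 < M) (hM2 : n2 < M) : ∀ᵐ z : Z, z ∈ Q →
    L1 + GU n1 n2 M z = 0 ∨ L2 + GW n1 n2 M z = 0 := by
  obtain ⟨r1, r1'⟩ := ratio h1 hM1
  obtain ⟨r2, r2'⟩ := ratio h2 hM2
  have hMp : (0:ℝ) < M := by exact_mod_cast (by omega : 0 < M)
  have hn1 : (0:ℝ) < n1 := by exact_mod_cast (by omega : 0 < n1)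
  have hn2 : (0:ℝ) < n2 := by exact_mod_cast (by omega : 0 < n2)
  have DU := datU h1 h2 hM1 hM2
  have DW := datW h1 h2 hM1 hM2
  set D : Set Z := {z | z ∈ Q ∧ L1 + GU n1 n2 M z ≠ 0 ∧ L2 + GW n1 n2 M z ≠ 0} with hD
  have key : ∀ᵐ z : Z, z ∈ D → z ∈ ⋃ i, Sm M (aa n1 n2 M i) ⁻¹' D := by
    filter_upwards [ae_cases hMp (aa n1 n2 M), collar h1 h2 hM1 hM2, GG_inner DU, GG_inner DW]
      with z hc hcol iu iw hz
    rcases hc with ⟨i, hi⟩ | hc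
    · rw [mem_iUnion]
      refine ⟨i, hi, ?_, ?_⟩
      · have e : L1 + GU n1 n2 M z = ((n1:ℝ)⁻¹ * M) • (L1 + GU n1 n2 M (Sm M (aa n1 n2 M i) z)) := by
          have := iu i hi
          rw [GU, this, smul_add, ← add_assoc]
          congr 1
          rw [Pu, Phi_fderiv_inner (κ := fun i => ((i.1:ℕ):ℝ) + 1/2) hn1 r1 r1' r2' cont_X1 cont_X2
            tile_disj (L := L1) (fun i z => rfl) ((Sm_mem (by omega) i z).1 hi)]
          have : ((n1:ℝ)⁻¹ * M) = 1 + (1 / ((n1:ℝ) / M) - 1) := by field_simp; ring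
          rw [this, add_smul (1:ℝ), one_smul]
        intro h0
        apply hz.2.1
        rw [e, h0, smul_zero]
      · have e : L2 + GW n1 n2 M z = ((n2:ℝ)⁻¹ * M) • (L2 + GW n1 n2 M (Sm M (aa n1 n2 M i) z)) := by
          have := iw i hi
          rw [GW, this, smul_add, ← add_assoc]
          congr 1
          rw [Pw, Phi_fderiv_inner (κ := fun i => ((i.2:ℕ):ℝ) + 1/2) hn2 r2 r2' r1' cont_X2 cont_X1
            (fun i j z h h' => tile_disj i j z h.symm h'.symm) (L := L2) (fun i z => rfl)
            ((Sm_mem (by omega) i z).1 hi).symm]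
          have : ((n2:ℝ)⁻¹ * M) = 1 + (1 / ((n2:ℝ) / M) - 1) := by field_simp; ring
          rw [this, add_smul (1:ℝ), one_smul]
        intro h0
        apply hz.2.2
        rw [e, h0, smul_zero]
    · exfalso
      rcases hcol hz.1 hc with h | h
      · apply hz.2.1
        rw [GU, GG_collar DU hc, h, add_neg_cancel]
      · apply hz.2.2
        rw [GW, GG_collar DW hc, h, add_neg_cancel]
  have hDm : MeasurableSet D := by
    refine isOpen_Q.measurableSet.inter (MeasurableSet.inter ?_ ?_)
    · exact (measurableSet_singleton _).compl.preimage (measurable_GG.const_add _)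
    · exact (measurableSet_singleton _).compl.preimage (measurable_GG.const_add _)
  have hDfin : volume D ≠ ∞ := by
    refine ne_top_of_le_ne_top isCompact_closure_Q.measure_lt_top.ne
      (measure_mono (fun z hz => subset_closure hz.1))
  have hle : volume D ≤ ENNReal.ofReal (n1 * n2 * (M:ℝ)⁻¹ ^ 2) * volume D := by
    calc volume D ≤ volume (⋃ i, Sm M (aa n1 n2 M i) ⁻¹' D) := measure_mono_ae key
      _ ≤ ∑ i, volume (Sm M (aa n1 n2 M i) ⁻¹' D) := measure_iUnion_fintype_le _ _
      _ = ∑ i : Fin n1 × Fin n2, ENNReal.ofReal ((M:ℝ)⁻¹ ^ 2) * volume D := by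
          congr 1; ext i
          rw [← Measure.map_apply (continuous_Sm _ _).measurable hDm, map_Sm hMp]
          rfl
      _ = _ := by
          rw [Finset.sum_const, Finset.card_univ, nsmul_eq_mul, ENNReal.ofReal_mul (by positivity),
            ← mul_assoc]
          simp [Fintype.card_prod, ENNReal.ofReal_mul]
  have h0 : volume D = 0 := by
    by_contra hne
    have hlt : ENNReal.ofReal (n1 * n2 * (M:ℝ)⁻¹ ^ 2) < 1 := by
      rw [← ENNReal.ofReal_one]
      refine (ENNReal.ofReal_lt_ofReal_iff one_pos).2 ?_
      have : (n1 * n2 * (M:ℝ)⁻¹ ^ 2) = (n1 / M) * (n2 / M : ℝ) := by field_simp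
      rw [this]
      nlinarith
    have := ENNReal.mul_lt_mul_left hne hDfin hlt
    rw [one_mul] at this
    exact absurd hle (not_le.2 this)
  filter_upwards [measure_eq_zero_iff_ae_notMem.1 h0] with z hz hQ
  by_contra! hcon
  exact hz ⟨hQ, hcon⟩

end
end Lav

namespace Lav
section
variable {d : ℕ}

/-- Lebesgue measure on the cube. -/
abbrev mu (d : ℕ) : Measure (E d) := volume.restrict (cube d)

/-- The projection to the plane. -/
def prj (i0 i1 : Fin d) : E d →L[ℝ] Z :=
  (2:ℝ) • ((EuclideanSpace.proj i0).prod (EuclideanSpace.proj i1))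

lemma prj_apply (i0 i1 : Fin d) (x : E d) : prj i0 i1 x = (2 * x i0, 2 * x i1) := rfl

lemma map_pair {i0 i1 : Fin d} (h : i0 ≠ i1) :
    ∃ C : ℝ≥0∞, C ≠ ∞ ∧ Measure.map (fun x : E d => ((x i0, x i1) : Z)) (mu d) ≤ C • volume := by
  set ν : Measure ℝ := volume.restrict (Ioo (-1:ℝ) 1) with hν
  have hfin : IsFiniteMeasure ν := by rw [hν]; infer_instance
  have e1 : Measure.map (MeasurableEquiv.toLp 2 (Fin d → ℝ)).symm (mu d) =
      Measure.pi fun _ => ν := by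
    have hmp := (EuclideanSpace.volume_preserving_symm_measurableEquiv_toLp (Fin d))
    have hpre : cube d = (MeasurableEquiv.toLp 2 (Fin d → ℝ)).symm ⁻¹'
        (Set.pi univ fun _ => Ioo (-1:ℝ) 1) := by
      ext x; simp [cube, Set.mem_pi]
    rw [mu, hpre, (hmp.restrict_preimage_emb (MeasurableEquiv.measurableEmbedding _) _).map_eq,
      volume_pi, Measure.restrict_pi_pi]
  have e2 : Measure.map (fun x : E d => ((x i0, x i1) : Z)) (mu d) =
      Measure.map (fun y : Fin d → ℝ => ((y i0, y i1) : Z)) (Measure.pi fun _ => ν) := by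
    rw [← e1, Measure.map_map (by fun_prop) (by fun_prop)]
    rfl
  set C := ∏ i ∈ (Finset.univ.erase i0).erase i1, ν univ with hC
  have hCfin : C ≠ ∞ := by
    rw [hC]; exact (ENNReal.prod_lt_top fun i _ => measure_lt_top ν univ).ne
  have e3 : Measure.map (fun y : Fin d → ℝ => ((y i0, y i1) : Z)) (Measure.pi fun _ => ν) =
      (C • ν).prod ν := by
    have : IsFiniteMeasure (C • ν) := ν.smul_finite hCfin
    refine (Measure.prod_eq fun s t hs ht => ?_).symm
    rw [Measure.map_apply (by fun_prop) (hs.prod ht)]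
    have hpre : (fun y : Fin d → ℝ => ((y i0, y i1) : Z)) ⁻¹' (s ×ˢ t) =
        Set.pi univ (Function.update (Function.update (fun _ => univ) i0 s) i1 t) := by
      ext y
      simp only [mem_preimage, mem_prod, Set.mem_pi, mem_univ, true_implies]
      constructor
      · rintro ⟨a, b⟩ i
        by_cases h1 : i = i1
        · subst h1; simpa using b
        · rw [Function.update_of_ne h1]
          by_cases h0 : i = i0
          · subst h0; simpa using a
          · rw [Function.update_of_ne h0]; trivial
      · intro hy
        have a := hy i0
        have b := hy i1
        rw [Function.update_self] at b
        rw [Function.update_of_ne h, Function.update_self] at a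
        exact ⟨a, b⟩
    rw [hpre, Measure.pi_pi, ← Finset.mul_prod_erase _ _ (Finset.mem_univ i0),
      ← Finset.mul_prod_erase _ _ (Finset.mem_erase.2 ⟨h.symm, Finset.mem_univ i1⟩),
      Function.update_self, Function.update_of_ne h, Function.update_self,
      Finset.prod_congr rfl (g := fun _ => ν univ)]
    · rw [← hC, Measure.smul_apply, smul_eq_mul]; ring
    · intro i hi
      simp only [Finset.mem_erase] at hi
      rw [Function.update_of_ne hi.1, Function.update_of_ne hi.2.1]
  refine ⟨C, hCfin, ?_⟩
  rw [e2, e3, Measure.prod_smul_left, hν, Measure.prod_restrict, ← Measure.volume_eq_prod]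
  intro s
  simp only [Measure.smul_apply, smul_eq_mul]
  gcongr
  exact Measure.restrict_le_self

lemma map_prj {i0 i1 : Fin d} (h : i0 ≠ i1) :
    ∃ C : ℝ≥0∞, C ≠ ∞ ∧ Measure.map (prj i0 i1) (mu d) ≤ C • volume := by
  obtain ⟨C, hC, hle⟩ := map_pair h
  have e : Measure.map (prj i0 i1) (mu d) =
      Measure.map (Sm 2 0) (Measure.map (fun x : E d => ((x i0, x i1) : Z)) (mu d)) := by
    rw [Measure.map_map (continuous_Sm _ _).measurable (by fun_prop)]
    congr 1
    ext x <;> simp [prj_apply, Sm]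
  refine ⟨C * ENNReal.ofReal ((2:ℝ)⁻¹ ^ 2), ENNReal.mul_ne_top hC ENNReal.ofReal_ne_top, ?_⟩
  rw [e]
  refine (Measure.map_mono hle (continuous_Sm _ _).measurable).trans ?_
  rw [Measure.map_smul, map_Sm two_pos, smul_smul]

lemma ae_prj {i0 i1 : Fin d} (h : i0 ≠ i1) {p : Z → Prop} (hp : ∀ᵐ z, p z) :
    ∀ᵐ x ∂(mu d), p (prj i0 i1 x) := by
  obtain ⟨C, hC, hle⟩ := map_prj h
  have hac : Measure.map (prj i0 i1) (mu d) ≪ volume :=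
    (Measure.absolutelyContinuous_of_le hle).trans (Measure.smul_absolutelyContinuous)
  exact ae_of_ae_map (prj i0 i1).continuous.aemeasurable (hac.ae_le hp)

lemma memLp_prj {i0 i1 : Fin d} (h : i0 ≠ i1) {f : Z → ℝ} {q : ℝ≥0∞} (hf : MemLp f q) :
    MemLp (fun x => f (prj i0 i1 x)) q (mu d) := by
  obtain ⟨C, hC, hle⟩ := map_prj h
  have := hf.of_measure_le_smul hC hle
  exact (memLp_map_measure_iff this.aestronglyMeasurable
    (prj i0 i1).continuous.aemeasurable).1 this

lemma isOpen_cube : IsOpen (cube d) := by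
  have : cube d = ⋂ i, (fun x : E d => x i) ⁻¹' Ioo (-1:ℝ) 1 := by ext x; simp [cube]
  rw [this]
  exact isOpen_iInter_of_finite fun i => isOpen_Ioo.preimage (by fun_prop)

/-- The closed cubes. -/
def KK (d : ℕ) (r : ℝ) : Set (E d) := {x | ∀ i, x i ∈ Icc (-r) r}

lemma isCompact_KK (r : ℝ) : IsCompact (KK d r) := by
  have h : IsCompact (Set.pi univ fun _ : Fin d => Icc (-r) r) :=
    isCompact_univ_pi fun _ => isCompact_Icc
  have : KK d r = Set.image (WithLp.toLp 2) (Set.pi univ fun _ : Fin d => Icc (-r) r) := by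
    ext x
    simp only [KK, mem_ofPred_eq, mem_image, Set.mem_pi, mem_univ, true_implies]
    exact ⟨fun hx => ⟨x.ofLp, hx, rfl⟩, by rintro ⟨y, hy, rfl⟩; exact hy⟩
  rw [this]
  exact h.image (PiLp.continuous_toLp 2 _)

lemma KK_sub {r : ℝ} (hr : r < 1) : KK d r ⊆ cube d := fun x hx i =>
  ⟨by linarith [(hx i).1], by linarith [(hx i).2]⟩

instance : IsFiniteMeasure (mu d) := by
  refine ⟨?_⟩
  rw [Measure.restrict_apply_univ]
  refine (measure_mono (fun x hx i => ⟨(hx i).1.le, (hx i).2.le⟩)).trans_lt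
    (isCompact_KK (d := d) 1).measure_lt_top

/-- One-dimensional cutoff. -/
def bump : ContDiffBump (0:ℝ) := ⟨1/2, 3/4, by norm_num, by norm_num⟩

/-- The cutoff. -/
def chi (d : ℕ) (x : E d) : ℝ := ∏ i, bump (x i)

lemma contDiff_chi : ContDiff ℝ (⊤ : ℕ∞) (chi d) := by
  unfold chi
  refine contDiff_prod fun i _ => bump.contDiff.comp ?_
  exact (EuclideanSpace.proj (𝕜 := ℝ) i).contDiff

lemma chi_nonneg (x : E d) : 0 ≤ chi d x := Finset.prod_nonneg fun i _ => bump.nonneg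

lemma chi_le_one (x : E d) : chi d x ≤ 1 := Finset.prod_le_one (fun i _ => bump.nonneg)
  fun i _ => bump.le_one

lemma chi_zero {x : E d} (hx : x ∉ KK d (3/4)) : chi d x = 0 := by
  simp only [KK, mem_ofPred_eq, not_forall] at hx
  obtain ⟨i, hi⟩ := hx
  refine Finset.prod_eq_zero (Finset.mem_univ i) ?_
  refine bump.zero_of_le_dist ?_
  rw [Real.dist_eq, sub_zero]
  by_contra hlt
  push Not at hlt
  exact hi (abs_le.1 hlt.le)

lemma chi_pos_zero : chi d 0 = 1 := by
  refine Finset.prod_eq_one fun i _ => bump.one_of_mem_closedBall ?_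
  simp [bump]

lemma chi_supp : HasCompactSupport (chi d) :=
  HasCompactSupport.intro (isCompact_KK (3/4)) fun _ hx => chi_zero hx

lemma dchi_zero {x : E d} (hx : x ∉ KK d (3/4)) : fderiv ℝ (chi d) x = 0 := by
  have : chi d =ᶠ[𝓝 x] fun _ => 0 := by
    filter_upwards [(isCompact_KK (d := d) (3/4)).isClosed.isOpen_compl.mem_nhds hx] with y hy
    exact chi_zero hy
  rw [this.fderiv_eq]; exact fderiv_const_apply _

lemma dchi_bound : ∃ C, ∀ x, ‖fderiv ℝ (chi d) x‖ ≤ C :=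
  (chi_supp.fderiv (𝕜 := ℝ)).exists_bound_of_continuous
    (contDiff_chi.continuous_fderiv (by simp))

lemma dchi_dir {x : E d} {i : Fin d} (hx : |x i| < 1/2) :
    fderiv ℝ (chi d) x (EuclideanSpace.single i 1) = 0 := by
  have hd : DifferentiableAt ℝ (chi d) x := contDiff_chi.differentiable (by simp) x
  rw [← hd.lineDeriv_eq_fderiv, lineDeriv]
  have hc : Tendsto (fun t : ℝ => |x i + t|) (𝓝 0) (𝓝 |x i + 0|) :=
    Continuous.tendsto (by fun_prop) 0
  rw [add_zero] at hc
  have : (fun t : ℝ => chi d (x + t • EuclideanSpace.single i (1:ℝ))) =ᶠ[𝓝 0] fun _ => chi d x := by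
    filter_upwards [hc.eventually_lt_const hx] with t ht
    refine Finset.prod_congr rfl fun j _ => ?_
    by_cases hj : j = i
    · subst hj
      rw [bump.one_of_mem_closedBall, bump.one_of_mem_closedBall]
      · simpa [bump] using hx.le
      · simpa [bump] using ht.le
    · simp [hj]
  rw [this.deriv_eq, deriv_const]

end
end Lav

namespace Lav
section
variable {d : ℕ}

lemma IsLip.mul_bdd {X : Type*} [PseudoMetricSpace X] {f g : X → ℝ} (hf : IsLip f) (hg : IsLip g)
    {A B : ℝ} (hA : ∀ x, |f x| ≤ A) (hB : ∀ x, |g x| ≤ B) : IsLip fun x => f x * g x := by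
  obtain ⟨C, hC⟩ := hf
  obtain ⟨D, hD⟩ := hg
  refine ⟨(A * D + B * C).toNNReal, LipschitzWith.of_dist_le_mul fun x y => ?_⟩
  have h1 := hC.dist_le_mul x y
  have h2 := hD.dist_le_mul x y
  rw [Real.dist_eq] at h1 h2 ⊢
  have hA0 : 0 ≤ A := (abs_nonneg _).trans (hA x)
  have hB0 : 0 ≤ B := (abs_nonneg _).trans (hB x)
  rw [Real.coe_toNNReal _ (by positivity)]
  calc |f x * g x - f y * g y| = |f x * (g x - g y) + g y * (f x - f y)| := by ring_nf
    _ ≤ |f x| * |g x - g y| + |g y| * |f x - f y| := by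
        refine (abs_add_le _ _).trans ?_
        rw [abs_mul, abs_mul]
    _ ≤ A * (D * dist x y) + B * (C * dist x y) := by
        gcongr
        · exact hA x
        · exact hB y
    _ = _ := by ring

lemma IsLip.add {X : Type*} [PseudoMetricSpace X] {f g : X → ℝ} (hf : IsLip f) (hg : IsLip g) :
    IsLip fun x => f x + g x := by
  obtain ⟨C, hC⟩ := hf
  obtain ⟨D, hD⟩ := hg
  exact ⟨C + D, hC.add hD⟩

/-- Cut-off functions. -/
def U (i0 i1 : Fin d) (ℓ : Z →L[ℝ] ℝ) (ψ : Z → ℝ) (x : E d) : ℝ :=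
  chi d x * (ℓ (prj i0 i1 x) + ψ (prj i0 i1 x))

/-- Their gradients. -/
def A (i0 i1 : Fin d) (ℓ : Z →L[ℝ] ℝ) (ψ : Z → ℝ) (G : Z → Z →L[ℝ] ℝ) (x : E d) : E d →L[ℝ] ℝ :=
  (ℓ (prj i0 i1 x) + ψ (prj i0 i1 x)) • fderiv ℝ (chi d) x +
    chi d x • (ℓ + G (prj i0 i1 x)).comp (prj i0 i1)

variable {i0 i1 : Fin d} {ℓ : Z →L[ℝ] ℝ}

lemma fderiv_U {ψ : Z → ℝ} {x : E d} (h : DifferentiableAt ℝ ψ (prj i0 i1 x)) :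
    fderiv ℝ (U i0 i1 ℓ ψ) x = A i0 i1 ℓ ψ (fderiv ℝ ψ) x := by
  have h1 : HasFDerivAt (chi d) (fderiv ℝ (chi d) x) x :=
    (contDiff_chi.differentiable (by simp) x).hasFDerivAt
  have h2 : HasFDerivAt (fun y => ψ (prj i0 i1 y))
      ((fderiv ℝ ψ (prj i0 i1 x)).comp (prj i0 i1)) x :=
    h.hasFDerivAt.comp x (prj i0 i1).hasFDerivAt
  have h3 : HasFDerivAt (fun y => ℓ (prj i0 i1 y)) (ℓ.comp (prj i0 i1)) x :=
    (ℓ.comp (prj i0 i1)).hasFDerivAt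
  have h4 := h1.mul (h3.add h2)
  have h5 := h4.fderiv
  change fderiv ℝ (U i0 i1 ℓ ψ) x = _ at h5
  rw [h5, A, add_comm, ContinuousLinearMap.add_comp]
  rfl

lemma U_zero {ψ : Z → ℝ} {x : E d} (hx : x ∉ KK d (3/4)) : U i0 i1 ℓ ψ x = 0 := by
  rw [U, chi_zero hx, zero_mul]

lemma A_zero {ψ : Z → ℝ} {G} {x : E d} (hx : x ∉ KK d (3/4)) : A i0 i1 ℓ ψ G x = 0 := by
  rw [A, chi_zero hx, dchi_zero hx, smul_zero, zero_smul, zero_add]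

lemma U_bound (i0 i1 : Fin d) (ℓ : Z →L[ℝ] ℝ) (B : ℝ) : ∃ C, ∀ ψ : Z → ℝ, (∀ z, |ψ z| ≤ B) →
    ∀ x, |U i0 i1 ℓ ψ x| ≤ C := by
  have hc : Continuous fun x => chi d x * ℓ (prj i0 i1 x) :=
    contDiff_chi.continuous.mul (ℓ.comp (prj i0 i1)).continuous
  obtain ⟨C, hC⟩ := (chi_supp (d := d)).mul_right (f' := fun x => ℓ (prj i0 i1 x))
    |>.exists_bound_of_continuous hc
  refine ⟨C + B, fun ψ hψ x => ?_⟩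
  have h1 := hC x
  have h2 := hψ (prj i0 i1 x)
  rw [Real.norm_eq_abs] at h1
  rw [U, mul_add]
  refine (abs_add_le _ _).trans (add_le_add h1 ?_)
  rw [abs_mul, abs_of_nonneg (chi_nonneg x)]
  calc chi d x * |ψ (prj i0 i1 x)| ≤ 1 * B := by
        gcongr
        exact chi_le_one x
    _ = B := one_mul B

lemma A_bound (i0 i1 : Fin d) (ℓ : Z →L[ℝ] ℝ) (B : ℝ) : ∃ C, 0 ≤ C ∧ ∀ ψ : Z → ℝ,
    (∀ z, |ψ z| ≤ B) → ∀ G x,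
    ‖A i0 i1 ℓ ψ G x‖ ≤ C * (1 + ‖G (prj i0 i1 x)‖) ∧
    (ℓ + G (prj i0 i1 x) = 0 → ‖A i0 i1 ℓ ψ G x‖ ≤ C) := by
  have hc : Continuous fun x => ℓ (prj i0 i1 x) • fderiv ℝ (chi d) x :=
    (ℓ.comp (prj i0 i1)).continuous.smul (contDiff_chi.continuous_fderiv (by simp))
  have hs : HasCompactSupport fun x => ℓ (prj i0 i1 x) • fderiv ℝ (chi d) x :=
    HasCompactSupport.intro (isCompact_KK (3/4)) fun x hx => by rw [dchi_zero hx, smul_zero]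
  obtain ⟨C, hC⟩ := hs.exists_bound_of_continuous hc
  obtain ⟨C2, hC2⟩ := dchi_bound (d := d)
  have hC0 : 0 ≤ C := (norm_nonneg _).trans (hC 0)
  have hC20 : 0 ≤ C2 := (norm_nonneg _).trans (hC2 0)
  set N := ‖prj i0 i1‖
  have hN : 0 ≤ N := norm_nonneg _
  refine ⟨C + |B| * C2 + (‖ℓ‖ + 1) * N, by positivity, fun ψ hψ G x => ?_⟩
  have h1 : ‖(ℓ (prj i0 i1 x) + ψ (prj i0 i1 x)) • fderiv ℝ (chi d) x‖ ≤ C + |B| * C2 := by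
    rw [add_smul]
    refine (norm_add_le _ _).trans (add_le_add (hC x) ?_)
    rw [norm_smul]
    gcongr
    · exact (hψ _).trans (le_abs_self _)
    · exact hC2 x
  have h2 : ‖chi d x • (ℓ + G (prj i0 i1 x)).comp (prj i0 i1)‖ ≤
      (‖ℓ‖ + ‖G (prj i0 i1 x)‖) * N := by
    rw [norm_smul, Real.norm_eq_abs, abs_of_nonneg (chi_nonneg x)]
    calc _ ≤ 1 * ‖(ℓ + G (prj i0 i1 x)).comp (prj i0 i1)‖ := by gcongr; exact chi_le_one x
      _ = ‖(ℓ + G (prj i0 i1 x)).comp (prj i0 i1)‖ := one_mul _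
      _ ≤ ‖ℓ + G (prj i0 i1 x)‖ * N := ContinuousLinearMap.opNorm_comp_le _ _
      _ ≤ _ := by gcongr; exact norm_add_le _ _
  constructor
  · refine (norm_add_le _ _).trans ((add_le_add h1 h2).trans ?_)
    have h3 : 0 ≤ ‖G (prj i0 i1 x)‖ := norm_nonneg _
    have h4 : 0 ≤ ‖ℓ‖ := norm_nonneg _
    have h5 : 0 ≤ (C + |B| * C2 + ‖ℓ‖ * N) * ‖G (prj i0 i1 x)‖ := by positivity
    nlinarith
  · intro h0
    rw [A, h0, ContinuousLinearMap.zero_comp, smul_zero, add_zero]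
    refine h1.trans ?_
    have : 0 ≤ (‖ℓ‖ + 1) * N := by positivity
    linarith

/-- Weak gradient formula. -/
def WF (u : E d → ℝ) (a : E d → E d →L[ℝ] ℝ) : Prop :=
  ∀ ξ : E d → ℝ, ContDiff ℝ (⊤ : ℕ∞) ξ → HasCompactSupport ξ → ∀ v : E d,
    ∫ x, u x * fderiv ℝ ξ x v ∂(mu d) = - ∫ x, a x v * ξ x ∂(mu d)

lemma fderiv_zero_KK {f : E d → ℝ} (h0 : ∀ x ∉ KK d (3/4), f x = 0) {x : E d}
    (hx : x ∉ KK d (3/4)) : fderiv ℝ f x = 0 := by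
  have : f =ᶠ[𝓝 x] fun _ => 0 := by
    filter_upwards [(isCompact_KK (d := d) (3/4)).isClosed.isOpen_compl.mem_nhds hx] with y hy
    exact h0 y hy
  rw [this.fderiv_eq]; exact fderiv_const_apply _

lemma notMem_KK {x : E d} (hx : x ∉ cube d) : x ∉ KK d (3/4) := fun h => hx (KK_sub (by norm_num) h)

lemma WF_lip {f : E d → ℝ} (hf : IsLip f) (h0 : ∀ x ∉ KK d (3/4), f x = 0) :
    WF f (fderiv ℝ f) := by
  intro ξ hξ hξs v
  obtain ⟨C, hC⟩ := hf
  obtain ⟨D, hD⟩ := ContDiff.lipschitzWith_of_hasCompactSupport hξs hξ (by simp)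
  have key := hC.integral_lineDeriv_mul_eq (μ := volume) hD hξs v
  have e1 : ∫ x, lineDeriv ℝ f x v * ξ x = ∫ x, fderiv ℝ f x v * ξ x := by
    refine integral_congr_ae ?_
    filter_upwards [hC.ae_differentiableAt (μ := volume)] with x hx
    rw [hx.lineDeriv_eq_fderiv]
  have e2 : ∫ x, lineDeriv ℝ ξ x (-v) * f x = - ∫ x, f x * fderiv ℝ ξ x v := by
    rw [← integral_neg]
    refine integral_congr_ae (Eventually.of_forall fun x => ?_)
    simp only
    rw [(hξ.differentiable (by simp) x).lineDeriv_eq_fderiv, map_neg]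
    ring
  rw [setIntegral_eq_integral_of_forall_compl_eq_zero, setIntegral_eq_integral_of_forall_compl_eq_zero,
    ← e1, key, e2, neg_neg]
  · intro x hx
    rw [fderiv_zero_KK h0 (notMem_KK hx)]; simp
  · intro x hx
    rw [h0 x (notMem_KK hx), zero_mul]

lemma lip_of_smooth {f : E d → ℝ} (hf : ContDiff ℝ (⊤ : ℕ∞) f) (hs : HasCompactSupport f) :
    IsLip f := ContDiff.lipschitzWith_of_hasCompactSupport hs hf (by simp)

lemma U_lip {ψ : Z → ℝ} (hψ : IsLip ψ) {B : ℝ} (hB : ∀ z, |ψ z| ≤ B) : IsLip (U i0 i1 ℓ ψ) := by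
  have h1 : IsLip fun x => chi d x * ℓ (prj i0 i1 x) :=
    lip_of_smooth (contDiff_chi.mul (ℓ.comp (prj i0 i1)).contDiff) chi_supp.mul_right
  have h2 : IsLip fun x => ψ (prj i0 i1 x) := by
    obtain ⟨C, hC⟩ := hψ
    exact ⟨_, hC.comp (prj i0 i1).lipschitz⟩
  have h3 : IsLip fun x => chi d x * ψ (prj i0 i1 x) :=
    (lip_of_smooth contDiff_chi chi_supp).mul_bdd h2 (A := 1) (B := B)
      (fun x => by rw [abs_of_nonneg (chi_nonneg x)]; exact chi_le_one x) (fun x => hB _)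
  have : U i0 i1 ℓ ψ = fun x => chi d x * ℓ (prj i0 i1 x) + chi d x * ψ (prj i0 i1 x) := by
    ext x; rw [U, mul_add]
  rw [this]
  exact h1.add h3

lemma WF_zero : WF (U i0 i1 ℓ (fun _ => 0)) (A i0 i1 ℓ (fun _ => 0) (fun _ => 0)) := by
  have h := WF_lip (U_lip (i0 := i0) (i1 := i1) (ℓ := ℓ) (ψ := fun _ => 0) (.const 0) (B := 0)
    (by simp)) (fun x hx => U_zero hx)
  have e : fderiv ℝ (U i0 i1 ℓ (fun _ => 0)) = A i0 i1 ℓ (fun _ => 0) (fun _ => 0) := by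
    ext1 x
    rw [fderiv_U (differentiableAt_const _)]
    simp only [A, fderiv_const_apply]
  rwa [e] at h

variable {ι : Type} [Fintype ι] {M c : ℝ} {a : ι → Z} {Φ : Z → ℝ}

lemma WF_dat (h01 : i0 ≠ i1) (D : Dat M a c Φ) :
    WF (U i0 i1 ℓ (psi M a c Φ)) (A i0 i1 ℓ (psi M a c Φ) (GG M a c Φ)) := by
  intro ξ hξ hξs v
  obtain ⟨B, hB, hl⟩ := psi_props D
  obtain ⟨C1, hC1⟩ := U_bound i0 i1 ℓ B
  obtain ⟨C2, hC20, hC2⟩ := A_bound i0 i1 ℓ B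
  obtain ⟨X1, hX1⟩ := hξs.exists_bound_of_continuous hξ.continuous
  obtain ⟨X2, hX2⟩ := (hξs.fderiv (𝕜 := ℝ)).exists_bound_of_continuous
    (hξ.continuous_fderiv (by simp))
  have hU : ∀ n, IsLip (U i0 i1 ℓ (psin M a c Φ n)) := fun n => U_lip (psin_lip D n) (hB n)
  have hHH := memLp_prj h01 (memLp_one_iff_integrable.2 (integrable_HH D))
  rw [memLp_one_iff_integrable] at hHH
  have hgr := ae_prj h01 (ae_grad D)
  have t1 : Tendsto (fun n => ∫ x, U i0 i1 ℓ (psin M a c Φ n) x * fderiv ℝ ξ x v ∂(mu d)) atTop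
      (𝓝 (∫ x, U i0 i1 ℓ (psi M a c Φ) x * fderiv ℝ ξ x v ∂(mu d))) := by
    refine tendsto_integral_of_dominated_convergence (fun _ => C1 * (X2 * ‖v‖)) ?_
      (integrable_const _) ?_ ?_
    · intro n
      obtain ⟨C, hC⟩ := hU n
      refine (hC.continuous.mul ?_).aestronglyMeasurable
      exact (hξ.continuous_fderiv (by simp)).clm_apply continuous_const
    · intro n
      refine Eventually.of_forall fun x => ?_
      rw [norm_mul]
      have e1 := hC1 _ (hB n) x
      have e2 : ‖fderiv ℝ ξ x v‖ ≤ X2 * ‖v‖ :=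
        (ContinuousLinearMap.le_opNorm _ _).trans (by gcongr; exact hX2 x)
      exact mul_le_mul e1 e2 (norm_nonneg _) ((abs_nonneg _).trans e1)
    · refine Eventually.of_forall fun x => Tendsto.mul_const _ ?_
      exact ((hl _).const_add _).const_mul _
  have t2 : Tendsto (fun n => ∫ x, fderiv ℝ (U i0 i1 ℓ (psin M a c Φ n)) x v * ξ x ∂(mu d)) atTop
      (𝓝 (∫ x, A i0 i1 ℓ (psi M a c Φ) (GG M a c Φ) x v * ξ x ∂(mu d))) := by
    refine tendsto_integral_of_dominated_convergence
      (fun x => (C2 * (1 + HH M a c Φ (prj i0 i1 x))) * (‖v‖ * X1)) ?_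
      ((((integrable_const 1).add hHH).const_mul C2).mul_const _) ?_ ?_
    · intro n
      exact ((measurable_fderiv_apply_const ℝ _ v).mul hξ.continuous.measurable).aestronglyMeasurable
    · intro n
      filter_upwards [hgr] with x hx
      rw [fderiv_U (hx n).1, norm_mul]
      have e1 : ‖A i0 i1 ℓ (psin M a c Φ n) (fderiv ℝ (psin M a c Φ n)) x‖ ≤
          C2 * (1 + HH M a c Φ (prj i0 i1 x)) :=
        ((hC2 _ (hB n) _ x).1).trans (by gcongr; exact (hx n).2)
      have e2 := (ContinuousLinearMap.le_opNorm (A i0 i1 ℓ (psin M a c Φ n)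
        (fderiv ℝ (psin M a c Φ n)) x) v)
      have hX10 : 0 ≤ X1 := (norm_nonneg _).trans (hX1 0)
      calc _ ≤ (C2 * (1 + HH M a c Φ (prj i0 i1 x)) * ‖v‖) * X1 := by
            refine mul_le_mul (e2.trans ?_) (hX1 x) (norm_nonneg _) ?_
            · gcongr
            · exact mul_nonneg ((norm_nonneg _).trans e1) (norm_nonneg _)
        _ = _ := by ring
    · filter_upwards [hgr, ae_prj h01 (ae_grad_lim D)] with x hx hx2
      refine Tendsto.mul_const _ ?_
      have e : (fun n => fderiv ℝ (U i0 i1 ℓ (psin M a c Φ n)) x v) = fun n =>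
          (ℓ (prj i0 i1 x) + psin M a c Φ n (prj i0 i1 x)) * fderiv ℝ (chi d) x v +
          chi d x * (ℓ (prj i0 i1 v) + fderiv ℝ (psin M a c Φ n) (prj i0 i1 x) (prj i0 i1 v)) := by
        ext n
        rw [fderiv_U (hx n).1]; rfl
      rw [e]
      have hx3 : Tendsto (fun n => fderiv ℝ (psin M a c Φ n) (prj i0 i1 x) (prj i0 i1 v)) atTop
          (𝓝 (GG M a c Φ (prj i0 i1 x) (prj i0 i1 v))) :=
        ((ContinuousLinearMap.apply ℝ ℝ (prj i0 i1 v)).continuous.tendsto _).comp hx2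
      exact (((hl _).const_add _).mul_const _).add ((hx3.const_add _).const_mul _)
  refine tendsto_nhds_unique t1 ?_
  have : ∀ n, ∫ x, U i0 i1 ℓ (psin M a c Φ n) x * fderiv ℝ ξ x v ∂(mu d) =
      - ∫ x, fderiv ℝ (U i0 i1 ℓ (psin M a c Φ n)) x v * ξ x ∂(mu d) := fun n =>
    WF_lip (hU n) (fun x hx => U_zero hx) ξ hξ hξs v
  simp only [this]
  exact t2.neg

end
end Lav

namespace Lav
section
variable {d : ℕ} {i0 i1 : Fin d} {ℓ : Z →L[ℝ] ℝ}

/-- basis vector -/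
abbrev ee (i : Fin d) : E d := EuclideanSpace.single i 1

/-- The rotated gradient. -/
def bvec (i0 i1 : Fin d) (L : E d →L[ℝ] ℝ) : E d := L (ee i1) • ee i0 - L (ee i0) • ee i1

/-- The Riesz representative. -/
def gvec (L : E d →L[ℝ] ℝ) : E d := (InnerProductSpace.toDual ℝ (E d)).symm L

lemma inner_b (L K : E d →L[ℝ] ℝ) :
    ⟪bvec i0 i1 L, gvec K⟫ = L (ee i1) * K (ee i0) - L (ee i0) * K (ee i1) := by
  rw [real_inner_comm, gvec, InnerProductSpace.toDual_symm_apply, bvec, map_sub, map_smul, map_smul]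
  rfl

lemma gvec_apply (L : E d →L[ℝ] ℝ) (i : Fin d) : gvec L i = L (ee i) := by
  have : L (ee i) = ⟪gvec L, ee i⟫ := by rw [gvec, InnerProductSpace.toDual_symm_apply]
  rw [this, EuclideanSpace.inner_single_right]; simp

lemma norm_gvec (L : E d →L[ℝ] ℝ) : ‖gvec L‖ = ‖L‖ := LinearIsometryEquiv.norm_map _ _

lemma norm_bvec (L : E d →L[ℝ] ℝ) : ‖bvec i0 i1 L‖ ≤ 2 * ‖L‖ := by
  have h : ∀ i j : Fin d, ‖L (ee i) • ee j‖ ≤ ‖L‖ := fun i j => by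
    rw [norm_smul]
    have := L.le_opNorm (ee i)
    simpa using this
  refine (norm_sub_le _ _).trans ?_
  linarith [h i1 i0, h i0 i1]

lemma continuous_gvec : Continuous (gvec (d := d)) :=
  (InnerProductSpace.toDual ℝ (E d)).symm.continuous

lemma continuous_bvec : Continuous (bvec i0 i1) := by
  unfold bvec
  fun_prop

lemma gradient_eq (v : E d → ℝ) (x : E d) : gradient v x = gvec (fderiv ℝ v x) := rfl

lemma integrable_apply_mul {a : E d → E d →L[ℝ] ℝ} (ha : Integrable a (mu d)) {f : E d → ℝ}
    (hf : Continuous f) (hs : HasCompactSupport f) (v : E d) :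
    Integrable (fun x => a x v * f x) (mu d) := by
  obtain ⟨C, hC⟩ := hs.exists_bound_of_continuous hf
  exact (ha.apply_continuousLinearMap v).mul_bdd hf.aestronglyMeasurable (Eventually.of_forall hC)

lemma divfree_smooth {u : E d → ℝ} {a : E d → E d →L[ℝ] ℝ} (hw : WF u a)
    (ha : Integrable a (mu d)) {v : E d → ℝ} (hv : ContDiff ℝ (⊤ : ℕ∞) v)
    (hs : HasCompactSupport v) :
    ∫ x, (a x (ee i1) * fderiv ℝ v x (ee i0) - a x (ee i0) * fderiv ℝ v x (ee i1)) ∂(mu d) = 0 := by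
  have hsm : ContDiff ℝ (⊤ : ℕ∞) (fderiv ℝ v) := hv.fderiv_right (by simp)
  have hsi : ∀ i, ContDiff ℝ (⊤ : ℕ∞) fun x => fderiv ℝ v x (ee i) := fun i =>
    hsm.clm_apply contDiff_const
  have hss : ∀ i, HasCompactSupport fun x => fderiv ℝ v x (ee i) := fun i =>
    (hs.fderiv (𝕜 := ℝ)).comp_left (g := fun L : E d →L[ℝ] ℝ => L (ee i)) rfl
  have h2 : ∀ i j x, fderiv ℝ (fun x => fderiv ℝ v x (ee i)) x (ee j) =
      fderiv ℝ (fderiv ℝ v) x (ee j) (ee i) := by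
    intro i j x
    have hd : DifferentiableAt ℝ (fderiv ℝ v) x := hsm.differentiable (by simp) x
    rw [fderiv_clm_apply hd (differentiableAt_const _)]
    simp
  rw [integral_sub (integrable_apply_mul ha (hsi i0).continuous (hss i0) _)
    (integrable_apply_mul ha (hsi i1).continuous (hss i1) _)]
  have k1 := hw _ (hsi i0) (hss i0) (ee i1)
  have k2 := hw _ (hsi i1) (hss i1) (ee i0)
  have k3 : ∀ x, fderiv ℝ (fun x => fderiv ℝ v x (ee i0)) x (ee i1) =
      fderiv ℝ (fun x => fderiv ℝ v x (ee i1)) x (ee i0) := by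
    intro x
    rw [h2, h2]
    exact (hv.contDiffAt.isSymmSndFDerivAt (by
      rw [minSmoothness_of_isRCLikeNormedField]
      exact WithTop.coe_le_coe.2 (le_top : (2:ℕ∞) ≤ ⊤))).eq _ _
  simp only [k3] at k1
  linarith

lemma divfree {u : E d → ℝ} {a : E d → E d →L[ℝ] ℝ} (hw : WF u a)
    (ha : Integrable a (mu d)) (h0 : ∀ x ∉ KK d (3/4), a x = 0) {v : E d → ℝ}
    (hv : ContDiffOn ℝ (⊤ : ℕ∞) v (cube d)) :
    ∫ x in cube d, ⟪bvec i0 i1 (a x), gradient v x⟫ = 0 := by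
  obtain ⟨η, hη0, hη1, -⟩ := exists_contMDiffMap_zero_one_nhds_of_isClosed (n := (⊤ : ℕ∞))
    (modelWithCornersSelf ℝ (E d)) (s := (cube d)ᶜ) (t := KK d (3/4))
    isOpen_cube.isClosed_compl (isCompact_KK _).isClosed
    (disjoint_left.2 fun x hx hx2 => hx (KK_sub (by norm_num) hx2))
  have hηc : ContDiff ℝ (⊤ : ℕ∞) η := η.contMDiff.contDiff
  have hηv : ContDiff ℝ (⊤ : ℕ∞) fun x => η x * v x := by
    rw [contDiff_iff_contDiffAt]
    intro x
    by_cases hx : x ∈ cube d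
    · exact hηc.contDiffAt.mul (hv.contDiffAt (isOpen_cube.mem_nhds hx))
    · have : (fun x => η x * v x) =ᶠ[𝓝 x] fun _ => 0 := by
        filter_upwards [(eventually_nhdsSet_iff_forall.1 hη0) x hx] with y hy
        rw [hy, zero_mul]
      exact contDiffAt_const.congr_of_eventuallyEq this
  have hsupp : HasCompactSupport fun x => η x * v x := by
    refine HasCompactSupport.intro (isCompact_KK (d := d) 1) fun x hx => ?_
    have : x ∉ cube d := fun h => hx fun i => ⟨(h i).1.le, (h i).2.le⟩
    rw [((eventually_nhdsSet_iff_forall.1 hη0) x this).self_of_nhds, zero_mul]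
  rw [← divfree_smooth (i0 := i0) (i1 := i1) hw ha hηv hsupp]
  refine integral_congr_ae (Eventually.of_forall fun x => ?_)
  simp only
  rw [gradient_eq, inner_b]
  by_cases hx : x ∈ KK d (3/4)
  · have : (fun x => η x * v x) =ᶠ[𝓝 x] v := by
      filter_upwards [(eventually_nhdsSet_iff_forall.1 hη1) x hx] with y hy
      rw [hy, one_mul]
    rw [this.fderiv_eq]
  · rw [h0 x hx]; simp

lemma measurable_A {ψ : Z → ℝ} {G : Z → Z →L[ℝ] ℝ} (hψ : Measurable ψ) (hG : Measurable G) :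
    Measurable (A i0 i1 ℓ ψ G) := by
  have hp : Measurable (prj i0 i1) := (prj i0 i1).continuous.measurable
  have hc : Measurable fun L : Z →L[ℝ] ℝ => L.comp (prj i0 i1) := by
    refine Continuous.measurable ?_
    fun_prop
  have h1 : Measurable fun x => (ℓ + G (prj i0 i1 x)).comp (prj i0 i1) :=
    hc.comp ((hG.comp hp).const_add ℓ)
  have h2 : Measurable fun x => ℓ (prj i0 i1 x) + ψ (prj i0 i1 x) :=
    (ℓ.continuous.measurable.comp hp).add (hψ.comp hp)
  exact (h2.smul (measurable_fderiv ℝ (chi d))).add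
    (contDiff_chi.continuous.measurable.smul h1)

variable {ι : Type} [Fintype ι] {M c : ℝ} {a : ι → Z} {Φ : Z → ℝ}

lemma memLp_A (h01 : i0 ≠ i1) (D : Dat M a c Φ) {q : ℝ≥0∞} (hq : MemLp (HH M a c Φ) q) :
    MemLp (A i0 i1 ℓ (psi M a c Φ) (GG M a c Φ)) q (mu d) := by
  obtain ⟨B, hB⟩ := psi_bound D
  obtain ⟨C, hC0, hC⟩ := A_bound i0 i1 ℓ B
  have h0 : MemLp (fun _ : E d => (1:ℝ)) q (mu d) := memLp_const 1
  have h00 : MemLp (fun x => 1 + HH M a c Φ (prj i0 i1 x)) q (mu d) := h0.add (memLp_prj h01 hq)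
  have h1 : MemLp (fun x => C * (1 + HH M a c Φ (prj i0 i1 x))) q (mu d) := h00.const_mul C
  have hm : Measurable (A i0 i1 ℓ (psi M a c Φ) (GG M a c Φ)) :=
    measurable_A (measurable_psi D) measurable_GG
  refine h1.of_le hm.aestronglyMeasurable ?_
  filter_upwards [ae_prj h01 (ae_GG_le D)] with x hx
  have h3 := (hC _ hB (GG M a c Φ) x).1
  have h4 : C * (1 + ‖GG M a c Φ (prj i0 i1 x)‖) ≤ C * (1 + HH M a c Φ (prj i0 i1 x)) :=
    mul_le_mul_of_nonneg_left (by linarith) hC0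
  exact h3.trans (h4.trans (le_abs_self _))

lemma integrable_A (h01 : i0 ≠ i1) (D : Dat M a c Φ) :
    Integrable (A i0 i1 ℓ (psi M a c Φ) (GG M a c Φ)) (mu d) :=
  memLp_one_iff_integrable.1 (memLp_A h01 D (memLp_one_iff_integrable.2 (integrable_HH D)))

lemma integrable_A0 :
    Integrable (A i0 i1 ℓ (fun _ => 0) (fun _ => 0)) (mu d) := by
  obtain ⟨C, hC0, hC⟩ := A_bound i0 i1 ℓ 0
  refine (integrable_const C).mono'
    (measurable_A measurable_const measurable_const).aestronglyMeasurable
    (Eventually.of_forall fun x => ?_)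
  have := (hC (fun _ => 0) (by simp) (fun _ => 0) x).1
  simpa using this

lemma A_apply (ψ : Z → ℝ) (G : Z → Z →L[ℝ] ℝ) (x v : E d) :
    A i0 i1 ℓ ψ G x v = (ℓ (prj i0 i1 x) + ψ (prj i0 i1 x)) * fderiv ℝ (chi d) x v +
      chi d x * (ℓ + G (prj i0 i1 x)) (prj i0 i1 v) := rfl

lemma dchi_Q {x : E d} (hx : prj i0 i1 x ∈ Q) :
    fderiv ℝ (chi d) x (ee i0) = 0 ∧ fderiv ℝ (chi d) x (ee i1) = 0 := by
  rw [prj_apply] at hx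
  obtain ⟨⟨h1, h2⟩, h3, h4⟩ := hx
  simp only at h1 h2 h3 h4
  exact ⟨dchi_dir (abs_lt.2 ⟨by linarith, by linarith⟩),
    dchi_dir (abs_lt.2 ⟨by linarith, by linarith⟩)⟩

lemma A_Q {ψ : Z → ℝ} {G : Z → Z →L[ℝ] ℝ} {x : E d} (hx : prj i0 i1 x ∈ Q) :
    A i0 i1 ℓ ψ G x (ee i0) = chi d x * (ℓ + G (prj i0 i1 x)) (prj i0 i1 (ee i0)) ∧
    A i0 i1 ℓ ψ G x (ee i1) = chi d x * (ℓ + G (prj i0 i1 x)) (prj i0 i1 (ee i1)) := by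
  rw [A_apply, A_apply, (dchi_Q hx).1, (dchi_Q hx).2]
  constructor <;> ring

lemma A_off (D : Dat M a c Φ) {x : E d} (hx : prj i0 i1 x ∉ closure Q) :
    A i0 i1 ℓ (psi M a c Φ) (GG M a c Φ) x = A i0 i1 ℓ (fun _ => 0) (fun _ => 0) x := by
  rw [A, A, psi_zero_off D _ (fun h => hx (subset_closure h)), GG_off D hx]

end
end Lav

namespace Lav
section
variable {d : ℕ} {i0 i1 : Fin d}
variable {ι : Type} [Fintype ι] {M c c' : ℝ} {a : ι → Z} {Φ Φ' : Z → ℝ}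

lemma prj_e0 (h01 : i0 ≠ i1) : prj i0 i1 (ee i0) = (2, 0) := by
  rw [prj_apply]; simp [h01.symm]

lemma prj_e1 (h01 : i0 ≠ i1) : prj i0 i1 (ee i1) = (0, 2) := by
  rw [prj_apply]; simp [h01]

/-- The smooth Jacobian. -/
def JJ (i0 i1 : Fin d) (x : E d) : ℝ :=
  A i0 i1 L1 (fun _ => 0) (fun _ => 0) x (ee i1) * A i0 i1 L2 (fun _ => 0) (fun _ => 0) x (ee i0) -
  A i0 i1 L1 (fun _ => 0) (fun _ => 0) x (ee i0) * A i0 i1 L2 (fun _ => 0) (fun _ => 0) x (ee i1)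

lemma fderiv_U0 {ℓ : Z →L[ℝ] ℝ} : fderiv ℝ (U i0 i1 ℓ (fun _ => 0)) =
    A i0 i1 ℓ (fun _ => 0) (fun _ => 0) := by
  ext1 x
  rw [fderiv_U (differentiableAt_const _)]
  simp only [A, fderiv_const_apply]

lemma smooth_U0 {ℓ : Z →L[ℝ] ℝ} : ContDiff ℝ (⊤ : ℕ∞) (U i0 i1 ℓ (fun _ => 0)) :=
  contDiff_chi.mul ((ℓ.comp (prj i0 i1)).contDiff.add contDiff_const)

lemma supp_U0 {ℓ : Z →L[ℝ] ℝ} : HasCompactSupport (U i0 i1 ℓ (fun _ => 0)) :=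
  HasCompactSupport.intro (isCompact_KK (3/4)) fun _ hx => U_zero hx

lemma JJ_int : Integrable (JJ i0 i1) (mu d) ∧ ∫ x, JJ i0 i1 x ∂(mu d) = 0 := by
  constructor
  · have hsm : ContDiff ℝ (⊤ : ℕ∞) (fderiv ℝ (U i0 i1 L2 (fun _ => 0))) :=
      smooth_U0.fderiv_right (by simp)
    have hsi : ∀ i, Continuous fun x => fderiv ℝ (U i0 i1 L2 (fun _ => 0)) x (ee i) := fun i =>
      (hsm.clm_apply contDiff_const).continuous
    have hss : ∀ i, HasCompactSupport fun x => fderiv ℝ (U i0 i1 L2 (fun _ => 0)) x (ee i) :=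
      fun i => (supp_U0.fderiv (𝕜 := ℝ)).comp_left (g := fun L : E d →L[ℝ] ℝ => L (ee i)) rfl
    rw [fderiv_U0] at hsi hss
    exact (integrable_apply_mul integrable_A0 (hsi i0) (hss i0) _).sub
      (integrable_apply_mul integrable_A0 (hsi i1) (hss i1) _)
  · have := divfree_smooth (i0 := i0) (i1 := i1) (WF_zero (i0 := i0) (i1 := i1) (ℓ := L1))
      integrable_A0 (smooth_U0 (i0 := i0) (i1 := i1) (ℓ := L2)) supp_U0
    rwa [fderiv_U0] at this

lemma JJ_Q (h01 : i0 ≠ i1) {x : E d} (hx : prj i0 i1 x ∈ Q) :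
    JJ i0 i1 x = - (4 * chi d x ^ 2) := by
  rw [JJ, (A_Q hx).1, (A_Q hx).2, (A_Q hx).1, (A_Q hx).2, prj_e0 h01, prj_e1 h01]
  simp only [add_zero, ContinuousLinearMap.coe_fst', ContinuousLinearMap.coe_snd']
  ring

lemma pos_int (i0 i1 : Fin d) : Integrable ((prj i0 i1 ⁻¹' Q).indicator fun x => 4 * chi d x ^ 2)
    (mu d) ∧ 0 < ∫ x, (prj i0 i1 ⁻¹' Q).indicator (fun x => 4 * chi d x ^ 2) x ∂(mu d) := by
  have hQo : IsOpen (prj i0 i1 ⁻¹' Q) := isOpen_Q.preimage (prj i0 i1).continuous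
  have hcc : Continuous (chi d) := contDiff_chi.continuous
  have hi : Integrable ((prj i0 i1 ⁻¹' Q).indicator fun x => 4 * chi d x ^ 2) (mu d) := by
    refine Integrable.indicator ?_ hQo.measurableSet
    refine (integrable_const (4:ℝ)).mono' (by fun_prop) (Eventually.of_forall fun x => ?_)
    have h0 := chi_nonneg x
    have h1 := chi_le_one x
    rw [Real.norm_eq_abs, abs_of_nonneg (by positivity)]
    nlinarith
  refine ⟨hi, ?_⟩
  rw [integral_pos_iff_support_of_nonneg (fun x => indicator_nonneg (fun x _ => by positivity) x) hi]
  set W : Set (E d) := prj i0 i1 ⁻¹' Q ∩ {x | chi d x ≠ 0} with hW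
  have hWo : IsOpen W := hQo.inter (isOpen_ne_fun hcc continuous_const)
  have hsub : W ∩ cube d ⊆ Function.support ((prj i0 i1 ⁻¹' Q).indicator
      fun x => 4 * chi d x ^ 2) ∩ cube d := by
    rintro x ⟨⟨h1, h2⟩, h3⟩
    refine ⟨?_, h3⟩
    rw [Function.mem_support, indicator_of_mem h1]
    have h2' : chi d x ≠ 0 := h2
    positivity
  rw [Measure.restrict_apply' isOpen_cube.measurableSet]
  refine lt_of_lt_of_le ?_ (measure_mono hsub)
  refine (hWo.inter isOpen_cube).measure_pos _ ⟨WithLp.toLp 2 fun _ => 1/4, ⟨?_, ?_⟩, ?_⟩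
  · rw [mem_preimage, prj_apply]
    norm_num [Q]
  · have : chi d (WithLp.toLp 2 fun _ => 1/4) = 1 := by
      refine Finset.prod_eq_one fun i _ => bump.one_of_mem_closedBall ?_
      simp only [bump, mem_closedBall, Real.dist_eq]
      norm_num [abs_le]
    change chi d (WithLp.toLp 2 fun _ => 1/4) ≠ 0
    rw [this]; norm_num
  · intro i
    norm_num

lemma main_int (h01 : i0 ≠ i1) (DU : Dat M a c Φ) (DW : Dat M a c' Φ')
    (hdis : ∀ᵐ z : Z, z ∈ Q → L1 + GG M a c Φ z = 0 ∨ L2 + GG M a c' Φ' z = 0) :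
    0 < ∫ x, ⟪bvec i0 i1 (A i0 i1 L1 (psi M a c Φ) (GG M a c Φ) x),
      gvec (A i0 i1 L2 (psi M a c' Φ') (GG M a c' Φ') x)⟫ ∂(mu d) := by
  have h := pos_int i0 i1
  have e : ∫ x, ⟪bvec i0 i1 (A i0 i1 L1 (psi M a c Φ) (GG M a c Φ) x),
      gvec (A i0 i1 L2 (psi M a c' Φ') (GG M a c' Φ') x)⟫ ∂(mu d) =
      ∫ x, (JJ i0 i1 x + (prj i0 i1 ⁻¹' Q).indicator (fun x => 4 * chi d x ^ 2) x) ∂(mu d) := by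
    refine integral_congr_ae ?_
    filter_upwards [ae_prj h01 ae_Q, ae_prj h01 hdis] with x h1 h2
    rw [inner_b]
    rcases h1 with h1 | h1
    · rw [indicator_of_mem (s := prj i0 i1 ⁻¹' Q) h1, JJ_Q h01 h1, (A_Q h1).1, (A_Q h1).2, (A_Q h1).1, (A_Q h1).2]
      rcases h2 h1 with h2 | h2
      · rw [h2]; simp
      · rw [h2]; simp
    · rw [indicator_of_notMem (s := prj i0 i1 ⁻¹' Q) (fun h => h1 (subset_closure h)), A_off DU h1, A_off DW h1, add_zero]
      rfl
  rw [e, integral_add JJ_int.1 h.1, JJ_int.2, zero_add]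
  exact h.2

end
end Lav

namespace Lav
section

lemma params {pm pp : ℝ} (hpm : 1 < pm) (hpmpp : pm < pp) : ∃ n1 n2 M : ℕ,
    2 ≤ n1 ∧ 2 ≤ n2 ∧ n1 < M ∧ n2 < M ∧
    (Fintype.card (Fin n1 × Fin n2) : ℝ) * (M:ℝ)⁻¹ ^ 2 * ((n1:ℝ)⁻¹ * M) ^ (pp / (pp - 1)) < 1 ∧
    (Fintype.card (Fin n1 × Fin n2) : ℝ) * (M:ℝ)⁻¹ ^ 2 * ((n2:ℝ)⁻¹ * M) ^ pm < 1 := by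
  have h1 : 0 < pm - 1 := by linarith
  have h2 : 0 < pp - 1 := by linarith
  have hlt : (2:ℝ) ^ (-(1 / (pm - 1))) < (2:ℝ) ^ (-(1 / (pp - 1))) := by
    refine Real.rpow_lt_rpow_of_exponent_lt (by norm_num) ?_
    rw [neg_lt_neg_iff]
    exact one_div_lt_one_div_of_lt h1 (by linarith)
  obtain ⟨r, hr1, hr2⟩ := exists_rat_btwn hlt
  have hr0 : (0:ℝ) < r := (Real.rpow_pos_of_pos two_pos _).trans hr1
  have hr0' : 0 < r := by exact_mod_cast hr0
  have hrlt : (r:ℝ) < 1 := hr2.trans (Real.rpow_lt_one_of_one_lt_of_neg (by norm_num)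
    (by rw [neg_lt_zero]; positivity))
  have hnum : 0 < r.num := Rat.num_pos.2 hr0'
  obtain ⟨a, ha⟩ := Int.eq_ofNat_of_zero_le hnum.le
  have ha0 : 0 < a := by omega
  have hb0 : 0 < r.den := r.den_pos
  have hbR : (0:ℝ) < r.den := by exact_mod_cast hb0
  have hrab : (r:ℝ) = a / r.den := by
    rw [Rat.cast_def, ha]; simp
  have hab : a < r.den := by
    rw [hrab, div_lt_one hbR] at hrlt
    exact_mod_cast hrlt
  have haR : (0:ℝ) < a := by exact_mod_cast ha0
  refine ⟨2 * r.den, 4 * a, 4 * r.den, by omega, by omega, by omega, by omega, ?_, ?_⟩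
  · have e1 : (Fintype.card (Fin (2 * r.den) × Fin (4 * a)) : ℝ) * ((4 * r.den : ℕ):ℝ)⁻¹ ^ 2 =
        r / 2 := by
      rw [hrab]
      simp only [Fintype.card_prod, Fintype.card_fin]
      push_cast
      field_simp
      norm_num
    have e2 : (((2 * r.den : ℕ):ℝ)⁻¹ * (4 * r.den : ℕ)) = 2 := by
      push_cast
      field_simp
      norm_num
    rw [e1, e2]
    have e3 : (2:ℝ) ^ (pp / (pp - 1)) = 2 * 2 ^ (1 / (pp - 1)) := by
      rw [← Real.rpow_one_add' (by norm_num) (by positivity)]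
      congr 1
      field_simp
      ring
    rw [e3]
    rw [Real.rpow_neg (by norm_num), ← one_div, lt_div_iff₀ (by positivity)] at hr2
    linarith
  · have e1 : (Fintype.card (Fin (2 * r.den) × Fin (4 * a)) : ℝ) * ((4 * r.den : ℕ):ℝ)⁻¹ ^ 2 =
        r / 2 := by
      rw [hrab]
      simp only [Fintype.card_prod, Fintype.card_fin]
      push_cast
      field_simp
      norm_num
    have e2 : (((4 * a : ℕ):ℝ)⁻¹ * (4 * r.den : ℕ)) = (r:ℝ)⁻¹ := by
      rw [hrab]
      push_cast
      field_simp
    rw [e1, e2]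
    have e3 : (1:ℝ) / 2 < (r:ℝ) ^ (pm - 1) := by
      have := Real.rpow_lt_rpow (by positivity) hr1 h1
      rw [← Real.rpow_mul (by norm_num)] at this
      have e4 : -(1 / (pm - 1)) * (pm - 1) = -1 := by field_simp
      rw [e4, Real.rpow_neg_one] at this
      linarith
    rw [Real.rpow_sub hr0, Real.rpow_one, lt_div_iff₀ hr0] at e3
    rw [Real.inv_rpow hr0.le, ← div_eq_mul_inv, div_lt_one (by positivity)]
    linarith

lemma small {pm I B : ℝ} (hpm : 1 < pm) (hI : 0 < I) : ∃ t : ℝ, 0 < t ∧ t ≤ 1 ∧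
    t ^ pm * B - t * I < 0 := by
  have hc : Tendsto (fun t : ℝ => t ^ (pm - 1) * B) (𝓝[>] 0) (𝓝 ((0:ℝ) ^ (pm - 1) * B)) := by
    refine (Tendsto.mul_const _ ?_).mono_left nhdsWithin_le_nhds
    exact (Real.continuousAt_rpow_const 0 _ (Or.inr (by linarith))).tendsto
  rw [Real.zero_rpow (by linarith), zero_mul] at hc
  have h1 : ∀ᶠ t : ℝ in 𝓝[>] 0, t ≤ 1 :=
    nhdsWithin_le_nhds (Iic_mem_nhds one_pos)
  obtain ⟨t, h2, h3, h4⟩ := ((hc.eventually_lt_const hI).and (h1.and self_mem_nhdsWithin)).exists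
  have h4' : 0 < t := h4
  refine ⟨t, h4', h3, ?_⟩
  rw [Real.rpow_sub h4', Real.rpow_one] at h2
  have : t ^ pm * B = t * (t ^ pm / t * B) := by field_simp
  rw [this]
  nlinarith

end
end Lav

namespace Lav
section

lemma core (d : ℕ) (pm pp : ℝ) (hpm : 1 < pm) (hpmpp : pm < pp) {i0 i1 : Fin d} (h01 : i0 ≠ i1)
    {ι : Type} [Fintype ι] {M c c' : ℝ} {a : ι → Z} {Φ Φ' : Z → ℝ}
    (DU : Dat M a c Φ) (DW : Dat M a c' Φ')
    (hdis : ∀ᵐ z : Z, z ∈ Q → L1 + GG M a c Φ z = 0 ∨ L2 + GG M a c' Φ' z = 0)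
    (hU : MemLp (HH M a c Φ) (ENNReal.ofReal (pp / (pp - 1))))
    (hW : MemLp (HH M a c' Φ') (ENNReal.ofReal pm)) :
    ∃ p : E d → ℝ, Measurable p ∧ (∀ x ∈ cube d, p x ∈ Set.Icc pm pp) ∧
      ∃ b0 : E d → E d,
        IntegrableOn b0 (cube d) volume ∧
        (∃ K : Set (E d), IsCompact K ∧ K ⊆ cube d ∧ ∀ x ∉ K, b0 x = 0) ∧
        IntegrableOn (fun x => ‖b0 x‖ ^ (p x / (p x - 1))) (cube d) volume ∧
        (∀ v : E d → ℝ, ContDiffOn ℝ (⊤ : ℕ∞) v (cube d) →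
          ∫ x in cube d, ⟪b0 x, gradient v x⟫ = 0) ∧
        (∀ v : E d → ℝ, ContDiff ℝ (⊤ : ℕ∞) v → HasCompactSupport v → tsupport v ⊆ cube d →
          0 ≤ (∫ x in cube d, (1 / p x) * ‖gradient v x‖ ^ p x) +
                ∫ x in cube d, ⟪b0 x, gradient v x⟫) ∧
        ((∫ x in cube d, (1 / p x) * ‖gradient (fun _ : E d => (0:ℝ)) x‖ ^ p x) +
            (∫ x in cube d, ⟪b0 x, gradient (fun _ : E d => (0:ℝ)) x⟫) = 0) ∧
        (∃ (w : E d → ℝ) (g : E d → E d), MemW011 d w g ∧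
          IntegrableOn (fun x => ‖g x‖ ^ p x) (cube d) volume ∧
          (∫ x in cube d, (1 / p x) * ‖g x‖ ^ p x) +
              (∫ x in cube d, ⟪b0 x, g x⟫) < 0) := by
  classical
  have hpp : 1 < pp := hpm.trans hpmpp
  set aU : E d → E d →L[ℝ] ℝ := A i0 i1 L1 (psi M a c Φ) (GG M a c Φ) with haU
  set aW : E d → E d →L[ℝ] ℝ := A i0 i1 L2 (psi M a c' Φ') (GG M a c' Φ') with haW
  have hmU : Measurable aU := measurable_A (measurable_psi DU) measurable_GG
  have hmW : Measurable aW := measurable_A (measurable_psi DW) measurable_GG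
  have hiU : Integrable aU (mu d) := integrable_A h01 DU
  have hiW : Integrable aW (mu d) := integrable_A h01 DW
  set S : Set (E d) := prj i0 i1 ⁻¹' {z | z ∈ Q ∧ L2 + GG M a c' Φ' z ≠ 0} with hS
  have hSm : MeasurableSet S := by
    refine (prj i0 i1).continuous.measurable (isOpen_Q.measurableSet.inter ?_)
    exact (measurableSet_singleton _).compl.preimage (measurable_GG.const_add _)
  set p : E d → ℝ := S.piecewise (fun _ => pm) (fun _ => pp) with hp
  have hpm' : Measurable p := Measurable.piecewise hSm measurable_const measurable_const
  have hpS : ∀ x ∈ S, p x = pm := fun x hx => piecewise_eq_of_mem _ _ _ hx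
  have hpS' : ∀ x ∉ S, p x = pp := fun x hx => piecewise_eq_of_notMem _ _ _ hx
  have hpI : ∀ x, p x ∈ Icc pm pp := by
    intro x
    by_cases hx : x ∈ S
    · rw [hpS x hx]; exact ⟨le_rfl, hpmpp.le⟩
    · rw [hpS' x hx]; exact ⟨hpmpp.le, le_rfl⟩
  have hp1 : ∀ x, 1 < p x := fun x => hpm.trans_le (hpI x).1
  have hbm : Measurable fun x => bvec i0 i1 (aU x) := continuous_bvec.measurable.comp hmU
  have hgm : Measurable fun x => gvec (aW x) := continuous_gvec.measurable.comp hmW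
  have hq1 : 0 < pp / (pp - 1) := div_pos (by linarith) (by linarith)
  -- integrability of the dual field
  have hbLq : Integrable (fun x => ‖bvec i0 i1 (aU x)‖ ^ (pp / (pp - 1))) (mu d) := by
    have h1 : MemLp (fun x => bvec i0 i1 (aU x)) (ENNReal.ofReal (pp / (pp - 1))) (mu d) := by
      refine (memLp_A (ℓ := L1) h01 DU hU).of_le_mul (c := 2) hbm.aestronglyMeasurable
        (Eventually.of_forall fun x => norm_bvec _)
    have := h1.integrable_norm_rpow (by simpa using hq1) ENNReal.ofReal_ne_top
    rwa [ENNReal.toReal_ofReal hq1.le] at this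
  have hbint : Integrable (fun x => bvec i0 i1 (aU x)) (mu d) :=
    (hiU.norm.const_mul 2).mono' hbm.aestronglyMeasurable
      (Eventually.of_forall fun x => norm_bvec _)
  have hbS : ∀ᵐ x ∂(mu d), x ∈ S → bvec i0 i1 (aU x) = 0 := by
    filter_upwards [ae_prj h01 hdis] with x h1 hx
    have hx' : prj i0 i1 x ∈ Q ∧ L2 + GG M a c' Φ' (prj i0 i1 x) ≠ 0 := hx
    have h2 := (h1 hx'.1).resolve_right hx'.2
    rw [bvec, haU, (A_Q hx'.1).1, (A_Q hx'.1).2, h2]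
    simp
  have hbp : Integrable (fun x => ‖bvec i0 i1 (aU x)‖ ^ (p x / (p x - 1))) (mu d) := by
    refine hbLq.mono' (Measurable.aestronglyMeasurable (by fun_prop)) ?_
    filter_upwards [hbS] with x hx
    rw [Real.norm_eq_abs, abs_of_nonneg (by positivity)]
    by_cases hxS : x ∈ S
    · rw [hx hxS, norm_zero, Real.zero_rpow, Real.zero_rpow hq1.ne']
      have := hp1 x
      exact (div_pos (by linarith) (by linarith)).ne'
    · rw [hpS' x hxS]
  -- integrability of the gradient
  have hgLq : Integrable (fun x => ‖gvec (aW x)‖ ^ pm) (mu d) := by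
    have := (memLp_A (ℓ := L2) h01 DW hW).integrable_norm_rpow (by simp; linarith)
      ENNReal.ofReal_ne_top
    rw [ENNReal.toReal_ofReal (by linarith)] at this
    simpa only [norm_gvec] using this
  obtain ⟨B, hB⟩ := psi_bound DW
  obtain ⟨C, hC0, hC⟩ := A_bound i0 i1 L2 B
  have hgp : Integrable (fun x => ‖gvec (aW x)‖ ^ p x) (mu d) := by
    refine (hgLq.add (integrable_const (C ^ pp))).mono'
      (Measurable.aestronglyMeasurable (by fun_prop)) ?_
    filter_upwards [ae_prj h01 ae_Q] with x hx
    rw [Real.norm_eq_abs, abs_of_nonneg (by positivity)]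
    simp only [Pi.add_apply]
    by_cases hxS : x ∈ S
    · rw [hpS x hxS]
      have : 0 ≤ C ^ pp := by positivity
      linarith
    · rw [hpS' x hxS, norm_gvec]
      have h2 : ‖aW x‖ ≤ C := by
        rcases hx with hx | hx
        · have h3 : L2 + GG M a c' Φ' (prj i0 i1 x) = 0 := by
            by_contra hne
            exact hxS ⟨hx, hne⟩
          exact (hC _ hB _ x).2 h3
        · have h3 := (hC _ hB (GG M a c' Φ') x).1
          rw [GG_off DW hx, norm_zero, add_zero, mul_one] at h3
          exact h3
      have h4 : ‖aW x‖ ^ pp ≤ C ^ pp := Real.rpow_le_rpow (norm_nonneg _) h2 (by linarith)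
      have h5 : 0 ≤ ‖aW x‖ ^ pm := by positivity
      linarith
  have hdiv : ∀ v : E d → ℝ, ContDiffOn ℝ (⊤ : ℕ∞) v (cube d) →
      ∫ x in cube d, ⟪bvec i0 i1 (aU x), gradient v x⟫ = 0 := fun v hv =>
    divfree (WF_dat h01 DU) hiU (fun x hx => A_zero hx) hv
  refine ⟨p, hpm', fun x _ => hpI x, fun x => bvec i0 i1 (aU x), hbint,
    ⟨KK d (3/4), isCompact_KK _, KK_sub (by norm_num), fun x hx => ?_⟩, hbp, hdiv, ?_, ?_, ?_⟩
  · simp only [haU, A_zero hx, bvec]; simp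
  · intro v hv _ _
    rw [hdiv v hv.contDiffOn, add_zero]
    refine integral_nonneg fun x => ?_
    have := hp1 x
    simp only [Pi.zero_apply]
    positivity
  · rw [hdiv _ contDiffOn_const, add_zero]
    refine integral_eq_zero_of_ae (Eventually.of_forall fun x => ?_)
    have := hp1 x
    simp only [Pi.zero_apply]
    rw [gradient_fun_const, norm_zero, Real.zero_rpow (by linarith), mul_zero]
  · set I := ∫ x, ⟪bvec i0 i1 (aU x), gvec (aW x)⟫ ∂(mu d) with hI
    have hIpos : 0 < I := main_int h01 DU DW hdis
    set T := ∫ x, ‖gvec (aW x)‖ ^ p x ∂(mu d) with hT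
    obtain ⟨t, ht0, ht1, ht⟩ := small (B := T) hpm hIpos
    have hnorm : ∀ x, ‖(-t) • gvec (aW x)‖ ^ p x = t ^ p x * ‖gvec (aW x)‖ ^ p x := by
      intro x
      rw [norm_smul, norm_neg, Real.norm_of_nonneg ht0.le, Real.mul_rpow ht0.le (norm_nonneg _)]
    have htp : ∀ x, t ^ p x ≤ t ^ pm := fun x =>
      Real.rpow_le_rpow_of_exponent_ge ht0 ht1 (hpI x).1
    have htpm : t ^ pm ≤ 1 := Real.rpow_le_one ht0.le ht1 (by linarith)
    have hgi : Integrable (fun x => gvec (aW x)) (mu d) :=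
      hiW.norm.mono' hgm.aestronglyMeasurable (Eventually.of_forall fun x => (norm_gvec _).le)
    have hwi : Integrable (U i0 i1 L2 (psi M a c' Φ')) (mu d) := by
      obtain ⟨C1, hC1⟩ := U_bound i0 i1 L2 B
      refine (integrable_const C1).mono' ?_ (Eventually.of_forall fun x => hC1 _ hB x)
      have hp' : Measurable (prj i0 i1) := (prj i0 i1).continuous.measurable
      exact (contDiff_chi.continuous.measurable.mul ((L2.continuous.measurable.comp hp').add
        ((measurable_psi DW).comp hp'))).aestronglyMeasurable
    have hgi' : Integrable (fun x => (-t) • gvec (aW x)) (mu d) := hgi.smul (-t)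
    refine ⟨fun x => (-t) * U i0 i1 L2 (psi M a c' Φ') x, fun x => (-t) • gvec (aW x),
      ⟨hwi.const_mul _, hgi', ?_⟩, ?_, ?_⟩
    · intro ξ hξ hξs i
      have h1 := WF_dat (ℓ := L2) h01 DW ξ hξ hξs (ee i)
      have h2 : ∀ x, ((-t) • gvec (aW x)) i * ξ x = (-t) * (aW x (ee i) * ξ x) := by
        intro x
        rw [PiLp.smul_apply, gvec_apply, smul_eq_mul, mul_assoc]
      simp only [h2, mul_assoc]
      rw [integral_const_mul, integral_const_mul]
      have h3 := congrArg (fun y => (-t) * y) h1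
      refine h3.trans ?_
      ring
    · refine Integrable.mono' hgp (Measurable.aestronglyMeasurable ?_)
        (Eventually.of_forall fun x => ?_)
      · exact ((hgm.const_smul (-t)).norm).pow hpm'
      · rw [hnorm, Real.norm_eq_abs, abs_of_nonneg (by positivity)]
        have h6 : 0 ≤ ‖gvec (aW x)‖ ^ p x := by positivity
        nlinarith [htp x]
    · have e1 : ∫ x in cube d, ⟪bvec i0 i1 (aU x), (-t) • gvec (aW x)⟫ = (-t) * I := by
        simp only [inner_smul_right]
        rw [integral_const_mul]
      have e2 : ∫ x in cube d, (1 / p x) * ‖(-t) • gvec (aW x)‖ ^ p x ≤ t ^ pm * T := by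
        rw [hT, ← integral_const_mul]
        refine integral_mono_of_nonneg (Eventually.of_forall fun x => ?_) (hgp.const_mul _)
          (Eventually.of_forall fun x => ?_)
        · have := hp1 x
          simp only [Pi.zero_apply]
          positivity
        · simp only
          rw [hnorm, ← mul_assoc]
          have h6 : 0 ≤ ‖gvec (aW x)‖ ^ p x := by positivity
          refine mul_le_mul_of_nonneg_right ?_ h6
          have h7 : 1 / p x ≤ 1 := by
            rw [div_le_one (by linarith [hp1 x])]; exact (hp1 x).le
          have h8 : 0 ≤ t ^ p x := by positivity
          calc 1 / p x * t ^ p x ≤ 1 * t ^ p x := mul_le_mul_of_nonneg_right h7 h8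
            _ ≤ t ^ pm := by rw [one_mul]; exact htp x
      rw [e1]
      linarith

end
end Lav

/-- Theorem: Lavrentiev gap for a variable exponent.
Let `Ω = (−1,1)^d`, `d ≥ 2`, `1 < p⁻ < p⁺ < ∞`. There are a measurable exponent
`p : Ω → [p⁻,p⁺]` and a vector field `b° ∈ L^1(Ω;ℝ^d)` supported in a compact subset
of `Ω` with `∫_Ω |b°|^{p(x)/(p(x)−1)} dx < ∞` such that:
(i) `∫_Ω b°·∇v dx = 0` for every `v ∈ C^∞(Ω)`, hence
`G(v) = ∫_Ω (1/p(x))|∇v|^{p(x)} dx + ∫_Ω b°·∇v dx ≥ 0` for every `v ∈ C_c^∞(Ω)`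
and `G(0) = 0`; (ii) there is `w ∈ W_0^{1,1}(Ω)` (with weak gradient `g`) with
`∫_Ω |∇w|^{p(x)} dx < ∞` and `G(w) < 0`. Thus `G` has a Lavrentiev gap:
`inf G(W_0^{1,p(·)}(Ω)) < inf G(H_0^{1,p(·)}(Ω)) = 0`. -/
theorem statement_16 (d : ℕ) (hd : 2 ≤ d) (pm pp : ℝ) (hpm : 1 < pm) (hpmpp : pm < pp) :
    ∃ p : E d → ℝ, Measurable p ∧ (∀ x ∈ cube d, p x ∈ Set.Icc pm pp) ∧
      ∃ b0 : E d → E d,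
        IntegrableOn b0 (cube d) volume ∧
        (∃ K : Set (E d), IsCompact K ∧ K ⊆ cube d ∧ ∀ x ∉ K, b0 x = 0) ∧
        IntegrableOn (fun x => ‖b0 x‖ ^ (p x / (p x - 1))) (cube d) volume ∧
        (∀ v : E d → ℝ, ContDiffOn ℝ (⊤ : ℕ∞) v (cube d) →
          ∫ x in cube d, ⟪b0 x, gradient v x⟫ = 0) ∧
        (∀ v : E d → ℝ, ContDiff ℝ (⊤ : ℕ∞) v → HasCompactSupport v → tsupport v ⊆ cube d →
          0 ≤ (∫ x in cube d, (1 / p x) * ‖gradient v x‖ ^ p x) +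
                ∫ x in cube d, ⟪b0 x, gradient v x⟫) ∧
        ((∫ x in cube d, (1 / p x) * ‖gradient (fun _ : E d => (0:ℝ)) x‖ ^ p x) +
            (∫ x in cube d, ⟪b0 x, gradient (fun _ : E d => (0:ℝ)) x⟫) = 0) ∧
        (∃ (w : E d → ℝ) (g : E d → E d), MemW011 d w g ∧
          IntegrableOn (fun x => ‖g x‖ ^ p x) (cube d) volume ∧
          (∫ x in cube d, (1 / p x) * ‖g x‖ ^ p x) +
              (∫ x in cube d, ⟪b0 x, g x⟫) < 0) := by
  obtain ⟨n1, n2, M, h1, h2, hM1, hM2, hu, hw⟩ := Lav.params hpm hpmpp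
  have hq : 1 ≤ pp / (pp - 1) := by
    rw [le_div_iff₀ (by linarith)]
    linarith
  exact Lav.core d pm pp hpm hpmpp (i0 := ⟨0, by omega⟩) (i1 := ⟨1, by omega⟩) (by simp)
    (Lav.datU h1 h2 hM1 hM2) (Lav.datW h1 h2 hM1 hM2) (Lav.disjoint_grad h1 h2 hM1 hM2)
    (Lav.memLp_HH (Lav.datU h1 h2 hM1 hM2) hq hu)
    (Lav.memLp_HH (Lav.datW h1 h2 hM1 hM2) hpm.le hw)
end
end
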